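/- arXiv:1604.00216 — 6 statements merged into one kernel-verified Lean document; each statement's English description precedes it below -/
import Mathlib

section
/- If U is a universal prefix-free machine, X is a Π⁰₁ set, and Ω_U(X) is a right-c.e. real, then Ω_U(X) is not Martin-Löf random. -/
open Filter MeasureTheory Set

/-- A real is left-c.e. if it is the limit of a computable increasing sequence of rationals. -/
def LeftCE (x : ℝ) : Prop :=
  ∃ f : ℕ → ℚ, Computable f ∧ Monotone f ∧
    Tendsto (fun n => (f n : ℝ)) atTop (nhds x)

/-- A real is right-c.e. if it is the limit of a computable decreasing sequence of rationals. -/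
def RightCE (x : ℝ) : Prop :=
  ∃ f : ℕ → ℚ, Computable f ∧ Antitone f ∧
    Tendsto (fun n => (f n : ℝ)) atTop (nhds x)

/-- The Σ⁰₁ class of reals given by level `i` of the computable enumeration `g` of
rational open intervals. -/
def testSet (g : ℕ → ℕ → ℚ × ℚ) (i : ℕ) : Set ℝ :=
  ⋃ n, Set.Ioo (((g i n).1 : ℝ)) (((g i n).2 : ℝ))

/-- A real is Martin-Löf random if for every Martin-Löf test, i.e. every uniformly c.e.
sequence of Σ⁰₁ classes `(U_i)` with `μ(U_i) ≤ 2⁻¹ ^ i`, the real avoids some level of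
the test. -/
def MLRandom (x : ℝ) : Prop :=
  ∀ g : ℕ → ℕ → ℚ × ℚ, Computable₂ g →
    (∀ i, volume (testSet g i) ≤ 2⁻¹ ^ i) →
    ∃ i, x ∉ testSet g i

/-- A partial function on binary strings has prefix-free domain if no element of the
domain is a proper prefix of another. -/
def PrefixFreeDomain (M : List Bool →. List Bool) : Prop :=
  ∀ σ τ : List Bool, σ <+: τ → (M σ).Dom → (M τ).Dom → σ = τ

/-- A prefix-free machine is a partial computable function from binary strings to binary
strings whose domain is prefix-free. -/
def PrefixFreeMachine (M : List Bool →. List Bool) : Prop :=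
  Partrec M ∧ PrefixFreeDomain M

/-- A prefix-free machine `U` is universal if for every effective list `(M_e)` of
prefix-free machines there is a computable function `e ↦ σ_e` such that
`U (σ_e * τ) ≃ M_e τ` for all strings `τ`. -/
def UniversalPFM (U : List Bool →. List Bool) : Prop :=
  PrefixFreeMachine U ∧
    ∀ M : ℕ → List Bool →. List Bool, Partrec₂ M →
      (∀ e, PrefixFreeDomain (M e)) →
      ∃ g : ℕ → List Bool, Computable g ∧ ∀ e τ, U (g e ++ τ) = M e τ

/-- A predicate is computably enumerable. -/
def CEPred {α : Type*} [Primcodable α] (p : α → Prop) : Prop :=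
  Partrec fun a => Part.assert (p a) fun _ => Part.some ()

/-- A set of binary strings is Π⁰₁ if its complement is computably enumerable. -/
def Pi01 (X : Set (List Bool)) : Prop := CEPred fun σ => σ ∉ X

/-- `Omega U X` is the probability that the prefix-free machine `U` halts and outputs
an element of `X`, i.e. `Ω_U(X) = Σ_{U(σ)↓ ∈ X} 2^{-|σ|}`. -/
noncomputable def Omega (U : List Bool →. List Bool) (X : Set (List Bool)) : ℝ :=
  ∑' σ : {σ : List Bool // ∃ y ∈ U σ, y ∈ X}, (2 : ℝ)⁻¹ ^ (σ : List Bool).length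


namespace OmegaAux

/-- raw code of a rational -/
def rc (q : ℚ) : ℕ := @Encodable.encode ℚ Rat.instEncodable q

def RS : Set ℕ := Set.range rc

lemma rc_inj : Function.Injective rc := @Encodable.encode_injective ℚ Rat.instEncodable

lemma rc_eq (q : ℚ) : rc q = Nat.pair (Encodable.encode q.num) q.den := by
  rfl

lemma encode_int (z : ℤ) : Encodable.encode z = if 0 ≤ z then 2 * z.toNat else 2 * (-z-1).toNat + 1 := by
  cases z with
  | ofNat n => simp; rfl
  | negSucc n => 
    rw [if_neg (by simp)]
    have : (-(Int.negSucc n) - 1).toNat = n := by omega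
    rw [this]; rfl

lemma rc_ofNat_strictMono : StrictMono (fun n => rc (Denumerable.ofNat ℚ n)) := by
  apply strictMono_nat_of_lt_succ
  intro n
  let := @Encodable.decidableRangeEncode ℚ Rat.instEncodable
  let : Infinite (Set.range (@Encodable.encode ℚ Rat.instEncodable)) :=
    Infinite.of_injective _ (Equiv.ofInjective _ (@Encodable.encode_injective ℚ Rat.instEncodable)).injective
  have key : ∀ n, rc (Denumerable.ofNat ℚ n) = (Nat.Subtype.ofNat (Set.range (@Encodable.encode ℚ Rat.instEncodable)) n : ℕ) := by
    intro n
    have h := (@Encodable.equivRangeEncode ℚ Rat.instEncodable).apply_symm_apply (Nat.Subtype.ofNat (Set.range (@Encodable.encode ℚ Rat.instEncodable)) n)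
    have h2 := congrArg Subtype.val h
    exact h2
  rw [key, key]
  exact Nat.Subtype.lt_succ_self _


lemma natAbs_encode (z : ℤ) : (Encodable.encode z + 1) / 2 = z.natAbs := by
  rw [encode_int]; split_ifs <;> omega

lemma mem_RS (m : ℕ) : m ∈ RS ↔ 0 < m.unpair.2 ∧
    ∀ d < m.unpair.2 + 1, ((m.unpair.1 + 1) / 2) % d = 0 → m.unpair.2 % d = 0 → d = 1 := by
  constructor
  · rintro ⟨q, rfl⟩
    rw [rc_eq]
    simp only [Nat.unpair_pair, natAbs_encode]
    refine ⟨q.den_pos, fun d _ h1 h2 => ?_⟩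
    exact Nat.eq_one_of_dvd_coprimes q.reduced (Nat.dvd_of_mod_eq_zero h1)
      (Nat.dvd_of_mod_eq_zero h2)
  · rintro ⟨h1, h2⟩
    have hz : ∃ z : ℤ, Encodable.encode z = m.unpair.1 := by
      exact ⟨Denumerable.ofNat ℤ m.unpair.1, Denumerable.encode_ofNat _⟩
    obtain ⟨z, hz⟩ := hz
    rw [← hz, natAbs_encode] at h2
    have hc : z.natAbs.Coprime m.unpair.2 := by
      apply h2
      · exact Nat.lt_succ_of_le (Nat.gcd_le_right _ h1)
      · exact Nat.mod_eq_zero_of_dvd (Nat.gcd_dvd_left _ _)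
      · exact Nat.mod_eq_zero_of_dvd (Nat.gcd_dvd_right _ _)
    refine ⟨⟨z, m.unpair.2, h1.ne', hc⟩, ?_⟩
    rw [rc_eq]
    simp [hz]

lemma RS_primrec : PrimrecPred (fun m => m ∈ RS) := by
  have e : (fun m => m ∈ RS) = fun m : ℕ => 0 < m.unpair.2 ∧
    ∀ d < m.unpair.2 + 1, ((m.unpair.1 + 1) / 2) % d = 0 → m.unpair.2 % d = 0 → d = 1 := by
    funext m; exact propext (mem_RS m)
  rw [e]
  have u1 : Primrec (fun m : ℕ => m.unpair.1) := Primrec.fst.comp Primrec.unpair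
  have u2 : Primrec (fun m : ℕ => m.unpair.2) := Primrec.snd.comp Primrec.unpair
  have hR : PrimrecRel (fun (d m : ℕ) => ((m.unpair.1 + 1) / 2) % d = 0 → m.unpair.2 % d = 0 → d = 1) := by
    have a1 : PrimrecPred (fun p : ℕ × ℕ => ((p.2.unpair.1 + 1) / 2) % p.1 = 0) :=
      Primrec.eq.comp (Primrec.nat_mod.comp (Primrec.nat_div.comp
        (Primrec.succ.comp (u1.comp Primrec.snd)) (Primrec.const 2)) Primrec.fst) (Primrec.const 0)
    have a2 : PrimrecPred (fun p : ℕ × ℕ => p.2.unpair.2 % p.1 = 0) :=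
      Primrec.eq.comp (Primrec.nat_mod.comp (u2.comp Primrec.snd) Primrec.fst) (Primrec.const 0)
    have a3 : PrimrecPred (fun p : ℕ × ℕ => p.1 = 1) :=
      Primrec.eq.comp Primrec.fst (Primrec.const 1)
    have := (a1.not).or ((a2.not).or a3)
    refine PrimrecPred.of_eq this ?_
    intro p; tauto
  have b := hR.forall_lt
  have b2 : PrimrecPred (fun m : ℕ => ∀ d < m.unpair.2 + 1, ((m.unpair.1 + 1) / 2) % d = 0 → m.unpair.2 % d = 0 → d = 1) :=
    PrimrecRel.comp b (Primrec.succ.comp u2) Primrec.id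
  exact PrimrecPred.and (Primrec.nat_lt.comp (Primrec.const 0) u2) b2

noncomputable def dc (n : ℕ) : ℕ := rc (Denumerable.ofNat ℚ n)

lemma dc_range (m : ℕ) (h : m ∈ RS) : ∃ n, dc n = m := by
  obtain ⟨q, rfl⟩ := h
  exact ⟨@Encodable.encode ℚ Primcodable.toEncodable q, congrArg rc (Denumerable.ofNat_encode q)⟩

lemma dc_computable : Computable dc := by
  classical
  obtain ⟨inst, hRS⟩ := RS_primrec
  have hp : Partrec₂ (fun (_ : ℕ) (p : ℕ × ℕ) =>
      Nat.rfind (fun k => (Part.some (decide (p.2 < k) && decide (k ∈ RS)) : Part Bool))) := by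
    apply Partrec.rfind
    apply Computable.partrec
    apply Primrec.to_comp
    refine Primrec.and.comp ?_ ?_
    · exact PrimrecPred.decide (Primrec.nat_lt.comp (Primrec.snd.comp (Primrec.snd.comp Primrec.fst)) Primrec.snd)
    · exact PrimrecPred.decide (RS_primrec.comp Primrec.snd)
  have := Partrec.nat_rec (f := fun n : ℕ => n) (g := fun _ => Part.some (dc 0)) Computable.id
    (Computable.const (dc 0)).partrec hp
  refine this.of_eq_tot ?_
  intro n
  induction n with
  | zero => simp
  | succ n ih =>
    simp only [Part.mem_bind_iff]
    refine ⟨_, ih, ?_⟩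
    refine Nat.mem_rfind.2 ?_
    constructor
    · simp only [Part.mem_some_iff]
      have : dc n < dc (n+1) := rc_ofNat_strictMono (Nat.lt_succ_self n)
      have h2 : dc (n+1) ∈ RS := ⟨_, rfl⟩
      simp [this, h2]
    · intro m hm
      simp only [Part.mem_some_iff]
      symm
      simp only [Bool.and_eq_false_imp, decide_eq_true_eq, decide_eq_false_iff_not]
      intro h1 h2
      obtain ⟨k, rfl⟩ := dc_range m h2
      have a := rc_ofNat_strictMono.lt_iff_lt.1 h1
      have b := rc_ofNat_strictMono.lt_iff_lt.1 hm
      omega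

lemma rc_computable : Computable rc := by
  have : Computable (fun q : ℚ => dc (@Encodable.encode ℚ Primcodable.toEncodable q)) := dc_computable.comp Computable.encode
  exact this.of_eq (fun q => congrArg rc (Denumerable.ofNat_encode q))

lemma computable_of_rc {h : ℕ → ℚ} (H : Computable (fun i => rc (h i))) : Computable h := by
  have hp : Partrec (fun i : ℕ =>
      Nat.rfind (fun m => (Part.some (decide (dc m = rc (h i))) : Part Bool))) := by
    apply Partrec.rfind
    apply Computable.partrec
    have : Primrec₂ (fun a b : ℕ => decide (a = b)) := PrimrecRel.decide Primrec.eq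
    exact this.to_comp.comp (dc_computable.comp Computable.snd) (H.comp Computable.fst)
  rw [← Computable.encode_iff]
  refine hp.of_eq_tot ?_
  intro i
  refine Nat.mem_rfind.2 ?_
  constructor
  · simp only [Part.mem_some_iff]
    symm
    rw [decide_eq_true_eq]
    exact congrArg rc (Denumerable.ofNat_encode (h i))
  · intro m hm
    simp only [Part.mem_some_iff]
    symm
    rw [decide_eq_false_iff_not]
    intro hh
    have := rc_inj hh
    rw [← this] at hm
    exact lt_irrefl _ (lt_of_lt_of_eq hm (Denumerable.encode_ofNat m))

lemma not_random_zero : ¬ MLRandom 0 := by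
  intro H
  have hpow : Primrec (fun i : ℕ => 2 ^ (i+1)) :=
    (Primrec₂.unpaired'.1 Nat.Primrec.pow).comp (Primrec.const 2) Primrec.succ
  have hden : ∀ i : ℕ, ((1:ℚ) / 2^(i+1)).den = 2^(i+1) ∧ ((1:ℚ) / 2^(i+1)).num = 1 := by
    intro i
    have e : ((1:ℚ) / 2^(i+1)) = ⟨1, 2^(i+1), by positivity, by simp⟩ := by
      rw [Rat.mk_eq_divInt, Rat.divInt_eq_div]; norm_num
    rw [e]; simp
  have hp1 : Computable (fun i : ℕ => (1:ℚ) / 2^(i+1)) := by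
    apply computable_of_rc
    have : Primrec (fun i : ℕ => Nat.pair (Encodable.encode (1:ℤ)) (2^(i+1))) :=
      Primrec₂.natPair.comp (Primrec.const _) hpow
    refine this.to_comp.of_eq ?_
    intro i
    rw [rc_eq, (hden i).1, (hden i).2]
  have hp2 : Computable (fun i : ℕ => -((1:ℚ) / 2^(i+1))) := by
    apply computable_of_rc
    have : Primrec (fun i : ℕ => Nat.pair (Encodable.encode (-1:ℤ)) (2^(i+1))) :=
      Primrec₂.natPair.comp (Primrec.const _) hpow
    refine this.to_comp.of_eq ?_
    intro i
    rw [rc_eq, Rat.neg_den, Rat.neg_num, (hden i).1, (hden i).2]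
  obtain ⟨i, hi⟩ := H (fun i _ => (-((1:ℚ) / 2^(i+1)), (1:ℚ) / 2^(i+1)))
    ((hp2.pair hp1).comp Computable.fst) (by
      intro i
      unfold testSet
      simp only [Set.iUnion_const]
      rw [Real.volume_Ioo]
      have : (((1:ℚ) / 2^(i+1) : ℚ):ℝ) - ((-((1:ℚ) / 2^(i+1)):ℚ):ℝ) = (2⁻¹:ℝ)^i := by
        push_cast
        rw [pow_succ, inv_pow]; field_simp; norm_num
      rw [this, ENNReal.ofReal_pow (by positivity), ENNReal.ofReal_inv_of_pos (by norm_num)]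
      simp)
  apply hi
  unfold testSet
  simp only [Set.iUnion_const, Set.mem_Ioo]
  push_cast
  constructor
  · simp
  · positivity

lemma rightCE_approx {f : ℕ → ℚ} (hf : Computable f) (h0 : ∀ n, 0 ≤ f n) :
    ∃ F : ℕ → ℕ, Computable F ∧ ∀ s, (F s : ℝ) ≤ f s * 2^s ∧ (f s : ℝ) * 2^s ≤ F s + 1 := by
  refine ⟨fun s => ((rc (f s)).unpair.1 / 2 * 2 ^ s) / (rc (f s)).unpair.2, ?_, ?_⟩
  · have hpow : Primrec (fun i : ℕ => 2 ^ i) :=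
      (Primrec₂.unpaired'.1 Nat.Primrec.pow).comp (Primrec.const 2) Primrec.id
    have hc := Computable.unpair.comp (rc_computable.comp hf)
    have h1 := Computable.fst.comp hc
    have h2 := Computable.snd.comp hc
    exact (Primrec.nat_div.to_comp).comp (Primrec.nat_mul.to_comp.comp
      (Primrec.nat_div.to_comp.comp h1 (Computable.const 2)) hpow.to_comp) h2
  · intro s
    simp only [rc_eq, Nat.unpair_pair]
    have hn : 0 ≤ (f s).num := Rat.num_nonneg.2 (h0 s)
    rw [encode_int, if_pos hn, Nat.mul_div_cancel_left _ (by norm_num)]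
    have hd : 0 < (f s).den := (f s).den_pos
    have e : (f s : ℝ) = ((f s).num.toNat : ℝ) / ((f s).den : ℝ) := by
      have : ((f s).num : ℝ) = ((f s).num.toNat : ℝ) := by
        exact_mod_cast (Int.toNat_of_nonneg hn).symm
      rw [← this]; exact_mod_cast (Rat.num_div_den (f s)).symm
    set a := (f s).num.toNat
    set b := (f s).den
    have hb : (0:ℝ) < b := by exact_mod_cast hd
    have e2 : (f s : ℝ) * 2^s = ((a * 2^s : ℕ) : ℝ) / b := by
      rw [e]; push_cast; field_simp
    rw [e2]
    constructor
    · exact Nat.cast_div_le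
    · rw [div_le_iff₀ hb]
      have := Nat.lt_mul_div_succ (a * 2^s) hd
      have h3 : a * 2^s ≤ (a*2^s/b + 1) * b := by rw [Nat.mul_comm _ b]; exact this.le
      exact_mod_cast h3


open Encodable in
lemma partrec_approx {α β : Type} [Primcodable α] [Primcodable β] {f : α →. β} (hf : Partrec f) :
    ∃ u : ℕ → α → Option β, Primrec₂ u ∧
      (∀ s t a b, s ≤ t → u s a = some b → u t a = some b) ∧
      (∀ a b, b ∈ f a ↔ ∃ s, u s a = some b) ∧
      (∀ s a b, u s a = some b → encode a < s) := by
  obtain ⟨c, hc⟩ := Nat.Partrec.Code.exists_code.1 hf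
  refine ⟨fun s a => (Nat.Partrec.Code.evaln s c (encode a)).bind decode, ?_, ?_, ?_, ?_⟩
  · have h1 : Primrec (fun p : ℕ × α => Nat.Partrec.Code.evaln p.1 c (encode p.2)) :=
      Nat.Partrec.Code.primrec_evaln.comp
        ((Primrec.fst.pair (Primrec.const c)).pair (Primrec.encode.comp Primrec.snd))
    exact Primrec.option_bind h1 (Primrec.decode.comp Primrec.snd)
  · intro s t a b hst h
    simp only [Option.bind_eq_some_iff] at h ⊢
    obtain ⟨n, h1, h2⟩ := h
    exact ⟨n, Nat.Partrec.Code.evaln_mono hst h1, h2⟩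
  · intro a b
    have he : c.eval (encode a) = (f a).map encode := by
      rw [hc]; simp
    simp only [Option.bind_eq_some_iff]
    constructor
    · intro hb
      have : encode b ∈ c.eval (encode a) := by
        rw [he]; exact Part.mem_map _ hb
      obtain ⟨k, hk⟩ := Nat.Partrec.Code.evaln_complete.1 this
      exact ⟨k, encode b, hk, encodek b⟩
    · rintro ⟨s, n, h1, h2⟩
      have := Nat.Partrec.Code.evaln_sound h1
      rw [he] at this
      obtain ⟨b', hb', e⟩ := (Part.mem_map_iff _).1 this
      subst e
      rw [encodek] at h2
      cases h2
      exact hb'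
  · intro s a b h
    simp only [Option.bind_eq_some_iff] at h
    obtain ⟨n, h1, h2⟩ := h
    exact Nat.Partrec.Code.evaln_bound h1

/-- stack, emitted strings, precision -/
abbrev St := List (ℕ × List Bool) × List (List Bool) × ℕ

def allStr : ℕ → List (List Bool)
  | 0 => [[]]
  | n+1 => (allStr n).map (List.cons false) ++ (allStr n).map (List.cons true)

def wgt (u : ℕ → List Bool → Option (List Bool)) (v : ℕ → List Bool → Option Unit)
    (s n : ℕ) : ℕ :=
  (((Encodable.decode n : Option (List Bool)).bind fun σ =>
    bif decide (Encodable.encode σ = n) then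
    ((u s σ).bind fun y => bif (v s y).isSome then none else some (2 ^ (s - σ.length))) else none)).getD 0

def num (u : ℕ → List Bool → Option (List Bool)) (v : ℕ → List Bool → Option Unit)
    (s : ℕ) : ℕ := ((List.range s).map (wgt u v s)).foldl (· + ·) 0

def Cond (u : ℕ → List Bool → Option (List Bool)) (nm Fs : ℕ) (ρ : List Bool) (t : ℕ) (st : St) :
    Prop :=
  (∀ τ ∈ st.2.1, (u t (ρ ++ τ)).isSome = true) ∧
  (∀ p ∈ st.1, (u t (ρ ++ p.2)).isSome = false) ∧
  ((nm - Fs) + (Fs - nm)) * 2 ^ st.2.2 ≤ 2 ^ t ∧ st.2.2 ≤ t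

def act (ρ : List Bool) (t : ℕ) (st : St) : St :=
  match st.1 with
  | [] => st
  | (0, τ) :: L => (L, τ :: st.2.1, st.2.2)
  | (j+1, τ) :: L => ((allStr (t + (ρ.length + 3))).map (fun w => (j, τ ++ w)) ++ L, st.2.1,
      st.2.2 + (t + (ρ.length + 3)))

def init (ρ : List Bool) : St := ([(2 ^ (ρ.length + 2), [])], [], ρ.length + 4)

open Classical in
noncomputable def step (u : ℕ → List Bool → Option (List Bool)) (nm Fs : ℕ) (ρ : List Bool) (t : ℕ)
    (st : St) : St :=
  if Cond u nm Fs ρ t st then act ρ t st else st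

noncomputable def run (u : ℕ → List Bool → Option (List Bool)) (v : ℕ → List Bool → Option Unit)
    (F : ℕ → ℕ) (ρ : List Bool) : ℕ → St
  | 0 => init ρ
  | t+1 => step u (num u v t) (F t) ρ t (run u v F ρ t)

lemma primrec_pow : Primrec₂ (fun a b : ℕ => a ^ b) := Primrec₂.unpaired'.1 Nat.Primrec.pow

lemma primrec_allStr : Primrec allStr := by
  have h : Primrec₂ (fun (_ : ℕ) (ih : List (List Bool)) =>
      ih.map (List.cons false) ++ ih.map (List.cons true)) := by
    have c : ∀ b : Bool, Primrec (fun p : ℕ × List (List Bool) => p.2.map (List.cons b)) := fun b =>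
      Primrec.list_map (g := fun (_ : ℕ × List (List Bool)) l => List.cons b l) Primrec.snd
        (Primrec.list_cons.comp (Primrec.const b) Primrec.snd)
    exact Primrec.list_append.comp (c false) (c true)
  refine (Primrec.nat_rec₁ [[]] h).of_eq ?_
  intro n
  induction n with
  | zero => rfl
  | succ n ih => simp only [allStr]; rw [← ih]

lemma primrec_wgt {u : ℕ → List Bool → Option (List Bool)} {v : ℕ → List Bool → Option Unit}
    (hu : Primrec₂ u) (hv : Primrec₂ v) : Primrec₂ (wgt u v) := by
  refine Primrec.option_getD.comp ?_ (Primrec.const 0)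
  refine Primrec.option_bind (Primrec.decode.comp Primrec.snd) ?_
  refine Primrec.cond ?_ ?_ (Primrec.const none)
  · exact PrimrecPred.decide (Primrec.eq.comp (Primrec.encode.comp Primrec.snd) (Primrec.snd.comp Primrec.fst))
  · refine Primrec.option_bind (hu.comp (Primrec.fst.comp Primrec.fst) Primrec.snd) ?_
    refine Primrec.cond ?_ (Primrec.const none) ?_
    · exact Primrec.option_isSome.comp (hv.comp (Primrec.fst.comp (Primrec.fst.comp Primrec.fst)) Primrec.snd)
    · refine Primrec.option_some.comp (primrec_pow.comp (Primrec.const 2) ?_)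
      exact Primrec.nat_sub.comp (Primrec.fst.comp (Primrec.fst.comp Primrec.fst))
        (Primrec.list_length.comp (Primrec.snd.comp Primrec.fst))

lemma primrec_num {u : ℕ → List Bool → Option (List Bool)} {v : ℕ → List Bool → Option Unit}
    (hu : Primrec₂ u) (hv : Primrec₂ v) : Primrec (num u v) := by
  have h : Primrec₂ (fun (_ : ℕ) (p : ℕ × ℕ) => p.1 + p.2) :=
    Primrec.nat_add.comp (Primrec.fst.comp Primrec.snd) (Primrec.snd.comp Primrec.snd)
  exact Primrec.list_foldl (Primrec.list_map Primrec.list_range (primrec_wgt hu hv)) (Primrec.const 0) h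

abbrev Inp := (ℕ × ℕ) × (List Bool × ℕ) × St

lemma primrec_Cond {u : ℕ → List Bool → Option (List Bool)} (hu : Primrec₂ u) :
    PrimrecPred (fun i : Inp => Cond u i.1.1 i.1.2 i.2.1.1 i.2.1.2 i.2.2) := by
  have hst : Primrec (fun i : Inp => i.2.2) := Primrec.snd.comp Primrec.snd
  have hρt : Primrec (fun i : Inp => i.2.1) := Primrec.fst.comp Primrec.snd
  have ht : Primrec (fun i : Inp => i.2.1.2) := Primrec.snd.comp hρt
  have hk : Primrec (fun i : Inp => i.2.2.2.2) := Primrec.snd.comp (Primrec.snd.comp hst)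
  have hE : Primrec (fun i : Inp => i.2.2.2.1) := Primrec.fst.comp (Primrec.snd.comp hst)
  have hS : Primrec (fun i : Inp => i.2.2.1) := Primrec.fst.comp hst
  have r1 : PrimrecRel (fun (τ : List Bool) (q : List Bool × ℕ) => (u q.2 (q.1 ++ τ)).isSome = true) :=
    Primrec.eq.comp (Primrec.option_isSome.comp (hu.comp (Primrec.snd.comp Primrec.snd)
      (Primrec.list_append.comp (Primrec.fst.comp Primrec.snd) Primrec.fst))) (Primrec.const true)
  have r2 : PrimrecRel (fun (p : ℕ × List Bool) (q : List Bool × ℕ) => (u q.2 (q.1 ++ p.2)).isSome = false) :=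
    Primrec.eq.comp (Primrec.option_isSome.comp (hu.comp (Primrec.snd.comp Primrec.snd)
      (Primrec.list_append.comp (Primrec.fst.comp Primrec.snd) (Primrec.snd.comp Primrec.fst)))) (Primrec.const false)
  have c1 := r1.forall_mem_list.comp hE hρt
  have c2 := r2.forall_mem_list.comp hS hρt
  have h11 : Primrec (fun i : Inp => i.1.1) := Primrec.fst.comp Primrec.fst
  have h12 : Primrec (fun i : Inp => i.1.2) := Primrec.snd.comp Primrec.fst
  have c3 : PrimrecPred (fun i : Inp => ((i.1.1 - i.1.2) + (i.1.2 - i.1.1)) * 2 ^ i.2.2.2.2 ≤ 2 ^ i.2.1.2) :=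
    Primrec.nat_le.comp (Primrec.nat_mul.comp (Primrec.nat_add.comp (Primrec.nat_sub.comp h11 h12)
      (Primrec.nat_sub.comp h12 h11)) (primrec_pow.comp (Primrec.const 2) hk))
      (primrec_pow.comp (Primrec.const 2) ht)
  have c4 : PrimrecPred (fun i : Inp => i.2.2.2.2 ≤ i.2.1.2) := Primrec.nat_le.comp hk ht
  exact c1.and (c2.and (c3.and c4))

lemma primrec_act : Primrec (fun i : (List Bool × ℕ) × St => act i.1.1 i.1.2 i.2) := by
  have hst : Primrec (fun i : (List Bool × ℕ) × St => i.2) := Primrec.snd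
  have hk : Primrec (fun i : (List Bool × ℕ) × St => i.2.2.2) := Primrec.snd.comp (Primrec.snd.comp hst)
  have hE : Primrec (fun i : (List Bool × ℕ) × St => i.2.2.1) := Primrec.fst.comp (Primrec.snd.comp hst)
  have hS : Primrec (fun i : (List Bool × ℕ) × St => i.2.1) := Primrec.fst.comp hst
  have hn : Primrec (fun i : (List Bool × ℕ) × St => i.1.2 + (i.1.1.length + 3)) :=
    Primrec.nat_add.comp (Primrec.snd.comp Primrec.fst) (Primrec.nat_add.comp
      (Primrec.list_length.comp (Primrec.fst.comp Primrec.fst)) (Primrec.const 3))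
  have main : Primrec (fun i : (List Bool × ℕ) × St =>
      (@List.casesOn _ (fun _ => St) i.2.1 i.2 (fun p L => (@Nat.casesOn (fun _ => St) p.1 (L, p.2 :: i.2.2.1, i.2.2.2)
        (fun j => ((allStr (i.1.2 + (i.1.1.length + 3))).map (fun w => (j, p.2 ++ w)) ++ L, i.2.2.1,
      i.2.2.2 + (i.1.2 + (i.1.1.length + 3)))) : St)) : St)) := by
    refine Primrec.list_casesOn (h := fun (i : (List Bool × ℕ) × St) (q : (ℕ × List Bool) × List (ℕ × List Bool)) =>
      (@Nat.casesOn (fun _ => St) q.1.1 (q.2, q.1.2 :: i.2.2.1, i.2.2.2)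
        (fun j => ((allStr (i.1.2 + (i.1.1.length + 3))).map (fun w => (j, q.1.2 ++ w)) ++ q.2, i.2.2.1,
      i.2.2.2 + (i.1.2 + (i.1.1.length + 3)))) : St)) hS hst ?_
    refine Primrec.nat_casesOn (Primrec.fst.comp (Primrec.fst.comp Primrec.snd)) ?_ ?_
    · exact (Primrec.snd.comp Primrec.snd).pair ((Primrec.list_cons.comp
        (Primrec.snd.comp (Primrec.fst.comp Primrec.snd)) (hE.comp Primrec.fst)).pair (hk.comp Primrec.fst))
    · refine Primrec.pair (Primrec.list_append.comp (Primrec.list_map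
        (primrec_allStr.comp (hn.comp (Primrec.fst.comp Primrec.fst))) ?_) 
        (Primrec.snd.comp (Primrec.snd.comp Primrec.fst))) (Primrec.pair (hE.comp (Primrec.fst.comp Primrec.fst)) ?_)
      · exact Primrec.pair (Primrec.snd.comp Primrec.fst) (Primrec.list_append.comp
          (Primrec.snd.comp (Primrec.fst.comp (Primrec.snd.comp (Primrec.fst.comp Primrec.fst)))) Primrec.snd)
      · exact Primrec.nat_add.comp (hk.comp (Primrec.fst.comp Primrec.fst)) (hn.comp (Primrec.fst.comp Primrec.fst))
  refine main.of_eq ?_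
  rintro ⟨⟨ρ, t⟩, ⟨S, E, k⟩⟩
  unfold act
  rcases S with _ | ⟨⟨_ | j, τ⟩, L⟩ <;> rfl

lemma primrec_step {u : ℕ → List Bool → Option (List Bool)} (hu : Primrec₂ u) :
    Primrec (fun i : Inp => step u i.1.1 i.1.2 i.2.1.1 i.2.1.2 i.2.2) := by
  classical
  have := Primrec.ite (primrec_Cond hu) (primrec_act.comp Primrec.snd) (Primrec.snd.comp Primrec.snd)
  refine this.of_eq ?_
  intro i
  unfold step
  rfl

attribute [local irreducible] num step in
lemma computable_run {u : ℕ → List Bool → Option (List Bool)} {v : ℕ → List Bool → Option Unit}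
    {F : ℕ → ℕ} (hu : Primrec₂ u) (hv : Primrec₂ v) (hF : Computable F) :
    Computable₂ (run u v F) := by
  have hinit : Primrec init := by
    refine Primrec.pair ?_ (Primrec.pair (Primrec.const []) 
      (Primrec.nat_add.comp Primrec.list_length (Primrec.const 4)))
    exact Primrec.list_cons.comp (Primrec.pair (primrec_pow.comp (Primrec.const 2)
      (Primrec.nat_add.comp Primrec.list_length (Primrec.const 2))) (Primrec.const [])) (Primrec.const [])
  have hstep : Computable (fun i : Inp => step u i.1.1 i.1.2 i.2.1.1 i.2.1.2 i.2.2) :=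
    Primrec.to_comp (primrec_step hu)
  have hnum : Computable (num u v) := Primrec.to_comp (primrec_num hu hv)
  have : Computable (fun p : List Bool × ℕ => (Nat.rec (init p.1) (fun t st =>
      step u (num u v t) (F t) p.1 t st) p.2 : St)) := by
    have ht : Computable (fun q : (List Bool × ℕ) × (ℕ × St) => q.2.1) := Computable.fst.comp Computable.snd
    have hi : Computable (fun q : (List Bool × ℕ) × (ℕ × St) =>
        (((num u v q.2.1, F q.2.1), (q.1.1, q.2.1), q.2.2) : Inp)) :=
      Computable.pair (Computable.pair (hnum.comp ht)
      (hF.comp ht)) (Computable.pair (Computable.pair (Computable.fst.comp Computable.fst) ht)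
        (Computable.snd.comp Computable.snd))
    have h3 : Computable₂ (fun (p : List Bool × ℕ) (q : ℕ × St) =>
        step u (num u v q.1) (F q.1) p.1 q.1 q.2) := hstep.comp hi
    have hinit' : Computable (fun p : List Bool × ℕ => init p.1) := hinit.to_comp.comp Computable.fst
    exact Computable.nat_rec Computable.snd hinit' h3
  refine Computable.of_eq this ?_
  rintro ⟨ρ, t⟩
  show _ = run u v F ρ t
  induction t with
  | zero => rfl
  | succ t ih => 
    have ih : (Nat.rec (init ρ) (fun t st =>
      step u (num u v t) (F t) ρ t st) t : St) = run u v F ρ t := ih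
    simp only [run]; rw [← ih]

/-- The machine of the strategy. -/
noncomputable def mach (R : List Bool → ℕ → St) (x : List Bool) (ρ τ : List Bool) : Part (List Bool) :=
  (Nat.rfind (fun t => (Part.some (decide (τ ∈ (R ρ t).2.1)) : Part Bool))).map (fun _ => x)

lemma partrec_mach {R : List Bool → ℕ → St} (hR : Computable₂ R) (x : List Bool) :
    Partrec₂ (mach R x) := by
  refine Partrec.map (Partrec.rfind ?_) (Computable.const x)
  apply Computable.partrec
  have r : PrimrecRel (fun (L : List (List Bool)) (τ : List Bool) => ∃ a ∈ L, a = τ) :=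
    PrimrecRel.exists_mem_list Primrec.eq
  have r' : Primrec₂ (fun (L : List (List Bool)) (τ : List Bool) => decide (τ ∈ L)) := by
    refine Primrec₂.of_eq r.decide ?_
    intro L τ; simp
  exact r'.to_comp.comp (Computable.fst.comp (Computable.snd.comp (hR.comp
    (Computable.fst.comp Computable.fst) Computable.snd))) (Computable.snd.comp Computable.fst)

lemma mem_mach {R : List Bool → ℕ → St} {x ρ τ y : List Bool} :
    y ∈ mach R x ρ τ ↔ y = x ∧ ∃ t, τ ∈ (R ρ t).2.1 := by
  unfold mach
  rw [Part.mem_map_iff]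
  constructor
  · rintro ⟨t, ht, rfl⟩
    have := Nat.rfind_spec ht
    simp at this
    exact ⟨rfl, t, this⟩
  · rintro ⟨rfl, t, ht⟩
    obtain ⟨n, hn, _⟩ := Nat.rfind_min' (p := fun t => decide (τ ∈ (R ρ t).2.1)) (m := t) (by simpa using ht)
    exact ⟨n, hn, rfl⟩

/-- Self-reference. -/
lemma exists_prefix {U : List Bool →. List Bool} (hU : UniversalPFM U)
    {N : List Bool → List Bool →. List Bool} (hN : Partrec₂ N) (hpf : ∀ ρ, PrefixFreeDomain (N ρ)) :
    ∃ ρ, ∀ τ, U (ρ ++ τ) = N ρ τ := by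
  let G : ℕ → Part (Option (List Bool)) := fun e =>
    ((Denumerable.ofNat Nat.Partrec.Code e).eval e).map Encodable.decode
  have hG : Partrec G := by
    refine Partrec.map (Nat.Partrec.Code.eval_part.comp (Computable.ofNat _) Computable.id) ?_
    exact (Primrec.decode.comp Primrec.snd).to_comp
  obtain ⟨g, hg, hgU⟩ := hU.2 (fun e τ => (G e).bind (fun o => (o : Part (List Bool)).bind (fun ρ => N ρ τ))) (by
    refine Partrec.bind (hG.comp Computable.fst) ?_
    refine Partrec.bind (Computable.ofOption Computable.snd) ?_
    exact hN.comp Computable.snd (Computable.snd.comp (Computable.fst.comp Computable.fst))) (by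
    intro e σ τ hst h1 h2
    obtain ⟨a, ha⟩ := Part.dom_iff_mem.1 h1
    obtain ⟨b, hb⟩ := Part.dom_iff_mem.1 h2
    obtain ⟨o, ho, ha⟩ := Part.mem_bind_iff.1 ha
    obtain ⟨o', ho', hb⟩ := Part.mem_bind_iff.1 hb
    obtain rfl := Part.mem_unique ho ho'
    obtain ⟨r, hr, ha⟩ := Part.mem_bind_iff.1 ha
    obtain ⟨r', hr', hb⟩ := Part.mem_bind_iff.1 hb
    obtain rfl := Part.mem_unique hr hr'
    exact hpf r σ τ hst (Part.dom_iff_mem.2 ⟨_, ha⟩) (Part.dom_iff_mem.2 ⟨_, hb⟩))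
  have hg' : Nat.Partrec (fun e => Part.some (Encodable.encode (g e))) := 
    Partrec.nat_iff.1 (Computable.encode.comp hg).partrec
  obtain ⟨c, hc⟩ := Nat.Partrec.Code.exists_code.1 hg'
  refine ⟨g (Encodable.encode c), fun τ => ?_⟩
  rw [hgU]
  have : G (Encodable.encode c) = Part.some (some (g (Encodable.encode c))) := by
    simp only [G, Denumerable.ofNat_encode, hc, Part.map_some, Encodable.encodek]
  rw [this]
  simp


/-! Invariants of the run. -/

def Incomp (a b : List Bool) : Prop := ¬ a <+: b ∧ ¬ b <+: a

lemma Incomp.symm {a b : List Bool} (h : Incomp a b) : Incomp b a := ⟨h.2, h.1⟩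

def strs (st : St) : List (List Bool) := st.1.map Prod.snd ++ st.2.1

def Inv (ρ : List Bool) (st : St) : Prop :=
  (strs st).Pairwise Incomp ∧ ∀ p ∈ st.1, ρ.length + 4 + p.2.length ≤ st.2.2

lemma length_allStr (n : ℕ) : (allStr n).length = 2 ^ n := by
  induction n with
  | zero => rfl
  | succ n ih => simp [allStr, ih, pow_succ]; ring

lemma length_of_mem_allStr {n : ℕ} : ∀ {w : List Bool}, w ∈ allStr n → w.length = n := by
  induction n with
  | zero => intro w hw; simp [allStr] at hw; simp [hw]
  | succ n ih =>
    intro w hw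
    simp only [allStr, List.mem_append, List.mem_map] at hw
    rcases hw with ⟨a, ha, rfl⟩ | ⟨a, ha, rfl⟩ <;> simp [ih ha]

lemma nodup_allStr (n : ℕ) : (allStr n).Nodup := by
  induction n with
  | zero => simp [allStr]
  | succ n ih =>
    simp only [allStr]
    refine List.Nodup.append (ih.map (List.cons_injective)) (ih.map (List.cons_injective)) ?_
    intro a h1 h2
    simp only [List.mem_map] at h1 h2
    obtain ⟨b, _, rfl⟩ := h1
    obtain ⟨c, _, h⟩ := h2
    simp at h

lemma incomp_ext {a b : List Bool} (h : Incomp a b) (w : List Bool) : Incomp (a ++ w) b := by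
  constructor
  · intro h'
    exact h.1 ((List.prefix_append a w).trans h')
  · intro h'
    rcases List.prefix_or_prefix_of_prefix h' (List.prefix_append a w) with h2 | h2
    · exact h.2 h2
    · exact h.1 h2

lemma Inv.init (ρ : List Bool) : Inv ρ (init ρ) := by
  constructor
  · simp [strs, OmegaAux.init]
  · intro p hp
    simp [OmegaAux.init] at hp
    simp [OmegaAux.init, hp]

lemma Inv.act {ρ : List Bool} {st : St} (h : Inv ρ st) (t : ℕ) : Inv ρ (act ρ t st) := by
  obtain ⟨S, E, k⟩ := st
  obtain ⟨h1, h2⟩ := h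
  rcases S with _ | ⟨⟨_ | j, τ⟩, L⟩
  · exact ⟨h1, h2⟩
  · constructor
    · simp only [strs, OmegaAux.act, List.map_cons, List.cons_append] at h1 ⊢
      exact (List.Perm.pairwise_iff (fun h => Incomp.symm h) (List.perm_middle)).2 h1
    · intro p hp
      exact h2 p (List.mem_cons_of_mem _ hp)
  · constructor
    · simp only [strs, OmegaAux.act, List.map_cons, List.cons_append, List.pairwise_cons,
        List.map_append, List.map_map, List.append_assoc] at h1 ⊢
      rw [List.pairwise_append]
      refine ⟨?_, h1.2, ?_⟩
      · rw [List.pairwise_map]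
        refine List.Pairwise.imp_of_mem ?_ (nodup_allStr _)
        intro a b ha hb hab
        have la := length_of_mem_allStr ha
        have lb := length_of_mem_allStr hb
        constructor
        · intro h
          simp only [Function.comp, List.prefix_append_right_inj] at h
          exact hab (h.eq_of_length (by omega))
        · intro h
          simp only [Function.comp, List.prefix_append_right_inj] at h
          exact hab (h.eq_of_length (by omega)).symm
      · intro a ha b hb
        simp only [List.mem_map, Function.comp] at ha
        obtain ⟨w, _, rfl⟩ := ha
        exact incomp_ext (h1.1 b hb) w
    · intro p hp
      simp only [OmegaAux.act, List.mem_append, List.mem_map] at hp ⊢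
      rcases hp with ⟨w, hw, rfl⟩ | hp
      · have := h2 (j+1, τ) (by simp)
        have lw := length_of_mem_allStr hw
        simp only [List.length_append] at this ⊢
        omega
      · have := h2 p (List.mem_cons_of_mem _ hp)
        simp only at this ⊢
        omega

section
variable {u : ℕ → List Bool → Option (List Bool)} {v : ℕ → List Bool → Option Unit}
  {F : ℕ → ℕ} {ρ : List Bool}

lemma run_succ (t : ℕ) : run u v F ρ (t+1) = step u (num u v t) (F t) ρ t (run u v F ρ t) := rfl

lemma inv_run (t : ℕ) : Inv ρ (run u v F ρ t) := by
  induction t with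
  | zero => exact Inv.init ρ
  | succ t ih =>
    rw [run_succ, step]
    split_ifs
    · exact ih.act t
    · exact ih

lemma act_mono (t : ℕ) (st : St) : st.2.1 ⊆ (act ρ t st).2.1 ∧ st.2.2 ≤ (act ρ t st).2.2 := by
  obtain ⟨S, E, k⟩ := st
  rcases S with _ | ⟨⟨_ | j, τ⟩, L⟩
  · simp [act]
  · simp [act]
  · simp [act]

lemma run_mono {s t : ℕ} (h : s ≤ t) : (run u v F ρ s).2.1 ⊆ (run u v F ρ t).2.1 ∧
    (run u v F ρ s).2.2 ≤ (run u v F ρ t).2.2 := by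
  induction t, h using Nat.le_induction with
  | base => simp
  | succ t _ ih =>
    rw [run_succ, step]
    split_ifs
    · have := act_mono (ρ := ρ) t (run u v F ρ t)
      exact ⟨fun a ha => this.1 (ih.1 ha), ih.2.trans this.2⟩
    · exact ih

lemma incomp_of_pairwise {L : List (List Bool)} (h : L.Pairwise Incomp) {a b : List Bool}
    (ha : a ∈ L) (hb : b ∈ L) (hab : a <+: b) : a = b := by
  by_contra hne
  have : Std.Symm Incomp := ⟨fun _ _ h => h.symm⟩
  exact (h.forall ha hb hne).1 hab

lemma pf_mach (x : List Bool) (ρ : List Bool) : PrefixFreeDomain (mach (run u v F) x ρ) := by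
  intro σ τ hst h1 h2
  obtain ⟨a, ha⟩ := Part.dom_iff_mem.1 h1
  obtain ⟨b, hb⟩ := Part.dom_iff_mem.1 h2
  obtain ⟨-, s, hs⟩ := mem_mach.1 ha
  obtain ⟨-, t, ht⟩ := mem_mach.1 hb
  have i := (inv_run (u := u) (v := v) (F := F) (ρ := ρ) (max s t)).1
  refine incomp_of_pairwise i ?_ ?_ hst
  · exact List.mem_append_right _ ((run_mono (le_max_left s t)).1 hs)
  · exact List.mem_append_right _ ((run_mono (le_max_right s t)).1 ht)

end

/-! The measure of stages. -/

lemma kraft {S : Finset (List Bool)} (h : ∀ a ∈ S, ∀ b ∈ S, a <+: b → a = b) :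
    ∑ σ ∈ S, (2 : ℝ)⁻¹ ^ σ.length ≤ 1 := by
  by_cases h0 : [] ∈ S
  · have : S = {[]} := by
      ext a
      simp only [Finset.mem_singleton]
      constructor
      · intro ha
        exact (h [] h0 a ha (List.nil_prefix)).symm
      · rintro rfl
        exact h0
    rw [this]; simp
  have hu : InformationTheory.UniquelyDecodable (S : Set (List Bool)) := by
    intro L₁
    induction L₁ with
    | nil =>
      intro L₂ _ h2 he
      rcases L₂ with _ | ⟨b, L₂⟩
      · rfl
      · simp at he
        exact absurd (h2 b (by simp)) (by rw [he.1]; exact h0)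
    | cons a L₁ ih =>
      intro L₂ h1 h2 he
      rcases L₂ with _ | ⟨b, L₂⟩
      · simp at he
        exact absurd (h1 a (by simp)) (by rw [he.1]; exact h0)
      · simp only [List.flatten_cons] at he
        have ha : a ∈ S := h1 a (by simp)
        have hb : b ∈ S := h2 b (by simp)
        have hab : a = b := by
          rcases List.prefix_or_prefix_of_prefix (List.prefix_append a L₁.flatten)
            (he ▸ List.prefix_append b L₂.flatten) with h' | h'
          · exact h a ha b hb h'
          · exact (h b hb a ha h').symm
        subst hab
        rw [ih L₂ (fun w hw => h1 w (by simp [hw])) (fun w hw => h2 w (by simp [hw]))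
          (List.append_cancel_left he)]
  have := InformationTheory.kraft_mcmillan_inequality hu
  simpa using this

structure Apx (U : List Bool →. List Bool) (X : Set (List Bool))
    (u : ℕ → List Bool → Option (List Bool)) (v : ℕ → List Bool → Option Unit) : Prop where
  umono : ∀ s t a b, s ≤ t → u s a = some b → u t a = some b
  uspec : ∀ a b, b ∈ U a ↔ ∃ s, u s a = some b
  ubd : ∀ s (a : List Bool) b, u s a = some b → Encodable.encode a < s
  vmono : ∀ s t a b, s ≤ t → v s a = some b → v t a = some b
  vspec : ∀ a, a ∉ X ↔ ∃ s, v s a = some ()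
  pf : PrefixFreeDomain U

def XS (v : ℕ → List Bool → Option Unit) (s : ℕ) : Set (List Bool) := {b | v s b = none}

lemma finT (s : ℕ) : {σ : List Bool | Encodable.encode σ < s}.Finite :=
  Set.Finite.preimage Encodable.encode_injective.injOn (Set.finite_Iio s)

noncomputable def TT (s : ℕ) : Finset (List Bool) := (finT s).toFinset

lemma mem_TT {s : ℕ} {σ : List Bool} : σ ∈ TT s ↔ Encodable.encode σ < s := by simp [TT]

lemma TT_mono {s t : ℕ} (h : s ≤ t) : TT s ⊆ TT t := by
  intro σ; simp only [mem_TT]; omega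

open Classical in
noncomputable def gg (u : ℕ → List Bool → Option (List Bool)) (s : ℕ) (B : Set (List Bool))
    (σ : List Bool) : ℝ := if ∃ y ∈ B, u s σ = some y then (2:ℝ)⁻¹ ^ σ.length else 0

noncomputable def mm (u : ℕ → List Bool → Option (List Bool)) (s : ℕ) (B : Set (List Bool)) : ℝ :=
  ∑ σ ∈ TT s, gg u s B σ

lemma gg_nonneg (u : ℕ → List Bool → Option (List Bool)) (s : ℕ) (B : Set (List Bool))
    (σ : List Bool) : 0 ≤ gg u s B σ := by
  unfold gg; split_ifs <;> positivity

lemma mm_nonneg (u : ℕ → List Bool → Option (List Bool)) (s : ℕ) (B : Set (List Bool)) :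
    0 ≤ mm u s B := Finset.sum_nonneg fun σ _ => gg_nonneg u s B σ

section
variable {U : List Bool →. List Bool} {X : Set (List Bool)}
    {u : ℕ → List Bool → Option (List Bool)} {v : ℕ → List Bool → Option Unit}

lemma Apx.mm_eq (h : Apx U X u v) {s t : ℕ} (hst : s ≤ t) (B : Set (List Bool)) :
    mm u s B = ∑ σ ∈ TT t, gg u s B σ := by
  refine Finset.sum_subset (TT_mono hst) ?_
  intro σ _ h2
  unfold gg
  rw [if_neg]
  rintro ⟨y, _, hy⟩
  exact h2 (mem_TT.2 (h.ubd s σ y hy))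

lemma Apx.mm_le_one (h : Apx U X u v) (s : ℕ) (B : Set (List Bool)) : mm u s B ≤ 1 := by
  classical
  unfold mm gg
  rw [← Finset.sum_filter]
  apply kraft
  intro a ha b hb hab
  simp only [Finset.mem_filter] at ha hb
  obtain ⟨-, y, _, hy⟩ := ha
  obtain ⟨-, z, _, hz⟩ := hb
  exact h.pf a b hab (Part.dom_iff_mem.2 ⟨y, (h.uspec _ _).2 ⟨s, hy⟩⟩)
    (Part.dom_iff_mem.2 ⟨z, (h.uspec _ _).2 ⟨s, hz⟩⟩)

lemma Apx.gg_mono (h : Apx U X u v) {s t : ℕ} (hst : s ≤ t) {B C : Set (List Bool)} (hBC : B ⊆ C)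
    (σ : List Bool) : gg u s B σ ≤ gg u t C σ := by
  by_cases hs : ∃ y ∈ B, u s σ = some y
  · obtain ⟨y, hy, e⟩ := hs
    rw [gg, gg, if_pos ⟨y, hy, e⟩, if_pos ⟨y, hBC hy, h.umono _ _ _ _ hst e⟩]
  · rw [gg, if_neg hs]; exact gg_nonneg _ _ _ _

lemma Apx.mm_mono (h : Apx U X u v) {s t : ℕ} (hst : s ≤ t) {B C : Set (List Bool)} (hBC : B ⊆ C) :
    mm u s B ≤ mm u t C := by
  rw [h.mm_eq hst B]
  exact Finset.sum_le_sum fun σ _ => h.gg_mono hst hBC σ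

lemma gg_union {s : ℕ} {B C : Set (List Bool)} (hd : Disjoint B C) (σ : List Bool) :
    gg u s (B ∪ C) σ = gg u s B σ + gg u s C σ := by
  by_cases h1 : ∃ y ∈ B, u s σ = some y
  · have h2 : ¬ ∃ y ∈ C, u s σ = some y := by
      rintro ⟨z, hz, e⟩
      obtain ⟨y, hy, e'⟩ := h1
      have : y = z := by simpa [e] using e'.symm
      exact Set.disjoint_left.1 hd hy (this ▸ hz)
    have h3 : ∃ y ∈ B ∪ C, u s σ = some y := by
      obtain ⟨y, hy, e'⟩ := h1
      exact ⟨y, Or.inl hy, e'⟩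
    rw [gg, gg, gg, if_pos h1, if_neg h2, if_pos h3, add_zero]
  · by_cases h2 : ∃ y ∈ C, u s σ = some y
    · have h3 : ∃ y ∈ B ∪ C, u s σ = some y := by
        obtain ⟨y, hy, e'⟩ := h2
        exact ⟨y, Or.inr hy, e'⟩
      rw [gg, gg, gg, if_neg h1, if_pos h2, if_pos h3, zero_add]
    · have h3 : ¬ ∃ y ∈ B ∪ C, u s σ = some y := by
        rintro ⟨y, hy | hy, e⟩
        exacts [h1 ⟨y, hy, e⟩, h2 ⟨y, hy, e⟩]
      rw [gg, gg, gg, if_neg h1, if_neg h2, if_neg h3, zero_add]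

lemma mm_union {s : ℕ} {B C : Set (List Bool)} (hd : Disjoint B C) :
    mm u s (B ∪ C) = mm u s B + mm u s C := by
  unfold mm
  rw [← Finset.sum_add_distrib]
  exact Finset.sum_congr rfl fun σ _ => gg_union hd σ

lemma Apx.le_mm (h : Apx U X u v) {s t : ℕ} (hst : s ≤ t) {B : Set (List Bool)} {b : List Bool}
    (hb : b ∈ B) {σ : List Bool} (e : u s σ = some b) : (2:ℝ)⁻¹ ^ s ≤ mm u t B := by
  have h1 : σ.length ≤ s := (Encodable.length_le_encode σ).trans (h.ubd _ _ _ e).le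
  have h2 : gg u t B σ = (2:ℝ)⁻¹ ^ σ.length := by
    rw [gg, if_pos ⟨b, hb, h.umono _ _ _ _ hst e⟩]
  have h3 : gg u t B σ ≤ mm u t B :=
    Finset.single_le_sum (f := fun σ => gg u t B σ) (fun σ _ => gg_nonneg _ _ _ _)
      (TT_mono hst (mem_TT.2 (h.ubd _ _ _ e)))
  rw [h2] at h3
  refine le_trans ?_ h3
  exact pow_le_pow_of_le_one (by norm_num) (by norm_num) h1

lemma Apx.key (h : Apx U X u v) {s t : ℕ} (hst : s ≤ t) {X' Z : Set (List Bool)} {x ρ : List Bool}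
    (hx : x ∈ X') {T : List (List Bool)} (hT : T.Nodup)
    (hTt : ∀ τ ∈ T, u t (ρ ++ τ) = some x) (hTs : ∀ τ ∈ T, u s (ρ ++ τ) = none)
    (hZ : Z ⊆ X') (hxZ : x ∉ Z) (hZs : ∀ b ∈ Z, ∀ σ, u s σ ≠ some b) :
    mm u s X' + mm u t Z + 2⁻¹ ^ ρ.length * (T.map fun τ => (2:ℝ)⁻¹ ^ τ.length).sum
      ≤ mm u t X' := by
  classical
  have e1 : 2⁻¹ ^ ρ.length * (T.map fun τ => (2:ℝ)⁻¹ ^ τ.length).sum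
      = ∑ σ ∈ TT t, if σ ∈ (T.map (ρ ++ ·)).toFinset then (2:ℝ)⁻¹ ^ σ.length else 0 := by
    rw [← Finset.sum_filter]
    have : (TT t).filter (· ∈ (T.map (ρ ++ ·)).toFinset) = (T.map (ρ ++ ·)).toFinset := by
      ext σ
      simp only [Finset.mem_filter, and_iff_right_iff_imp]
      intro hσ
      simp only [List.mem_toFinset, List.mem_map] at hσ
      obtain ⟨τ, hτ, rfl⟩ := hσ
      exact mem_TT.2 (h.ubd _ _ _ (hTt τ hτ))
    rw [this, List.sum_toFinset _ (hT.map (List.append_right_injective ρ)), List.map_map,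
      ← List.sum_map_mul_left]
    congr 1
    apply List.map_congr_left
    intro τ _
    simp [pow_add, mul_comm]
  rw [h.mm_eq hst X', e1, mm, mm, ← Finset.sum_add_distrib, ← Finset.sum_add_distrib]
  refine Finset.sum_le_sum fun σ _ => ?_
  by_cases hσ : σ ∈ (T.map (ρ ++ ·)).toFinset
  · rw [if_pos hσ]
    simp only [List.mem_toFinset, List.mem_map] at hσ
    obtain ⟨τ, hτ, rfl⟩ := hσ
    have e2 := hTt τ hτ
    have e3 := hTs τ hτ
    rw [gg, gg, gg, if_neg, if_neg, if_pos]
    · simp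
    · exact ⟨x, hx, e2⟩
    · rintro ⟨y, hy, e⟩
      rw [e2] at e
      cases e
      exact hxZ hy
    · rintro ⟨y, hy, e⟩
      rw [e3] at e
      cases e
  · rw [if_neg hσ, add_zero]
    by_cases h1 : ∃ y ∈ X', u s σ = some y
    · have : gg u t Z σ = 0 := by
        rw [gg, if_neg]
        rintro ⟨z, hz, e⟩
        obtain ⟨y, hy, e'⟩ := h1
        have := h.umono _ _ _ _ hst e'
        rw [e] at this
        cases this
        exact hZs _ hz _ e'
      rw [this, add_zero]
      exact h.gg_mono hst le_rfl σ
    · have : gg u s X' σ = 0 := by rw [gg, if_neg h1]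
      rw [this, zero_add]
      exact h.gg_mono le_rfl hZ σ

lemma Apx.XS_anti (h : Apx U X u v) {s t : ℕ} (hst : s ≤ t) : XS v t ⊆ XS v s := by
  intro b hb
  change v t b = none at hb
  change v s b = none
  by_contra hn
  obtain ⟨c, hc⟩ := Option.ne_none_iff_exists'.1 hn
  rw [h.vmono _ _ _ _ hst hc] at hb
  cases hb

lemma Apx.sub_XS (h : Apx U X u v) (s : ℕ) : X ⊆ XS v s := by
  intro b hb
  by_contra hn
  obtain ⟨c, hc⟩ := Option.ne_none_iff_exists'.1 hn
  exact (h.vspec b).2 ⟨s, hc⟩ hb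

end

section
variable {U : List Bool →. List Bool} {X : Set (List Bool)}
    {u : ℕ → List Bool → Option (List Bool)} {v : ℕ → List Bool → Option Unit}

lemma wgt_encode (h : Apx U X u v) (s : ℕ) (σ : List Bool) :
    ((wgt u v s (Encodable.encode σ) : ℕ) : ℝ) = 2 ^ s * gg u s (XS v s) σ := by
  have hd : (decide (Encodable.encode σ = Encodable.encode σ)) = true := by simp
  unfold wgt
  rw [Encodable.encodek, Option.bind_some, hd, cond_true]
  cases e : u s σ with
  | none =>
    rw [gg, if_neg]
    · simp
    · rintro ⟨y, _, hy⟩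
      rw [e] at hy; cases hy
  | some y =>
    rw [Option.bind_some]
    cases e2 : v s y with
    | none =>
      rw [gg, if_pos ⟨y, e2, e⟩]
      have h1 : σ.length ≤ s := (Encodable.length_le_encode σ).trans (h.ubd _ _ _ e).le
      simp only [Option.isSome_none, cond_false, Option.getD_some, Nat.cast_pow, Nat.cast_ofNat]
      rw [inv_pow, ← div_eq_mul_inv, pow_sub₀ _ (by norm_num) h1, div_eq_mul_inv]
    | some c =>
      rw [gg, if_neg]
      · simp
      · rintro ⟨z, hz, hy⟩
        rw [e] at hy; cases hy
        have hz : v s y = none := hz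
        rw [e2] at hz; cases hz

lemma num_eq (h : Apx U X u v) (s : ℕ) : (num u v s : ℝ) = 2 ^ s * mm u s (XS v s) := by
  have e1 : num u v s = ∑ n ∈ Finset.range s, wgt u v s n := by
    rw [num, ← List.sum_eq_foldl, ← List.toFinset_range, List.sum_toFinset _ List.nodup_range]
  rw [e1, Nat.cast_sum, mm, Finset.mul_sum]
  symm
  refine Finset.sum_of_injOn (Encodable.encode : List Bool → ℕ) Encodable.encode_injective.injOn ?_ ?_ ?_
  · intro σ hσ
    simpa using mem_TT.1 hσ
  · intro n hn hn'
    have : wgt u v s n = 0 := by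
      unfold wgt
      cases e : (Encodable.decode n : Option (List Bool)) with
      | none => rfl
      | some σ =>
        have hne : Encodable.encode σ ≠ n := by
          rintro rfl
          exact hn' ⟨σ, mem_TT.2 (by simpa using hn), rfl⟩
        have hd : decide (Encodable.encode σ = n) = false := by simpa using hne
        rw [Option.bind_some, hd, cond_false]; rfl
    rw [this]; simp
  · intro σ _
    exact (wgt_encode h s σ).symm

lemma tendsto_mm (h : Apx U X u v) :
    Tendsto (fun s => mm u s (XS v s)) atTop (nhds (Omega U X)) := by
  classical
  have e1 : ∀ s, mm u s (XS v s) = ∑' σ, gg u s (XS v s) σ := by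
    intro s
    rw [tsum_eq_sum (s := TT s)]
    · rfl
    · intro σ hσ
      rw [gg, if_neg]
      rintro ⟨y, _, hy⟩
      exact hσ (mem_TT.2 (h.ubd _ _ _ hy))
  have e2 : Omega U X = ∑' σ : List Bool,
      ({σ : List Bool | ∃ y ∈ U σ, y ∈ X}.indicator (fun σ => (2:ℝ)⁻¹ ^ σ.length)) σ := by
    rw [← tsum_subtype]
    rfl
  rw [e2]
  simp_rw [e1]
  refine tendsto_tsum_of_dominated_convergence
    (bound := fun σ => if (U σ).Dom then (2:ℝ)⁻¹ ^ σ.length else 0) ?_ ?_ ?_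
  · refine summable_of_sum_le (c := 1) (fun σ => ?_) ?_
    · show 0 ≤ (if _ then _ else _ : ℝ)
      split_ifs <;> positivity
    · intro S
      rw [← Finset.sum_filter]
      apply kraft
      intro a ha b hb hab
      simp only [Finset.mem_filter] at ha hb
      exact h.pf a b hab ha.2 hb.2
  · intro σ
    apply tendsto_const_nhds.congr'
    by_cases hσ : (U σ).Dom
    · obtain ⟨y, hy⟩ := Part.dom_iff_mem.1 hσ
      obtain ⟨s0, hs0⟩ := (h.uspec _ _).1 hy
      by_cases hyX : y ∈ X
      · filter_upwards [eventually_ge_atTop s0] with s hs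
        rw [Set.indicator_of_mem (show σ ∈ {σ : List Bool | ∃ y ∈ U σ, y ∈ X} from ⟨y, hy, hyX⟩), gg, if_pos]
        exact ⟨y, h.sub_XS s hyX, h.umono _ _ _ _ hs hs0⟩
      · obtain ⟨s1, hs1⟩ := (h.vspec y).1 hyX
        filter_upwards [eventually_ge_atTop s0, eventually_ge_atTop s1] with s hs hs'
        rw [Set.indicator_of_notMem, gg, if_neg]
        · rintro ⟨z, hz, e⟩
          rw [h.umono _ _ _ _ hs hs0] at e
          cases e
          have : v s y = none := hz
          rw [h.vmono _ _ _ _ hs' hs1] at this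
          cases this
        · rintro ⟨z, hz, hzX⟩
          exact hyX (Part.mem_unique hy hz ▸ hzX)
    · filter_upwards with s
      rw [Set.indicator_of_notMem, gg, if_neg]
      · rintro ⟨y, _, e⟩
        exact hσ (Part.dom_iff_mem.2 ⟨y, (h.uspec _ _).2 ⟨s, e⟩⟩)
      · rintro ⟨z, hz, hzX⟩
        exact hσ (Part.dom_iff_mem.2 ⟨z, hz⟩)
  · filter_upwards with s σ
    rw [Real.norm_of_nonneg (gg_nonneg _ _ _ _), gg]
    split_ifs with h1 h2 h2
    · exact le_rfl
    · obtain ⟨y, _, e⟩ := h1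
      exact absurd (Part.dom_iff_mem.2 ⟨y, (h.uspec _ _).2 ⟨s, e⟩⟩) h2
    · positivity
    · exact le_rfl

lemma Omega_nonneg (U : List Bool →. List Bool) (X : Set (List Bool)) : 0 ≤ Omega U X :=
  tsum_nonneg fun _ => by positivity

end

/-! The argument. -/

structure Ctx (U : List Bool →. List Bool) (X : Set (List Bool))
    (u : ℕ → List Bool → Option (List Bool)) (v : ℕ → List Bool → Option Unit)
    (x ρ : List Bool) (f : ℕ → ℚ) (F : ℕ → ℕ) : Prop where
  apx : Apx U X u v
  hx : x ∈ X
  anti : Antitone f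
  lim : Tendsto (fun n => (f n : ℝ)) atTop (nhds (Omega U X))
  hF : ∀ s, (F s : ℝ) ≤ f s * 2 ^ s ∧ (f s : ℝ) * 2 ^ s ≤ F s + 1
  hρ : ∀ τ, U (ρ ++ τ) = mach (run u v F) x ρ τ

def Act (u : ℕ → List Bool → Option (List Bool)) (v : ℕ → List Bool → Option Unit)
    (F : ℕ → ℕ) (ρ : List Bool) (t : ℕ) : Prop :=
  Cond u (num u v t) (F t) ρ t (run u v F ρ t)

noncomputable def RR (u : ℕ → List Bool → Option (List Bool)) (v : ℕ → List Bool → Option Unit)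
    (s t : ℕ) : ℝ := mm u t (XS v s \ XS v t)

def ZZ (u : ℕ → List Bool → Option (List Bool)) (v : ℕ → List Bool → Option Unit)
    (s t : ℕ) : Set (List Bool) := {b | (b ∈ XS v s ∧ b ∉ XS v t) ∧ ∀ σ, u s σ ≠ some b}

section
variable {U : List Bool →. List Bool} {X : Set (List Bool)}
    {u : ℕ → List Bool → Option (List Bool)} {v : ℕ → List Bool → Option Unit}
    {x ρ : List Bool} {f : ℕ → ℚ} {F : ℕ → ℕ}

lemma run_act {t : ℕ} (h : Act u v F ρ t) :
    run u v F ρ (t+1) = act ρ t (run u v F ρ t) := by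
  have h' : Cond u (num u v t) (F t) ρ t (run u v F ρ t) := h
  rw [run_succ, step, if_pos h']

lemma run_not {t : ℕ} (h : ¬ Act u v F ρ t) : run u v F ρ (t+1) = run u v F ρ t := by
  have h' : ¬ Cond u (num u v t) (F t) ρ t (run u v F ρ t) := h
  rw [run_succ, step, if_neg h']

lemma Apx.RR_add (h : Apx U X u v) {s t w : ℕ} (hst : s ≤ t) (htw : t ≤ w) :
    RR u v s t + RR u v t w ≤ RR u v s w := by
  have h1 : RR u v s t ≤ mm u w (XS v s \ XS v t) := h.mm_mono htw le_rfl
  have h2 : mm u w ((XS v s \ XS v t) ∪ (XS v t \ XS v w)) = _ := mm_union (u := u) (s := w) (by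
    rw [Set.disjoint_left]
    rintro b ⟨_, hb⟩ ⟨hb', _⟩
    exact hb hb')
  have h3 : mm u w ((XS v s \ XS v t) ∪ (XS v t \ XS v w)) ≤ RR u v s w := by
    refine h.mm_mono le_rfl ?_
    rintro b (⟨hb, hb'⟩ | ⟨hb, hb'⟩)
    · exact ⟨hb, fun h' => hb' (h.XS_anti htw h')⟩
    · exact ⟨h.XS_anti hst hb, hb'⟩
  have : RR u v t w = mm u w (XS v t \ XS v w) := rfl
  linarith

lemma Apx.RR_eq (h : Apx U X u v) {s t : ℕ} (hst : s ≤ t) :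
    mm u t (XS v s) = RR u v s t + mm u t (XS v t) := by
  rw [RR, ← mm_union Set.disjoint_sdiff_left, Set.sdiff_union_of_subset (h.XS_anti hst)]

lemma cond_bound (h : Apx U X u v) {s : ℕ} (hA : Act u v F ρ s) :
    mm u s (XS v s) ≤ F s / 2 ^ s + 2⁻¹ ^ (run u v F ρ s).2.2 ∧
    F s / 2 ^ s ≤ mm u s (XS v s) + 2⁻¹ ^ (run u v F ρ s).2.2 := by
  obtain ⟨-, -, h3, -⟩ := hA
  set k := (run u v F ρ s).2.2
  have e := num_eq h s
  have a1 : num u v s * 2 ^ k ≤ F s * 2 ^ k + 2 ^ s := by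
    have : num u v s ≤ F s + (num u v s - F s + (F s - num u v s)) := by omega
    calc num u v s * 2 ^ k ≤ (F s + (num u v s - F s + (F s - num u v s))) * 2 ^ k :=
          Nat.mul_le_mul_right _ this
      _ ≤ _ := by rw [add_mul]; omega
  have a2 : F s * 2 ^ k ≤ num u v s * 2 ^ k + 2 ^ s := by
    have : F s ≤ num u v s + (num u v s - F s + (F s - num u v s)) := by omega
    calc F s * 2 ^ k ≤ (num u v s + (num u v s - F s + (F s - num u v s))) * 2 ^ k :=
          Nat.mul_le_mul_right _ this
      _ ≤ _ := by rw [add_mul]; omega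
  have b1 : (num u v s : ℝ) * 2 ^ k ≤ F s * 2 ^ k + 2 ^ s := by exact_mod_cast a1
  have b2 : (F s : ℝ) * 2 ^ k ≤ num u v s * 2 ^ k + 2 ^ s := by exact_mod_cast a2
  have hs : (0:ℝ) < 2 ^ s := by positivity
  have hk : (0:ℝ) < 2 ^ k := by positivity
  have ek : (2:ℝ)⁻¹ ^ k * 2 ^ k = 1 := by rw [inv_pow, inv_mul_cancel₀ hk.ne']
  have eF : (F s : ℝ) = (F s / 2 ^ s : ℝ) * 2 ^ s := by field_simp
  rw [e] at b1 b2
  generalize (F s / 2 ^ s : ℝ) = q at *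
  rw [eF] at b1 b2
  constructor
  · refine le_of_mul_le_mul_right ?_ (mul_pos hs hk)
    have : (q + 2⁻¹ ^ k) * (2 ^ s * 2 ^ k) = q * 2 ^ s * 2 ^ k + 2 ^ s * ((2:ℝ)⁻¹ ^ k * 2 ^ k) := by ring
    rw [this, ek]; linarith
  · refine le_of_mul_le_mul_right ?_ (mul_pos hs hk)
    have : (mm u s (XS v s) + 2⁻¹ ^ k) * (2 ^ s * 2 ^ k)
      = 2 ^ s * mm u s (XS v s) * 2 ^ k + 2 ^ s * ((2:ℝ)⁻¹ ^ k * 2 ^ k) := by ring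
    rw [this, ek]; linarith

lemma Ctx.F_bound (c : Ctx U X u v x ρ f F) (s : ℕ) :
    (F s : ℝ) / 2 ^ s ≤ f s ∧ (f s : ℝ) ≤ F s / 2 ^ s + 2⁻¹ ^ s := by
  have hs : (0:ℝ) < 2 ^ s := by positivity
  obtain ⟨h1, h2⟩ := c.hF s
  constructor
  · rwa [div_le_iff₀ hs]
  · rw [inv_pow, ← one_div, ← add_div, le_div_iff₀ hs]
    exact h2

lemma Ctx.gap (c : Ctx U X u v x ρ f F) {s t : ℕ} (hst : s ≤ t) (hs : Act u v F ρ s)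
    (ht : Act u v F ρ t) :
    mm u t (XS v t) ≤ mm u s (XS v s) + 3 * 2⁻¹ ^ (run u v F ρ s).2.2 := by
  have h1 := (cond_bound c.apx ht).1
  have h2 := (cond_bound c.apx hs).2
  have h3 := (c.F_bound t).1
  have h4 := (c.F_bound s).2
  have h5 : (f t : ℝ) ≤ f s := by exact_mod_cast c.anti hst
  have h6 : (2:ℝ)⁻¹ ^ (run u v F ρ t).2.2 ≤ 2⁻¹ ^ (run u v F ρ s).2.2 :=
    pow_le_pow_of_le_one (by norm_num) (by norm_num) (run_mono hst).2
  have h7 : (2:ℝ)⁻¹ ^ s ≤ 2⁻¹ ^ (run u v F ρ s).2.2 :=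
    pow_le_pow_of_le_one (by norm_num) (by norm_num) hs.2.2.2
  linarith

lemma Ctx.out (c : Ctx U X u v x ρ f F) {t : ℕ} {τ y : List Bool} (h : u t (ρ ++ τ) = some y) :
    y = x ∧ ∃ t, τ ∈ (run u v F ρ t).2.1 := by
  have : y ∈ U (ρ ++ τ) := (c.apx.uspec _ _).2 ⟨t, h⟩
  rw [c.hρ] at this
  exact mem_mach.1 this

lemma Ctx.progress (c : Ctx U X u v x ρ f F) (t : ℕ) :
    ∃ t' ≥ t, run u v F ρ t' = run u v F ρ t ∧ Act u v F ρ t' := by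
  by_contra hcon
  push Not at hcon
  have hconst : ∀ t' ≥ t, run u v F ρ t' = run u v F ρ t := by
    intro t' ht'
    induction t', ht' using Nat.le_induction with
    | base => rfl
    | succ n hn ih =>
      have := hcon n hn ih
      rw [run_not this, ih]
  have hinv := inv_run (u := u) (v := v) (F := F) (ρ := ρ) t
  have ev1 : ∀ᶠ t' in atTop, ∀ τ ∈ (run u v F ρ t).2.1.toFinset, (u t' (ρ ++ τ)).isSome = true := by
    rw [Filter.eventually_all_finset]
    intro τ hτ
    have : x ∈ U (ρ ++ τ) := by
      rw [c.hρ]; exact mem_mach.2 ⟨rfl, t, by simpa using hτ⟩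
    obtain ⟨s, hs⟩ := (c.apx.uspec _ _).1 this
    filter_upwards [eventually_ge_atTop s] with t' ht'
    rw [c.apx.umono _ _ _ _ ht' hs]; rfl
  have ev2 : ∀ t', ∀ p ∈ (run u v F ρ t).1, (u t' (ρ ++ p.2)).isSome = false := by
    intro t' p hp
    cases e : u t' (ρ ++ p.2) with
    | none => rfl
    | some y =>
      exfalso
      obtain ⟨-, w, hw⟩ := c.out e
      have h1 := (run_mono (u := u) (v := v) (F := F) (ρ := ρ) (le_max_left w t)).1 hw
      rw [hconst _ (le_max_right w t)] at h1
      have := (List.pairwise_append.1 hinv.1).2.2 p.2 (List.mem_map_of_mem hp) p.2 h1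
      exact this.1 List.prefix_rfl
  have ev3 : ∀ᶠ t' in atTop, ((num u v t' - F t') + (F t' - num u v t')) * 2 ^ (run u v F ρ t).2.2
      ≤ 2 ^ t' := by
    set k := (run u v F ρ t).2.2
    have hpos : (0:ℝ) < 2⁻¹ ^ k / 2 := by positivity
    have l1 := tendsto_mm c.apx
    have l2 : Tendsto (fun t' => mm u t' (XS v t') - f t') atTop (nhds 0) := by
      simpa using l1.sub c.lim
    have l3 : Tendsto (fun t' : ℕ => (2:ℝ)⁻¹ ^ t') atTop (nhds 0) :=
      tendsto_pow_atTop_nhds_zero_of_lt_one (by norm_num) (by norm_num)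
    filter_upwards [(Metric.tendsto_nhds.1 l2) _ hpos, (Metric.tendsto_nhds.1 l3) _ hpos] with t' h1 h2
    rw [Real.dist_eq, sub_zero, abs_lt] at h1 h2
    have hB := c.F_bound t'
    have hs : (0:ℝ) < 2 ^ t' := by positivity
    have hk : (0:ℝ) < 2 ^ k := by positivity
    have ek : (2:ℝ)⁻¹ ^ k * 2 ^ k = 1 := by rw [inv_pow, inv_mul_cancel₀ hk.ne']
    have eF : (F t' : ℝ) = (F t' / 2 ^ t' : ℝ) * 2 ^ t' := by field_simp
    have eN := num_eq c.apx t'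
    generalize (F t' / 2 ^ t' : ℝ) = q at *
    have hp : (0:ℝ) < 2 ^ t' * 2 ^ k := mul_pos hs hk
    have d1 : (mm u t' (XS v t') - q) * (2 ^ t' * 2 ^ k) ≤ 2⁻¹ ^ k * (2 ^ t' * 2 ^ k) :=
      mul_le_mul_of_nonneg_right (by linarith) hp.le
    have d2 : (q - mm u t' (XS v t')) * (2 ^ t' * 2 ^ k) ≤ 2⁻¹ ^ k * (2 ^ t' * 2 ^ k) :=
      mul_le_mul_of_nonneg_right (by linarith) hp.le
    have d3 : (2:ℝ)⁻¹ ^ k * (2 ^ t' * 2 ^ k) = 2 ^ t' := by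
      calc (2:ℝ)⁻¹ ^ k * (2 ^ t' * 2 ^ k) = 2 ^ t' * ((2:ℝ)⁻¹ ^ k * 2 ^ k) := by ring
        _ = _ := by rw [ek, mul_one]
    rw [d3] at d1 d2
    rcases le_total (F t') (num u v t') with hle | hle
    · rw [Nat.sub_eq_zero_of_le hle, add_zero]
      have : (((num u v t' - F t') * 2 ^ k : ℕ) : ℝ) ≤ ((2 ^ t' : ℕ) : ℝ) := by
        push_cast [Nat.cast_sub hle]
        rw [eN, eF]
        linarith
      exact_mod_cast this
    · rw [Nat.sub_eq_zero_of_le hle, zero_add]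
      have : (((F t' - num u v t') * 2 ^ k : ℕ) : ℝ) ≤ ((2 ^ t' : ℕ) : ℝ) := by
        push_cast [Nat.cast_sub hle]
        rw [eN, eF]
        linarith
      exact_mod_cast this
  obtain ⟨t', h1, h3, h4, h5⟩ := (ev1.and (ev3.and ((eventually_ge_atTop (run u v F ρ t).2.2).and
    (eventually_ge_atTop t)))).exists
  refine hcon t' h5 (hconst t' h5) ?_
  unfold Act
  rw [hconst t' h5]
  exact ⟨fun τ hτ => h1 τ (by simpa using hτ), ev2 t', h3, h4⟩

lemma Apx.incr (h : Apx U X u v) {s0 s t : ℕ} (h0 : s0 ≤ s) (hst : s ≤ t) {cc K : ℝ}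
    (hK : 0 ≤ K) (hcK : cc ≤ K * 2⁻¹ ^ s0) (hR : cc ≤ RR u v s t) :
    K * RR u v s0 s + mm u s (ZZ u v s0 s) + cc ≤ K * RR u v s0 t + mm u t (ZZ u v s0 t) := by
  have hadd := h.RR_add h0 hst
  by_cases hb : ∃ b ∈ XS v s \ XS v t, ∃ σ, u s0 σ = some b
  · obtain ⟨b, hb, σ, e⟩ := hb
    have h1 : (2:ℝ)⁻¹ ^ s0 ≤ RR u v s t := h.le_mm (h0.trans hst) hb e
    have h2 : mm u s (ZZ u v s0 s) ≤ mm u t (ZZ u v s0 t) := by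
      refine h.mm_mono hst ?_
      rintro b ⟨⟨hb, hb'⟩, hb2⟩
      exact ⟨⟨hb, fun h' => hb' (h.XS_anti hst h')⟩, hb2⟩
    have h3 : K * (RR u v s0 s + 2⁻¹ ^ s0) ≤ K * RR u v s0 t :=
      mul_le_mul_of_nonneg_left (by linarith) hK
    rw [mul_add] at h3
    linarith
  · push Not at hb
    have h1 : mm u t (ZZ u v s0 s ∪ (XS v s \ XS v t)) = _ := mm_union (u := u) (s := t) (by
      rw [Set.disjoint_left]
      rintro b ⟨⟨_, hb⟩, _⟩ ⟨hb', _⟩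
      exact hb hb')
    have h2 : mm u t (ZZ u v s0 s ∪ (XS v s \ XS v t)) ≤ mm u t (ZZ u v s0 t) := by
      refine h.mm_mono le_rfl ?_
      rintro b (⟨⟨hb1, hb'⟩, hb2⟩ | hb1)
      · exact ⟨⟨hb1, fun h' => hb' (h.XS_anti hst h')⟩, hb2⟩
      · exact ⟨⟨h.XS_anti h0 hb1.1, hb1.2⟩, hb b hb1⟩
    have h3 : mm u s (ZZ u v s0 s) ≤ mm u t (ZZ u v s0 s) := h.mm_mono hst le_rfl
    have h4 : 0 ≤ RR u v s t := mm_nonneg _ _ _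
    have h5 : K * RR u v s0 s ≤ K * RR u v s0 t := mul_le_mul_of_nonneg_left (by linarith) hK
    have : RR u v s t = mm u t (XS v s \ XS v t) := rfl
    linarith

def Phase (u : ℕ → List Bool → Option (List Bool)) (v : ℕ → List Bool → Option Unit)
    (F : ℕ → ℕ) (ρ : List Bool) (j : ℕ) : Prop :=
  ∀ s τ L E k, Act u v F ρ s → run u v F ρ s = ((j, τ) :: L, E, k) →
    ∃ t, s ≤ t ∧ Act u v F ρ t ∧ ∃ T k', run u v F ρ t = (L, T ++ E, k') ∧
      (T.map fun τ' => (2:ℝ)⁻¹ ^ τ'.length).sum = 2⁻¹ ^ τ.length ∧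
      (∀ τ' ∈ T, u s (ρ ++ τ') = none) ∧
      (j / 2 : ℝ) * 2⁻¹ ^ ρ.length * 2⁻¹ ^ τ.length ≤ RR u v s t

lemma none_mono (h : Apx U X u v) {s t : ℕ} (hst : s ≤ t) {σ : List Bool} (e : u t σ = none) :
    u s σ = none := by
  cases e' : u s σ with
  | none => rfl
  | some y => rw [h.umono _ _ _ _ hst e'] at e; cases e

lemma children (h : Apx U X u v) {j : ℕ} (ih : Phase u v F ρ j) {s0 ℓ : ℕ} {K : ℝ} (hK : 0 ≤ K)
    {τ : List Bool} {L : List (ℕ × List Bool)}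
    (hcK : (j / 2 : ℝ) * 2⁻¹ ^ ρ.length * 2⁻¹ ^ ℓ ≤ K * 2⁻¹ ^ s0) :
    ∀ (W : List (List Bool)), (∀ w ∈ W, (τ ++ w).length = ℓ) → ∀ s E k, s0 ≤ s → Act u v F ρ s →
      run u v F ρ s = (W.map (fun w => (j, τ ++ w)) ++ L, E, k) →
      ∃ t, s ≤ t ∧ Act u v F ρ t ∧ ∃ T k', run u v F ρ t = (L, T ++ E, k') ∧
      (T.map fun τ' => (2:ℝ)⁻¹ ^ τ'.length).sum = W.length * 2⁻¹ ^ ℓ ∧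
      (∀ τ' ∈ T, u s (ρ ++ τ') = none) ∧
      K * RR u v s0 s + mm u s (ZZ u v s0 s) + W.length * ((j / 2 : ℝ) * 2⁻¹ ^ ρ.length * 2⁻¹ ^ ℓ)
        ≤ K * RR u v s0 t + mm u t (ZZ u v s0 t) := by
  intro W
  induction W with
  | nil =>
    intro _ s E k h0 hA hr
    refine ⟨s, le_rfl, hA, [], k, by simpa using hr, by simp, by simp, by simp⟩
  | cons w W ihW =>
    intro hW s E k h0 hA hr
    obtain ⟨t1, ht1, hA1, T1, k1, hr1, hs1, hn1, hR1⟩ := ih s (τ ++ w) _ E k hA (by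
      rw [hr, List.map_cons, List.cons_append])
    have hl : (τ ++ w).length = ℓ := hW w (by simp)
    rw [hl] at hs1 hR1
    obtain ⟨t2, ht2, hA2, T2, k2, hr2, hs2, hn2, hR2⟩ := ihW (fun w' hw' => hW w' (by simp [hw']))
      t1 (T1 ++ E) k1 (h0.trans ht1) hA1 hr1
    refine ⟨t2, ht1.trans ht2, hA2, T2 ++ T1, k2, by rw [hr2, List.append_assoc], ?_, ?_, ?_⟩
    · rw [List.map_append, List.sum_append, hs1, hs2, List.length_cons]
      push_cast; ring
    · intro τ' hτ'
      rcases List.mem_append.1 hτ' with h' | h'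
      · exact none_mono h ht1 (hn2 _ h')
      · exact hn1 _ h'
    · have := h.incr h0 ht1 hK hcK hR1
      rw [List.length_cons]
      push_cast
      linarith

lemma Ctx.phase (c : Ctx U X u v x ρ f F) :
    ∀ j, j ≤ 2 ^ (ρ.length + 2) → Phase u v F ρ j := by
  intro j
  induction j with
  | zero =>
    intro _ s τ L E k hA hr
    have hr1 : run u v F ρ (s+1) = (L, τ :: E, k) := by
      rw [run_act hA, hr, act]
    obtain ⟨t, ht, hrt, hAt⟩ := c.progress (s+1)
    refine ⟨t, by omega, hAt, [τ], k, by rw [hrt, hr1]; rfl, by simp, ?_, ?_⟩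
    · intro τ' hτ'
      rw [List.mem_singleton] at hτ'
      subst hτ'
      have := hA.2.1 (0, τ') (by rw [hr]; simp)
      simpa using this
    · simp only [Nat.cast_zero, zero_div, zero_mul]
      exact mm_nonneg _ _ _
  | succ j ihj =>
    intro hj s τ L E k hA hr
    have ih := ihj (by omega)
    set d := ρ.length with hd
    set n := s + (d + 3) with hn
    have hr1 : run u v F ρ (s+1) = ((allStr n).map (fun w => (j, τ ++ w)) ++ L, E, k + n) := by
      rw [run_act hA, hr, act]
    obtain ⟨t1, ht1, hrt1, hA1⟩ := c.progress (s+1)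
    rw [hr1] at hrt1
    set A : ℝ := 2⁻¹ ^ τ.length with hAdef
    set δ : ℝ := 2⁻¹ ^ d with hδ
    have hδ0 : 0 < δ := by positivity
    have hA0 : 0 < A := by positivity
    have hj0 : (0:ℝ) ≤ j := by positivity
    obtain ⟨t, ht, hAt, T, k', hrt, hTs, hTn, hTR⟩ := children c.apx ih (s0 := s) (ℓ := τ.length + n)
      (K := (j / 2 : ℝ) * δ * A * 2⁻¹ ^ (d + 3)) (by positivity) (τ := τ) (L := L) (by
        apply le_of_eq
        rw [hn, pow_add, pow_add]; ring) (allStr n) (by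
        intro w hw
        rw [List.length_append, length_of_mem_allStr hw]) t1 E (k + n) (by omega) hA1 hrt1
    have hst : s ≤ t := by omega
    have e2 : ((allStr n).length : ℝ) * 2⁻¹ ^ (τ.length + n) = A := by
      rw [length_allStr, pow_add (2⁻¹ : ℝ)]
      push_cast
      have : (2:ℝ) ^ n * 2⁻¹ ^ n = 1 := by rw [← mul_pow]; norm_num
      calc (2:ℝ) ^ n * (A * 2⁻¹ ^ n) = A * (2 ^ n * 2⁻¹ ^ n) := by ring
        _ = A := by rw [this, mul_one]
    rw [e2] at hTs
    have hTn' : ∀ τ' ∈ T, u s (ρ ++ τ') = none := fun τ' h' =>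
      none_mono c.apx (by omega) (hTn τ' h')
    refine ⟨t, hst, hAt, T, k', hrt, hTs, hTn', ?_⟩
    have hnodup : T.Nodup := by
      have i := (inv_run (u := u) (v := v) (F := F) (ρ := ρ) t).1
      rw [hrt] at i
      have i2 := (List.pairwise_append.1 (List.pairwise_append.1 i).2.1).1
      refine i2.imp ?_
      rintro a b hab rfl
      exact hab.1 List.prefix_rfl
    have hTt : ∀ τ' ∈ T, u t (ρ ++ τ') = some x := by
      intro τ' h'
      have := hAt.1 τ' (by rw [hrt]; exact List.mem_append_left _ h')
      obtain ⟨y, hy⟩ := Option.isSome_iff_exists.1 this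
      rw [hy, (c.out hy).1]
    have key := c.apx.key hst (X' := XS v s) (Z := ZZ u v s t) (x := x) (ρ := ρ)
      (c.apx.sub_XS s c.hx) hnodup hTt hTn' (fun b hb => hb.1.1)
      (fun hb => hb.1.2 (c.apx.sub_XS t c.hx)) (fun b hb => hb.2)
    rw [hTs, c.apx.RR_eq hst, ← hd, ← hδ] at key
    have gap := c.gap hst hA hAt
    have hk : (2:ℝ)⁻¹ ^ (run u v F ρ s).2.2 ≤ δ * A / 16 := by
      have i := (inv_run (u := u) (v := v) (F := F) (ρ := ρ) s).2 (j+1, τ) (by rw [hr]; simp)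
      calc (2:ℝ)⁻¹ ^ (run u v F ρ s).2.2 ≤ 2⁻¹ ^ (d + 4 + τ.length) :=
            pow_le_pow_of_le_one (by norm_num) (by norm_num) i
        _ = δ * A / 16 := by rw [pow_add, pow_add]; norm_num; ring
    have hR1 : RR u v s t ≤ 1 := c.apx.mm_le_one _ _
    have hjb : (j : ℝ) * 2⁻¹ ^ (d + 3) ≤ 1 / 2 := by
      have : (j : ℝ) ≤ 2 ^ (d + 2) := by exact_mod_cast (by omega : j ≤ 2 ^ (d + 2))
      calc (j : ℝ) * 2⁻¹ ^ (d + 3) ≤ 2 ^ (d + 2) * 2⁻¹ ^ (d + 3) := by gcongr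
        _ = (2 ^ (d+2) * 2⁻¹ ^ (d + 2)) * 2⁻¹ := by ring
        _ = 1 / 2 := by rw [← mul_pow]; norm_num
    have hK1 : (j / 2 : ℝ) * δ * A * 2⁻¹ ^ (d + 3) * RR u v s t ≤ δ * A / 4 := by
      calc (j / 2 : ℝ) * δ * A * 2⁻¹ ^ (d + 3) * RR u v s t
          ≤ (j / 2 : ℝ) * δ * A * 2⁻¹ ^ (d + 3) * 1 := by gcongr
        _ = (j : ℝ) * 2⁻¹ ^ (d + 3) * (δ * A / 2) := by ring
        _ ≤ 1 / 2 * (δ * A / 2) := by gcongr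
        _ = _ := by ring
    have hK0 : 0 ≤ (j / 2 : ℝ) * δ * A * 2⁻¹ ^ (d + 3) * RR u v s t1 :=
      mul_nonneg (by positivity) (mm_nonneg _ _ _)
    have hm0 : 0 ≤ mm u t1 (ZZ u v s t1) := mm_nonneg _ _ _
    have e3 : ((allStr n).length : ℝ) * ((j / 2 : ℝ) * δ * 2⁻¹ ^ (τ.length + n)) = j / 2 * δ * A := by
      rw [← e2]; ring
    rw [e3] at hTR
    have hDA : 0 < δ * A := by positivity
    push_cast
    have : ((j : ℝ) + 1) / 2 * δ * A = j / 2 * δ * A + δ * A / 2 := by ring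
    rw [this]
    linarith

lemma Ctx.false (c : Ctx U X u v x ρ f F) : False := by
  obtain ⟨s, -, hrs, hAs⟩ := c.progress 0
  obtain ⟨t, _, _, T, k, _, _, _, hR⟩ := c.phase _ le_rfl s [] [] [] (ρ.length + 4) hAs hrs
  have h1 : RR u v s t ≤ 1 := c.apx.mm_le_one _ _
  have h2 : ((2 ^ (ρ.length + 2) : ℕ) / 2 : ℝ) * 2⁻¹ ^ ρ.length * 2⁻¹ ^ ([] : List Bool).length = 2 := by
    push_cast
    have : (2:ℝ) ^ ρ.length * 2⁻¹ ^ ρ.length = 1 := by rw [← mul_pow]; norm_num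
    rw [List.length_nil, pow_add]
    calc _ = 2 * ((2:ℝ) ^ ρ.length * 2⁻¹ ^ ρ.length) := by ring
      _ = 2 := by rw [this, mul_one]
  rw [h2] at hR
  linarith

end

theorem main {U : List Bool →. List Bool} (hU : UniversalPFM U) {X : Set (List Bool)}
    (hX : Pi01 X) (hR : RightCE (Omega U X)) : ¬ MLRandom (Omega U X) := by
  rcases X.eq_empty_or_nonempty with rfl | ⟨x, hx⟩
  · have : Omega U ∅ = 0 := by
      unfold Omega
      have : IsEmpty {σ : List Bool // ∃ y ∈ U σ, y ∈ (∅ : Set (List Bool))} :=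
        ⟨fun ⟨_, _, _, h⟩ => h⟩
      exact tsum_empty
    rw [this]
    exact not_random_zero
  · exfalso
    obtain ⟨u, hu, um, us, ub⟩ := partrec_approx hU.1.1
    obtain ⟨v, hv, vm, vs, -⟩ := partrec_approx hX
    obtain ⟨f, hf, fa, fl⟩ := hR
    have f0 : ∀ n, 0 ≤ f n := by
      intro n
      have : Omega U X ≤ f n := by
        have fa' : Antitone (fun m : ℕ => (f m : ℝ)) := fun a b hab => Rat.cast_le.2 (fa hab)
        exact fa'.le_of_tendsto fl n
      have h2 := (Omega_nonneg U X).trans this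
      exact_mod_cast h2
    obtain ⟨F, hFc, hF⟩ := rightCE_approx hf f0
    obtain ⟨ρ, hρ⟩ := exists_prefix hU (partrec_mach (computable_run hu hv hFc) x)
      (fun ρ => pf_mach x ρ)
    have apx : Apx U X u v := by
      refine ⟨um, us, ub, vm, ?_, hU.1.2⟩
      intro a
      rw [← vs a ()]
      simp
    exact Ctx.false (x := x) (ρ := ρ) (f := f) (F := F) ⟨apx, hx, fa, fl, hF, hρ⟩

end OmegaAux

/-- If `U` is a universal prefix-free machine, `X` is a Π⁰₁ set, and `Ω_U(X)` is a
right-c.e. real, then `Ω_U(X)` is not Martin-Löf random. -/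
theorem omega_rightCE_not_random (U : List Bool →. List Bool) (X : Set (List Bool))
    (hU : UniversalPFM U) (hX : Pi01 X) (h : RightCE (Omega U X)) :
    ¬ MLRandom (Omega U X) := by
  exact OmegaAux.main hU hX h
end

section
/- If δ is a d.c.e. real which is not Martin-Löf random and α is a Martin-Löf random left-c.e. real, then α + δ is a Martin-Löf random left-c.e. real. -/
open Filter MeasureTheory Set

/-- A real is d.c.e. if it is the difference of two left-c.e. reals. -/
def DCE (x : ℝ) : Prop := ∃ a b : ℝ, LeftCE a ∧ LeftCE b ∧ x = a - b


namespace DCEaux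

open Encodable Denumerable

/-- old code of a rational -/
def ratE (q : ℚ) : ℕ := @encode ℚ Rat.instEncodable q

lemma ratE_eq (q : ℚ) : ratE q = Nat.pair (encode q.num) q.den := rfl

lemma ratE_inj : Function.Injective ratE := @encode_injective ℚ Rat.instEncodable

def ratS : Set ℕ := Set.range ratE

lemma encode_int_even (n : ℕ) : encode (n : ℤ) = 2 * n := rfl
lemma encode_int_odd (n : ℕ) : encode (Int.negSucc n) = 2 * n + 1 := rfl

def cpos (k : ℕ) : ℕ := bif k.bodd then 0 else k.div2
def cneg (k : ℕ) : ℕ := bif k.bodd then k.div2 + 1 else 0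

lemma int_cpos (z : ℤ) : (z : ℤ) = (cpos (encode z) : ℤ) - (cneg (encode z) : ℤ) := by
  cases z with
  | ofNat n =>
    have : encode (Int.ofNat n) = 2 * n := rfl
    rw [this]
    simp [cpos, cneg]
  | negSucc n =>
    have : encode (Int.negSucc n) = 2 * n + 1 := rfl
    have h2 : (2 * n + 1).div2 = n := by rw [Nat.div2_val]; omega
    rw [this]
    simp [cpos, cneg]
    omega

lemma primrec_cpos : Primrec cpos :=
  Primrec.cond Primrec.nat_bodd (Primrec.const 0) Primrec.nat_div2
lemma primrec_cneg : Primrec cneg :=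
  Primrec.cond Primrec.nat_bodd (Primrec.succ.comp Primrec.nat_div2) (Primrec.const 0)

lemma mem_ratS (n : ℕ) : n ∈ ratS ↔ 0 < n.unpair.2 ∧
    ∀ x < n + 1, 2 ≤ x → ¬ ((cpos n.unpair.1 + cneg n.unpair.1) % x = 0 ∧ n.unpair.2 % x = 0) := by
  obtain ⟨z, hz⟩ : ∃ z : ℤ, encode z = n.unpair.1 := ⟨ofNat ℤ n.unpair.1, encode_ofNat _⟩
  have hab : cpos n.unpair.1 + cneg n.unpair.1 = z.natAbs := by
    rw [← hz]
    cases z with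
    | ofNat n =>
      have : encode (Int.ofNat n) = 2 * n := rfl
      rw [this]
      simp [cpos, cneg]
    | negSucc n =>
      have : encode (Int.negSucc n) = 2 * n + 1 := rfl
      have h2 : (2 * n + 1).div2 = n := by rw [Nat.div2_val]; omega
      rw [this]
      simp [cpos, cneg]
  rw [hab]
  constructor
  · rintro ⟨q, hq⟩
    rw [ratE_eq] at hq
    have h1 : n.unpair.1 = encode q.num := by rw [← hq]; simp
    have h2 : n.unpair.2 = q.den := by rw [← hq]; simp
    have h3 : z = q.num := by
      apply encode_injective; rw [hz, h1]
    rw [h2, h3]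
    refine ⟨q.den_pos, fun x _ hx h => ?_⟩
    have := Nat.dvd_gcd (Nat.dvd_of_mod_eq_zero h.1) (Nat.dvd_of_mod_eq_zero h.2)
    rw [q.reduced] at this
    have := Nat.le_of_dvd one_pos this
    omega
  · rintro ⟨h0, h⟩
    have hc : z.natAbs.Coprime n.unpair.2 := by
      by_contra hc
      have hpos : 0 < Nat.gcd z.natAbs n.unpair.2 := Nat.gcd_pos_of_pos_right _ h0
      have hle : Nat.gcd z.natAbs n.unpair.2 ≤ n.unpair.2 := Nat.gcd_le_right _ h0
      have hle' := Nat.unpair_right_le n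
      have hne : Nat.gcd z.natAbs n.unpair.2 ≠ 1 := hc
      exact h _ (by omega) (by omega) ⟨Nat.mod_eq_zero_of_dvd (Nat.gcd_dvd_left _ _),
        Nat.mod_eq_zero_of_dvd (Nat.gcd_dvd_right _ _)⟩
    refine ⟨⟨z, n.unpair.2, h0.ne', hc⟩, ?_⟩
    rw [ratE_eq]
    simp [hz]

lemma primrec_ratS : PrimrecPred (fun n => n ∈ ratS) := by
  have hR : PrimrecRel (fun (x n : ℕ) => ¬ (2 ≤ x ∧
      ((cpos n.unpair.1 + cneg n.unpair.1) % x = 0 ∧ n.unpair.2 % x = 0))) := by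
    have hn : Primrec (fun p : ℕ × ℕ => p.2.unpair) := Primrec.unpair.comp Primrec.snd
    have hn1 := Primrec.fst.comp hn
    have hn2 := Primrec.snd.comp hn
    refine PrimrecPred.not (PrimrecPred.and
      (Primrec.nat_le.comp (Primrec.const 2) Primrec.fst) (PrimrecPred.and ?_ ?_))
    · exact Primrec.eq.comp (Primrec.nat_mod.comp (Primrec.nat_add.comp
        (primrec_cpos.comp hn1) (primrec_cneg.comp hn1)) Primrec.fst) (Primrec.const 0)
    · exact Primrec.eq.comp (Primrec.nat_mod.comp hn2 Primrec.fst) (Primrec.const 0)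
  have h2 := (PrimrecRel.forall_lt hR).comp (Primrec.succ) (Primrec.id)
  have h3 : PrimrecPred (fun n : ℕ => 0 < n.unpair.2) :=
    Primrec.nat_lt.comp (Primrec.const 0) (Primrec.snd.comp Primrec.unpair)
  refine (h3.and h2).of_eq fun n => ?_
  rw [mem_ratS]
  simp only [not_and, id]

/-- enumeration of old codes -/
def ratEn (n : ℕ) : ℕ := ratE (ofNat ℚ n)

lemma ratEn_succ (n : ℕ) : ∃ h : ∃ m, ratEn n + m + 1 ∈ ratS,
    ∃ _ : DecidablePred (fun m => ratEn n + m + 1 ∈ ratS),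
    ratEn (n + 1) = ratEn n + Nat.find h + 1 := by
  let hdec := @decidableRangeEncode ℚ Rat.instEncodable
  let hinf : Infinite (Set.range (@encode ℚ Rat.instEncodable)) :=
    Infinite.of_injective _ (Equiv.ofInjective _ (@encode_injective ℚ Rat.instEncodable)).injective
  have key : ∀ n, ratEn n = (Nat.Subtype.ofNat (Set.range (@encode ℚ Rat.instEncodable)) n : ℕ) := by
    intro n
    obtain ⟨q, hq⟩ := (Nat.Subtype.ofNat (Set.range (@encode ℚ Rat.instEncodable)) n).2
    have : ofNat ℚ n = (@equivRangeEncode ℚ Rat.instEncodable).symm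
      (Nat.Subtype.ofNat (Set.range (@encode ℚ Rat.instEncodable)) n) := by
      rfl
    unfold ratEn ratE
    rw [this]
    exact congrArg Subtype.val ((@equivRangeEncode ℚ Rat.instEncodable).apply_symm_apply _)
  have hx := Nat.Subtype.exists_succ (Nat.Subtype.ofNat (Set.range (@encode ℚ Rat.instEncodable)) n)
  rw [← key] at hx
  refine ⟨hx, fun _ => hdec _, ?_⟩
  rw [key (n+1)]
  show ((Nat.Subtype.succ (Nat.Subtype.ofNat (Set.range (@encode ℚ Rat.instEncodable)) n) : _) : ℕ) = _
  unfold Nat.Subtype.succ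
  simp only [← key]
  rfl

lemma computable_ratEn : Computable ratEn := by
  classical
  obtain ⟨_, hS⟩ := primrec_ratS
  have hstep : Partrec₂ (fun (_ : ℕ) (p : ℕ × ℕ) =>
      (Nat.rfind (fun m => Part.some (decide (p.2 + m + 1 ∈ ratS)))).map
        (fun m => p.2 + m + 1)) := by
    have hadd : Computable₂ (fun (p : ℕ × (ℕ × ℕ)) (m : ℕ) => p.2.2 + m + 1) :=
      (Primrec.succ.comp (Primrec.nat_add.comp
        (Primrec.snd.comp (Primrec.snd.comp Primrec.fst)) Primrec.snd)).to_comp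
    refine Partrec.map (Partrec.rfind ?_) hadd
    have := (hS.to_comp.comp₂ hadd)
    refine Computable₂.partrec₂ (this.of_eq fun n => ?_)
    congr!
  have := Partrec.nat_rec (f := fun n : ℕ => n) (g := fun _ : ℕ => Part.some (ratEn 0))
    Computable.id (Computable.const (ratEn 0)).partrec hstep
  refine this.of_eq_tot fun n => ?_
  induction n with
  | zero => simp
  | succ n ih =>
    simp only
    refine Part.mem_bind_iff.2 ⟨_, ih, ?_⟩
    obtain ⟨h, inst, h2⟩ := ratEn_succ n
    rw [h2]
    refine (Part.mem_map_iff _).2 ⟨Nat.find h, ?_, rfl⟩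
    exact Nat.mem_rfind.2 ⟨by simpa using Nat.find_spec h,
      fun {m} hm => by simpa using Nat.find_min h hm⟩

lemma computable_ratE : Computable ratE :=
  (computable_ratEn.comp Computable.encode).of_eq fun q => by rw [ratEn, ofNat_encode]

def rp (q : ℚ) : ℕ := cpos (ratE q).unpair.1
def rn (q : ℚ) : ℕ := cneg (ratE q).unpair.1
def rd (q : ℚ) : ℕ := (ratE q).unpair.2

lemma rd_pos (q : ℚ) : 0 < rd q := by simp [rd, ratE_eq, q.den_pos]
lemma rat_eq (q : ℚ) : q = ((rp q : ℚ) - rn q) / rd q := by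
  have := int_cpos q.num
  have h2 : ((rp q : ℚ) - rn q) = q.num := by
    rw [this]; simp [rp, rn, ratE_eq]
  rw [h2]; simp [rd, ratE_eq, Rat.num_div_den]

lemma comp_rp : Computable rp := primrec_cpos.to_comp.comp
  (Computable.fst.comp (Computable.unpair.comp computable_ratE))
lemma comp_rn : Computable rn := primrec_cneg.to_comp.comp
  (Computable.fst.comp (Computable.unpair.comp computable_ratE))
lemma comp_rd : Computable rd :=
  (Computable.snd.comp (Computable.unpair.comp computable_ratE))

lemma comp_of_graph' {α β : Type*} [Primcodable α] [Denumerable β] {f : α → β} {c : α × β → Bool}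
    (hc : Computable c) (h : ∀ a q, c (a, q) = true ↔ q = f a) : Computable f := by
  have h1 : Partrec (fun a => Nat.rfind (fun n => Part.some (c (a, ofNat β n)))) := by
    refine Partrec.rfind ?_
    exact (hc.comp (Computable.fst.pair ((Computable.ofNat β).comp Computable.snd))).partrec
  have h2 := h1.map (((Computable.ofNat β).comp Computable.snd).to₂ :
    Computable₂ (fun (_ : α) (n : ℕ) => ofNat β n))
  refine h2.of_eq_tot fun a => ?_
  refine (Part.mem_map_iff _).2 ⟨encode (f a), ?_, ofNat_encode _⟩
  refine Nat.mem_rfind.2 ⟨?_, fun {m} hm => ?_⟩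
  · rw [ofNat_encode, (h a (f a)).2 rfl]; simp
  · simp only [Part.mem_some_iff]
    by_contra hh
    have hh : c (a, ofNat β m) = true := by
      cases hb : c (a, ofNat β m)
      · exact absurd hb.symm hh
      · rfl
    rw [h] at hh
    rw [← hh, encode_ofNat] at hm
    exact lt_irrefl _ hm

lemma comp_of_graph {α : Type*} [Primcodable α] {f : α → ℚ} {c : α × ℚ → Bool}
    (hc : Computable c) (h : ∀ a q, c (a, q) = true ↔ q = f a) : Computable f :=
  comp_of_graph' hc h

lemma comp_nle : Computable₂ (fun a b : ℕ => decide (a ≤ b)) := by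
  obtain ⟨_, h⟩ := Primrec.nat_le
  exact h.to_comp.of_eq fun n => by congr!
lemma comp_neq : Computable₂ (fun a b : ℕ => decide (a = b)) := by
  obtain ⟨_, h⟩ := (Primrec.eq (α := ℕ))
  exact h.to_comp.of_eq fun n => by congr!

lemma comp_nadd : Computable₂ (fun a b : ℕ => a + b) := Primrec.nat_add.to_comp
lemma comp_nmul : Computable₂ (fun a b : ℕ => a * b) := Primrec.nat_mul.to_comp

section
variable {α : Type*} [Primcodable α] {f g : α → ℚ}

lemma cadd (hf : Computable f) (hg : Computable g) : Computable (fun a => f a + g a) := by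
  have F1 := hf.comp (Computable.fst (α := α) (β := ℚ))
  have G1 := hg.comp (Computable.fst (α := α) (β := ℚ))
  have Q1 : Computable (fun p : α × ℚ => p.2) := Computable.snd
  have pf := comp_rp.comp F1
  have nf := comp_rn.comp F1
  have df := comp_rd.comp F1
  have pg := comp_rp.comp G1
  have ng := comp_rn.comp G1
  have dg := comp_rd.comp G1
  have pq := comp_rp.comp Q1
  have nq := comp_rn.comp Q1
  have dq := comp_rd.comp Q1
  have L := comp_nadd.comp (comp_nmul.comp (comp_nadd.comp (comp_nmul.comp pf dg)
    (comp_nmul.comp pg df)) dq) (comp_nmul.comp nq (comp_nmul.comp df dg))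
  have R := comp_nadd.comp (comp_nmul.comp (comp_nadd.comp (comp_nmul.comp nf dg)
    (comp_nmul.comp ng df)) dq) (comp_nmul.comp pq (comp_nmul.comp df dg))
  have hC := comp_neq.comp L R
  refine comp_of_graph hC fun a q => ?_
  clear hC L R
  have h1 : (rd (f a) : ℚ) ≠ 0 := by have := rd_pos (f a); positivity
  have h2 : (rd (g a) : ℚ) ≠ 0 := by have := rd_pos (g a); positivity
  have h3 : (rd q : ℚ) ≠ 0 := by have := rd_pos q; positivity
  simp only [decide_eq_true_iff]
  conv_rhs => rw [rat_eq q, rat_eq (f a), rat_eq (g a)]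
  rw [← Nat.cast_inj (R := ℚ)]
  push_cast
  field_simp
  constructor <;> intro h <;> linarith

lemma cneg' (hf : Computable f) : Computable (fun a => - f a) := by
  have F1 := hf.comp (Computable.fst (α := α) (β := ℚ))
  have Q1 : Computable (fun p : α × ℚ => p.2) := Computable.snd
  have pf := comp_rp.comp F1
  have nf := comp_rn.comp F1
  have df := comp_rd.comp F1
  have pq := comp_rp.comp Q1
  have nq := comp_rn.comp Q1
  have dq := comp_rd.comp Q1
  have L := comp_nadd.comp (comp_nmul.comp pf dq) (comp_nmul.comp pq df)
  have R := comp_nadd.comp (comp_nmul.comp nf dq) (comp_nmul.comp nq df)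
  have hC := comp_neq.comp L R
  refine comp_of_graph hC fun a q => ?_
  clear hC L R
  have h1 : (rd (f a) : ℚ) ≠ 0 := by have := rd_pos (f a); positivity
  have h3 : (rd q : ℚ) ≠ 0 := by have := rd_pos q; positivity
  simp only [decide_eq_true_iff]
  conv_rhs => rw [rat_eq q, rat_eq (f a)]
  rw [← Nat.cast_inj (R := ℚ)]
  push_cast
  rw [← neg_div, div_eq_div_iff h3 h1]
  constructor <;> intro h <;> linarith

lemma csub (hf : Computable f) (hg : Computable g) : Computable (fun a => f a - g a) :=
  (cadd hf (cneg' hg)).of_eq fun a => by ring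

lemma cmul (hf : Computable f) (hg : Computable g) : Computable (fun a => f a * g a) := by
  have F1 := hf.comp (Computable.fst (α := α) (β := ℚ))
  have G1 := hg.comp (Computable.fst (α := α) (β := ℚ))
  have Q1 : Computable (fun p : α × ℚ => p.2) := Computable.snd
  have pf := comp_rp.comp F1
  have nf := comp_rn.comp F1
  have df := comp_rd.comp F1
  have pg := comp_rp.comp G1
  have ng := comp_rn.comp G1
  have dg := comp_rd.comp G1
  have pq := comp_rp.comp Q1
  have nq := comp_rn.comp Q1
  have dq := comp_rd.comp Q1
  have L := comp_nadd.comp (comp_nmul.comp (comp_nadd.comp (comp_nmul.comp pf pg)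
    (comp_nmul.comp nf ng)) dq) (comp_nmul.comp nq (comp_nmul.comp df dg))
  have R := comp_nadd.comp (comp_nmul.comp (comp_nadd.comp (comp_nmul.comp nf pg)
    (comp_nmul.comp ng pf)) dq) (comp_nmul.comp pq (comp_nmul.comp df dg))
  have hC := comp_neq.comp L R
  refine comp_of_graph hC fun a q => ?_
  clear hC L R
  have h1 : (rd (f a) : ℚ) ≠ 0 := by have := rd_pos (f a); positivity
  have h2 : (rd (g a) : ℚ) ≠ 0 := by have := rd_pos (g a); positivity
  have h3 : (rd q : ℚ) ≠ 0 := by have := rd_pos q; positivity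
  simp only [decide_eq_true_iff]
  conv_rhs => rw [rat_eq q, rat_eq (f a), rat_eq (g a)]
  rw [← Nat.cast_inj (R := ℚ)]
  push_cast
  rw [div_mul_div_comm, div_eq_div_iff h3 (mul_ne_zero h1 h2)]
  constructor <;> intro h <;> linarith

lemma cle (hf : Computable f) (hg : Computable g) : Computable (fun a => decide (f a ≤ g a)) := by
  have pf := comp_rp.comp hf
  have nf := comp_rn.comp hf
  have df := comp_rd.comp hf
  have pg := comp_rp.comp hg
  have ng := comp_rn.comp hg
  have dg := comp_rd.comp hg
  have L := comp_nadd.comp (comp_nmul.comp pf dg) (comp_nmul.comp ng df)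
  have R := comp_nadd.comp (comp_nmul.comp pg df) (comp_nmul.comp nf dg)
  refine (comp_nle.comp L R).of_eq fun a => ?_
  have h1 : 0 < (rd (f a) : ℚ) := by have := rd_pos (f a); positivity
  have h2 : 0 < (rd (g a) : ℚ) := by have := rd_pos (g a); positivity
  apply decide_eq_decide.2
  conv_rhs => rw [rat_eq (f a), rat_eq (g a)]
  rw [← Nat.cast_le (α := ℚ)]
  push_cast
  rw [div_le_div_iff₀ h1 h2]
  constructor <;> intro h <;> linarith

lemma cmax (hf : Computable f) (hg : Computable g) : Computable (fun a => max (f a) (g a)) :=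
  (Computable.cond (cle hf hg) hg hf).of_eq fun a => by
    by_cases h : f a ≤ g a <;> simp [h, max_def]

lemma cpow (q : ℚ) {k : α → ℕ} (hk : Computable k) : Computable (fun a => q ^ k a) := by
  have : Computable₂ (fun (_ : α) (p : ℕ × ℚ) => p.2 * q) :=
    cmul (Computable.snd.comp Computable.snd) (Computable.const q)
  refine (Computable.nat_rec hk (Computable.const (1 : ℚ)) this).of_eq fun a => ?_
  induction k a with
  | zero => simp
  | succ n ih => simp only [ih, pow_succ]

end
end DCEaux

open Filter MeasureTheory Set

namespace DCEaux

def genH (z : ℕ → ℚ) (m : ℕ → ℚ) : ℕ → ℚ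
  | 0 => z 0
  | r + 1 => max (genH z m r + m r) (z (r + 1))

lemma le_genH (z m : ℕ → ℚ) (r : ℕ) : z r ≤ genH z m r := by
  cases r <;> simp [genH]

lemma genH_add (z m : ℕ → ℚ) {s R : ℕ} (h : s ≤ R) :
    genH z m s + ∑ r ∈ Finset.Ico s R, m r ≤ genH z m R := by
  induction R, h using Nat.le_induction with
  | base => simp
  | succ n hn ih =>
    rw [Finset.sum_Ico_succ_top hn]
    have : genH z m n + m n ≤ genH z m (n + 1) := le_max_left _ _
    linarith

lemma genH_mono (z m : ℕ → ℚ) (hm : ∀ r, 0 ≤ m r) : Monotone (genH z m) :=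
  monotone_nat_of_le_succ fun n => by
    have : genH z m n + m n ≤ genH z m (n + 1) := le_max_left _ _
    linarith [hm n]

lemma le_lim {z : ℕ → ℚ} {x : ℝ} (hm : Monotone z)
    (ht : Tendsto (fun n => (z n : ℝ)) atTop (nhds x)) (n : ℕ) : (z n : ℝ) ≤ x :=
  Monotone.ge_of_tendsto (f := fun n => (z n : ℝ)) (fun a b h => Rat.cast_le.2 (hm h)) ht n

lemma nonrandom_of_mass {y : ℝ} (ys : ℕ → ℚ) (hc : Computable ys) (hm : Monotone ys)
    (ht : Tendsto (fun n => (ys n : ℝ)) atTop (nhds y)) (m : ℕ → ℕ → ℚ) (hmc : Computable₂ m)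
    (h0 : ∀ i r, 0 ≤ m i r) (hsum : ∀ i R, ∑ r ∈ Finset.range R, m i r ≤ (1 / 2) ^ i)
    (hp : ∀ i, ∃ s R, s ≤ R ∧ y < ys s + ((∑ r ∈ Finset.Ico s R, m i r : ℚ) : ℝ)) :
    ¬ MLRandom y := by
  intro hr
  have hH : Computable₂ (fun i r => genH ys (m i) r) := by
    have hstep : Computable₂ (fun (p : ℕ × ℕ) (q : ℕ × ℚ) => max (q.2 + m p.1 q.1) (ys (q.1 + 1))) := by
      refine cmax (cadd (Computable.snd.comp Computable.snd) ?_) ?_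
      · exact hmc.comp (Computable.fst.comp Computable.fst) (Computable.fst.comp Computable.snd)
      · exact hc.comp (Computable.succ.comp (Computable.fst.comp Computable.snd))
    refine (Computable.nat_rec (f := fun p : ℕ × ℕ => p.2) (g := fun _ => ys 0) Computable.snd
      (Computable.const _) hstep).of_eq fun p => ?_
    obtain ⟨i, r⟩ := p
    induction r with
    | zero => rfl
    | succ n ih =>
      simp only [genH] at ih ⊢
      rw [ih]
  let g : ℕ → ℕ → ℚ × ℚ := fun i r =>
    (genH ys (m (i+1)) r - m (i+1) r, genH ys (m (i+1)) r + m (i+1) r)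
  have hS : Computable (fun p : ℕ × ℕ => p.1 + 1) := Computable.succ.comp Computable.fst
  have hg : Computable₂ g := by
    have h1 := hH.comp hS Computable.snd
    have h2 := hmc.comp hS Computable.snd
    exact (csub h1 h2).pair (cadd h1 h2)
  obtain ⟨i, hi⟩ := hr g hg (fun i => by
    refine (measure_iUnion_le _).trans ?_
    have : ∀ n, volume (Set.Ioo (((g i n).1 : ℝ)) (((g i n).2 : ℝ)))
        = ENNReal.ofReal (2 * m (i+1) n) := by
      intro n
      rw [Real.volume_Ioo]
      congr 1
      simp only [g]
      push_cast
      ring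
    simp only [this]
    refine ENNReal.tsum_le_of_sum_range_le fun R => ?_
    have hb : ∀ n, 0 ≤ (2 * m (i+1) n : ℝ) := fun n => by
      have := h0 (i+1) n
      have : (0:ℝ) ≤ m (i+1) n := by exact_mod_cast this
      positivity
    rw [← ENNReal.ofReal_sum_of_nonneg (fun n _ => hb n), ← Finset.mul_sum]
    have h3 := hsum (i+1) R
    have h4 : (∑ r ∈ Finset.range R, (m (i+1) r : ℝ)) ≤ (1/2)^(i+1) := by
      have h6 : ((∑ r ∈ Finset.range R, m (i+1) r : ℚ) : ℝ) ≤ (((1/2)^(i+1) : ℚ) : ℝ) :=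
        Rat.cast_le.2 h3
      push_cast at h6
      exact h6
    have h5 : (2⁻¹ ^ i : ENNReal) = ENNReal.ofReal ((1/2)^i) := by
      rw [ENNReal.ofReal_pow (by norm_num)]
      congr 1
      rw [one_div, ENNReal.ofReal_inv_of_pos (by norm_num)]
      simp
    rw [h5]
    apply ENNReal.ofReal_le_ofReal
    rw [pow_succ] at h4
    linarith)
  apply hi
  obtain ⟨s, R, hsR, hy⟩ := hp (i+1)
  have hR : y < genH ys (m (i+1)) R := by
    refine hy.trans_le ?_
    have h1 := genH_add ys (m (i+1)) hsR
    have h2 := le_genH ys (m (i+1)) s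
    have : ys s + ∑ r ∈ Finset.Ico s R, m (i+1) r ≤ genH ys (m (i+1)) R := by linarith
    exact_mod_cast this
  have hex : ∃ R, y < genH ys (m (i+1)) R := ⟨R, hR⟩
  classical
  obtain ⟨r, hr1⟩ : ∃ r, Nat.find hex = r + 1 := by
    apply Nat.exists_eq_succ_of_ne_zero
    intro h
    have := Nat.find_spec hex
    rw [h] at this
    exact absurd (le_lim hm ht 0) (not_le.2 this)
  have h1 := Nat.find_spec hex
  rw [hr1] at h1
  have h2 : ¬ y < genH ys (m (i+1)) r := Nat.find_min hex (by omega)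
  push Not at h2
  have h3 : y < genH ys (m (i+1)) r + m (i+1) r := by
    simp only [genH] at h1
    push_cast at h1
    rcases lt_max_iff.1 h1 with h | h
    · exact h
    · exact absurd (le_lim hm ht (r+1)) (not_le.2 h)
  refine Set.mem_iUnion.2 ⟨r, ?_, ?_⟩ <;> simp only [g] <;> push_cast <;> linarith

def mass (z H : ℕ → ℚ) (r : ℕ) : ℚ := if z (r + 1) ≤ H r then z (r + 1) - z r else 0

lemma mass_nonneg {z : ℕ → ℚ} (hz : Monotone z) (H : ℕ → ℚ) (r : ℕ) : 0 ≤ mass z H r := by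
  unfold mass
  split_ifs
  · exact sub_nonneg.2 (hz (Nat.le_succ r))
  · rfl

lemma mass_sum {z μ : ℕ → ℚ} (hz : Monotone z) (hμ : ∀ r, 0 ≤ μ r) (R : ℕ) :
    ∑ r ∈ Finset.range R, mass z (genH z μ) r + (genH z μ R - z R) ≤ ∑ r ∈ Finset.range R, μ r := by
  induction R with
  | zero => simp [genH]
  | succ R ih =>
    rw [Finset.sum_range_succ, Finset.sum_range_succ]
    have h1 := hμ R
    have h2 := hz (Nat.le_succ R)
    have h3 := le_genH z μ R
    simp only [Nat.succ_eq_add_one] at h2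
    unfold mass at *
    simp only [genH]
    split_ifs with h
    · rw [max_eq_left (by linarith)]
      linarith
    · rcases max_cases (genH z μ R + μ R) (z (R + 1)) with ⟨h', _⟩ | ⟨h', _⟩ <;> rw [h'] <;> linarith

/-- eventually the mass is full -/
def Full (z H : ℕ → ℚ) : Prop := ∃ N, ∀ r ≥ N, z (r + 1) ≤ H r

lemma sum_full {z H : ℕ → ℚ} {N : ℕ} (h : ∀ r ≥ N, z (r + 1) ≤ H r) {s R : ℕ} (hs : N ≤ s)
    (hsR : s ≤ R) : ∑ r ∈ Finset.Ico s R, mass z H r = z R - z s := by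
  rw [← Finset.sum_Ico_sub z hsR]
  refine Finset.sum_congr rfl fun r hr => ?_
  rw [mass, if_pos (h r (hs.trans (Finset.mem_Ico.1 hr).1))]

lemma full_step {z w H : ℕ → ℚ} {x y : ℝ} {p : ℚ} (hp : 0 ≤ p)
    (hz : Monotone z) (hw : Monotone w)
    (hzx : Tendsto (fun n => (z n : ℝ)) atTop (nhds x))
    (hwy : Tendsto (fun n => (w n : ℝ)) atTop (nhds y))
    (hF : Full z H) (hio : ∃ᶠ s in atTop, y - w s < p * (x - z s)) :
    Full w (genH w (fun r => p * mass z H r)) := by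
  obtain ⟨N, hN⟩ := hF
  obtain ⟨s, hs, hys⟩ := (frequently_atTop.1 hio) N
  have hlim : Tendsto (fun R => (w s : ℝ) + p * (z R - z s)) atTop
      (nhds (w s + p * (x - z s))) := by
    exact ((hzx.sub_const _).const_mul _).const_add _
  have hev := hlim.eventually (lt_mem_nhds (show y < w s + p * (x - z s) by linarith))
  obtain ⟨R, hR, hRs⟩ := (hev.and (eventually_ge_atTop s)).exists
  have h0 : ∀ r, 0 ≤ p * mass z H r := fun r => mul_nonneg hp (mass_nonneg hz H r)
  refine ⟨R, fun r hr => ?_⟩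
  have h1 := genH_add w (fun r => p * mass z H r) hRs
  rw [← Finset.mul_sum, sum_full hN hs hRs] at h1
  have h2 := le_genH w (fun r => p * mass z H r) s
  have h3 := genH_mono w _ h0 hr
  have h4 : w s + p * (z R - z s) ≤ genH w (fun r => p * mass z H r) r := by linarith
  have h5 : (w s + p * (z R - z s) : ℝ) ≤ genH w (fun r => p * mass z H r) r := by exact_mod_cast h4
  have h6 := le_lim hw hwy (r + 1)
  have h7 : (w (r + 1) : ℝ) ≤ genH w (fun r => p * mass z H r) r := by linarith
  exact_mod_cast h7

def chH (z : ℕ → ℕ → ℚ) (p : ℕ → ℚ) (B : ℚ) : ℕ → ℕ → ℚ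
  | 0 => fun _ => B
  | l + 1 => genH (z (l + 1)) (fun r => p l * mass (z l) (chH z p B l) r)

end DCEaux

open Filter MeasureTheory Set

namespace DCEaux

lemma comp_mass_aux {α : Type*} [Primcodable α] {u v h : α → ℚ} (hu : Computable u)
    (hv : Computable v) (hh : Computable h) :
    Computable (fun a => if u a ≤ h a then u a - v a else 0) :=
  (Computable.cond (cle hu hh) (csub hu hv) (Computable.const 0)).of_eq fun a => by
    by_cases h' : u a ≤ h a <;> simp [h']

lemma mass_le {z : ℕ → ℚ} (hz : Monotone z) (H : ℕ → ℚ) (r : ℕ) :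
    mass z H r ≤ z (r + 1) - z r := by
  unfold mass
  split_ifs
  · rfl
  · exact sub_nonneg.2 (hz (Nat.le_succ r))

def chStep (z : ℕ → ℕ → ℚ) (p : ℕ → ℚ) (B : ℚ) (L : List ℚ) : ℚ :=
  bif decide (L.length.unpair.1 = 0) then B else
  bif decide (L.length.unpair.2 = 0) then z L.length.unpair.1 0 else
  max ((L[Nat.pair L.length.unpair.1 (L.length.unpair.2.pred)]?).getD 0 +
    p L.length.unpair.1.pred * (if z L.length.unpair.1.pred (L.length.unpair.2) ≤
      (L[Nat.pair L.length.unpair.1.pred (L.length.unpair.2.pred)]?).getD 0 then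
      z L.length.unpair.1.pred (L.length.unpair.2) -
      z L.length.unpair.1.pred (L.length.unpair.2.pred) else 0)) (z L.length.unpair.1 L.length.unpair.2)

lemma comp_chStep {z : ℕ → ℕ → ℚ} {p : ℕ → ℚ} (B : ℚ) (hz : Computable₂ z) (hp : Computable p) :
    Computable (chStep z p B) := by
  have hn : Computable (fun L : List ℚ => L.length.unpair) :=
    Computable.unpair.comp Computable.list_length
  have hl := Computable.fst.comp hn
  have hr := Computable.snd.comp hn
  have hl' := Computable.pred.comp hl
  have hr' := Computable.pred.comp hr
  have hpair : Computable₂ Nat.pair := Primrec₂.natPair.to_comp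
  have hget : ∀ {k : List ℚ → ℕ}, Computable k → Computable (fun L : List ℚ => (L[k L]?).getD 0) :=
    fun hk => Computable.option_getD (Computable.list_getElem?.comp Computable.id hk)
      (Computable.const 0)
  unfold chStep
  refine Computable.cond (comp_neq.comp hl (Computable.const 0)) (Computable.const B) ?_
  refine Computable.cond (comp_neq.comp hr (Computable.const 0)) (hz.comp hl (Computable.const 0)) ?_
  refine cmax (cadd (hget (hpair.comp hl hr')) (cmul (hp.comp hl') ?_)) (hz.comp hl hr)
  exact comp_mass_aux (hz.comp hl' hr) (hz.comp hl' hr') (hget (hpair.comp hl' hr'))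

lemma comp_chH {z : ℕ → ℕ → ℚ} {p : ℕ → ℚ} (B : ℚ) (hz : Computable₂ z) (hp : Computable p) :
    Computable₂ (chH z p B) := by
  have h : Computable₂ (fun (_ : Unit) (n : ℕ) => chH z p B n.unpair.1 n.unpair.2) := by
    refine Computable.nat_strong_rec _ (g := fun _ L => some (chStep z p B L))
      (Computable.option_some.comp ((comp_chStep B hz hp).comp Computable.snd)) ?_
    intro _ n
    congr 1
    obtain ⟨l, r, rfl⟩ : ∃ l r, n = Nat.pair l r := ⟨n.unpair.1, n.unpair.2, by simp⟩
    unfold chStep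
    simp only [List.length_map, List.length_range, Nat.unpair_pair]
    cases l with
    | zero => simp [chH]
    | succ l =>
      cases r with
      | zero => simp [chH, genH]
      | succ r =>
        have h1 : Nat.pair (l + 1) r < Nat.pair (l + 1) (r + 1) := Nat.pair_lt_pair_right _ (by omega)
        have h2 : Nat.pair l r < Nat.pair (l + 1) (r + 1) :=
          (Nat.pair_lt_pair_left _ (by omega)).trans h1
        simp [h1, h2, chH, genH, mass]
  have hpair : Computable₂ Nat.pair := Primrec₂.natPair.to_comp
  refine (h.comp (Computable.const ()) hpair : Computable _).of_eq fun q => ?_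
  simp

lemma comp_chmass {z : ℕ → ℕ → ℚ} {p : ℕ → ℚ} (B : ℚ) (hz : Computable₂ z) (hp : Computable p) :
    Computable₂ (fun l r => mass (z l) (chH z p B l) r) := by
  have hs : Computable (fun p : ℕ × ℕ => p.2 + 1) := Computable.succ.comp Computable.snd
  exact comp_mass_aux (hz.comp Computable.fst hs) hz (comp_chH B hz hp)

/-- oscillation is impossible -/
lemma no_osc {a b : ℝ} {as bs : ℕ → ℚ} (hac : Computable as) (ham : Monotone as)
    (hat : Tendsto (fun n => (as n : ℝ)) atTop (nhds a))
    (hbc : Computable bs) (hbm : Monotone bs)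
    (hbt : Tendsto (fun n => (bs n : ℝ)) atTop (nhds b)) (hlt : ∀ s, (as s : ℝ) < a)
    {P Q : ℚ} (hP : 0 < P) (hQ : 0 < Q) (hPQ : P * Q < 1)
    (h1 : ∃ᶠ s in atTop, a - as s < P * (b - bs s))
    (h2 : ∃ᶠ s in atTop, b - bs s < Q * (a - as s)) : ¬ MLRandom a := by
  let z : ℕ → ℕ → ℚ := fun l r => bif l.bodd then bs r else as r
  let p : ℕ → ℚ := fun l => bif l.bodd then P else Q
  have hz : Computable₂ z := Computable.cond (Computable.nat_bodd.comp Computable.fst)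
    (hbc.comp Computable.snd) (hac.comp Computable.snd)
  have hp : Computable p := Computable.cond Computable.nat_bodd (Computable.const P)
    (Computable.const Q)
  have hzm : ∀ l, Monotone (z l) := fun l => by
    simp only [z]; cases l.bodd <;> simpa
  have hp0 : ∀ l, 0 ≤ p l := fun l => by
    simp only [p]; cases l.bodd <;> simp [hP.le, hQ.le]
  obtain ⟨B, hB⟩ := exists_rat_gt a
  have hfull : ∀ l, Full (z l) (chH z p B l) := by
    intro l
    induction l with
    | zero =>
      refine ⟨0, fun r _ => ?_⟩
      have := (le_lim ham hat (r + 1)).trans hB.le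
      simp only [chH, z, Nat.bodd_zero, cond_false]
      exact_mod_cast this
    | succ l ih =>
      have hs : (l + 1).bodd = !l.bodd := Nat.bodd_succ l
      cases hl : l.bodd with
      | false =>
        refine full_step (x := a) (y := b) (hp0 l) (hzm l) (hzm (l+1)) ?_ ?_ ih ?_ <;>
          simpa [z, p, hl, hs]
      | true =>
        refine full_step (x := b) (y := a) (hp0 l) (hzm l) (hzm (l+1)) ?_ ?_ ih ?_ <;>
          simpa [z, p, hl, hs]
  have hm0 : ∀ l r, 0 ≤ mass (z l) (chH z p B l) r := fun l r => mass_nonneg (hzm l) _ r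
  have hstep : ∀ l R, ∑ r ∈ Finset.range R, mass (z (l+1)) (chH z p B (l+1)) r ≤
      p l * ∑ r ∈ Finset.range R, mass (z l) (chH z p B l) r := by
    intro l R
    have h3 := mass_sum (hzm (l+1)) (μ := fun r => p l * mass (z l) (chH z p B l) r)
      (fun r => mul_nonneg (hp0 l) (hm0 l r)) R
    have h4 := le_genH (z (l+1)) (fun r => p l * mass (z l) (chH z p B l) r) R
    rw [← Finset.mul_sum] at h3
    simp only [chH]
    linarith
  have hsum : ∀ k R, ∑ r ∈ Finset.range R, mass (z (2*k)) (chH z p B (2*k)) r ≤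
      (P * Q) ^ k * (B - as 0) := by
    intro k R
    induction k with
    | zero =>
      have : ∑ r ∈ Finset.range R, mass (z 0) (chH z p B 0) r ≤
          ∑ r ∈ Finset.range R, (as (r+1) - as r) := by
        exact Finset.sum_le_sum fun r _ => mass_le ham _ r
      rw [Finset.sum_range_sub] at this
      have h5 := (le_lim ham hat R).trans hB.le
      have h5 : as R ≤ B := by exact_mod_cast h5
      simp only [mul_zero, pow_zero, one_mul]
      linarith
    | succ k ih =>
      have e1 := hstep (2*k) R
      have e2 := hstep (2*k+1) R
      have p1 : p (2*k) = Q := by simp [p]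
      have p2 : p (2*k+1) = P := by simp [p]
      rw [p1] at e1
      rw [p2] at e2
      calc _ ≤ P * (Q * ((P * Q) ^ k * (B - as 0))) := e2.trans (by gcongr; exact e1.trans (by gcongr))
        _ = _ := by ring
  have hC : 0 < B - as 0 := by
    have := (le_lim ham hat 0).trans_lt hB
    have : as 0 < B := by exact_mod_cast this
    linarith
  have hPQ0 : 0 < P * Q := mul_pos hP hQ
  obtain ⟨c, hc⟩ := exists_pow_lt_of_lt_one (show (0:ℚ) < 1/2 by norm_num) hPQ
  obtain ⟨c0, hc0⟩ := exists_pow_lt_of_lt_one (show (0:ℚ) < 1/(2 * (B - as 0)) by positivity) hPQ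
  let K : ℕ → ℕ := fun i => 2 * (c0 + c * i)
  have hK : Computable K := comp_nmul.comp (Computable.const 2)
    (comp_nadd.comp (Computable.const c0) (comp_nmul.comp (Computable.const c) Computable.id))
  refine nonrandom_of_mass as hac ham hat (fun i r => 2 * mass (z (K i)) (chH z p B (K i)) r) ?_ ?_ ?_ ?_
  · exact cmul (Computable.const 2) ((comp_chmass B hz hp).comp (hK.comp Computable.fst) Computable.snd)
  · intro i r
    exact mul_nonneg (by norm_num) (hm0 _ _)
  · intro i R
    rw [← Finset.mul_sum]
    have h6 := hsum (c0 + c * i) R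
    calc _ ≤ 2 * ((P * Q) ^ (c0 + c * i) * (B - as 0)) := by gcongr
      _ = ((P * Q) ^ c0 * (2 * (B - as 0))) * ((P * Q) ^ c) ^ i := by rw [pow_add, pow_mul]; ring
      _ ≤ 1 * (1/2) ^ i := by
        gcongr
        rw [lt_div_iff₀ (by positivity)] at hc0
        exact hc0.le
      _ = _ := one_mul _
  · intro i
    obtain ⟨N, hN⟩ := hfull (K i)
    have hev : ∀ᶠ R in atTop, a < as N + 2 * (as R - as N) := by
      have : Tendsto (fun R => (as N : ℝ) + 2 * (as R - as N)) atTop (nhds (as N + 2 * (a - as N))) :=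
        ((hat.sub_const _).const_mul _).const_add _
      exact this.eventually (lt_mem_nhds (by linarith [hlt N]))
    obtain ⟨R, hR, hNR⟩ := (hev.and (eventually_ge_atTop N)).exists
    refine ⟨N, R, hNR, ?_⟩
    rw [← Finset.mul_sum, sum_full hN le_rfl hNR]
    have : z (K i) = as := by funext r; simp [z, K]
    rw [this]
    push_cast
    exact hR

/-- Kučera–Slaman style boundedness -/
lemma ratio_bdd {a b : ℝ} {as bs : ℕ → ℚ} (hac : Computable as) (ham : Monotone as)
    (hat : Tendsto (fun n => (as n : ℝ)) atTop (nhds a))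
    (hbc : Computable bs) (hbm : Monotone bs)
    (hbt : Tendsto (fun n => (bs n : ℝ)) atTop (nhds b)) (hlt : ∀ s, (as s : ℝ) < a)
    (hr : MLRandom a) : ∃ M : ℝ, ∀ s, (b - bs s) / (a - as s) ≤ M := by
  by_contra hcon
  push Not at hcon
  obtain ⟨B, hB⟩ := exists_rat_gt b
  have hC : 0 < B - bs 0 := by
    have := (le_lim hbm hbt 0).trans_lt hB
    have : bs 0 < B := by exact_mod_cast this
    linarith
  refine nonrandom_of_mass as hac ham hat
    (fun i r => ((1/2) ^ i * (B - bs 0)⁻¹) * (bs (r+1) - bs r)) ?_ ?_ ?_ ?_ hr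
  · refine cmul (cmul (cpow _ Computable.fst) (Computable.const _)) (csub (hbc.comp ?_) (hbc.comp Computable.snd))
    exact Computable.succ.comp Computable.snd
  · intro i r
    exact mul_nonneg (by positivity) (sub_nonneg.2 (hbm (Nat.le_succ r)))
  · intro i R
    rw [← Finset.mul_sum, Finset.sum_range_sub]
    have h5 := (le_lim hbm hbt R).trans hB.le
    have h5 : bs R ≤ B := by exact_mod_cast h5
    calc _ ≤ ((1/2) ^ i * (B - bs 0)⁻¹) * (B - bs 0) := by gcongr
      _ = _ := by field_simp
  · intro i
    set e : ℚ := (1/2) ^ i * (B - bs 0)⁻¹ with he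
    have he0 : 0 < e := by positivity
    have he0' : (0:ℝ) < e := by exact_mod_cast he0
    obtain ⟨s, hs⟩ := hcon (e⁻¹ : ℝ)
    rw [lt_div_iff₀ (sub_pos.2 (hlt s)), inv_mul_lt_iff₀ he0'] at hs
    have hev : ∀ᶠ R in atTop, a < as s + e * (bs R - bs s) := by
      have : Tendsto (fun R => (as s : ℝ) + e * (bs R - bs s)) atTop (nhds (as s + e * (b - bs s))) :=
        ((hbt.sub_const _).const_mul _).const_add _
      exact this.eventually (lt_mem_nhds (by linarith))
    obtain ⟨R, hR, hNR⟩ := (hev.and (eventually_ge_atTop s)).exists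
    refine ⟨s, R, hNR, ?_⟩
    rw [← Finset.mul_sum, Finset.sum_Ico_sub bs hNR]
    push_cast
    exact hR

lemma ratio_lim {a b : ℝ} {as bs : ℕ → ℚ} (hac : Computable as) (ham : Monotone as)
    (hat : Tendsto (fun n => (as n : ℝ)) atTop (nhds a))
    (hbc : Computable bs) (hbm : Monotone bs)
    (hbt : Tendsto (fun n => (bs n : ℝ)) atTop (nhds b)) (hlt : ∀ s, (as s : ℝ) < a)
    (hr : MLRandom a) : ∃ L : ℝ, Tendsto (fun s => (b - bs s) / (a - as s)) atTop (nhds L) := by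
  obtain ⟨M, hM⟩ := ratio_bdd hac ham hat hbc hbm hbt hlt hr
  have h0 : ∀ s, 0 ≤ (b - bs s) / (a - as s) := fun s =>
    div_nonneg (sub_nonneg.2 (le_lim hbm hbt s)) (sub_pos.2 (hlt s)).le
  refine tendsto_of_no_upcrossings (s := Set.range ((↑) : ℚ → ℝ)) Rat.denseRange_cast ?_ ?_ ?_
  · rintro _ ⟨q, rfl⟩ _ ⟨q', rfl⟩ hqq ⟨hf1, hf2⟩
    have hq : 0 < q := by
      obtain ⟨s, hs⟩ := hf1.exists
      have := (h0 s).trans_lt hs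
      exact_mod_cast this
    have hqq : q < q' := by exact_mod_cast hqq
    have hq' : 0 < q' := hq.trans hqq
    have hq'r : (0:ℝ) < q' := by exact_mod_cast hq'
    refine no_osc (P := q'⁻¹) (Q := q) hac ham hat hbc hbm hbt hlt (by positivity) hq ?_ ?_ ?_ hr
    · rw [inv_mul_lt_iff₀ hq']; linarith
    · refine hf2.mono fun s hs => ?_
      rw [lt_div_iff₀ (sub_pos.2 (hlt s))] at hs
      push_cast
      rw [lt_inv_mul_iff₀ hq'r]
      exact hs
    · refine hf1.mono fun s hs => ?_
      rwa [div_lt_iff₀ (sub_pos.2 (hlt s))] at hs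
  · exact isBoundedUnder_of ⟨M, hM⟩
  · exact isBoundedUnder_of ⟨0, h0⟩

end DCEaux

open Filter MeasureTheory Set

namespace DCEaux

lemma rat_nonrandom (q : ℚ) : ¬ MLRandom (q : ℝ) := by
  refine nonrandom_of_mass (fun _ => q) (Computable.const q) monotone_const tendsto_const_nhds
    (fun i r => bif decide (r = 0) then (1/2) ^ i else 0) ?_ ?_ ?_ ?_
  · exact Computable.cond (comp_neq.comp Computable.snd (Computable.const 0))
      (cpow _ Computable.fst) (Computable.const 0)
  · intro i r
    by_cases h : r = 0 <;> simp [h]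
  · intro i R
    simp only [Bool.cond_decide, Finset.sum_ite_eq']
    split_ifs <;> first | rfl | positivity
  · intro i
    refine ⟨0, 1, by norm_num, ?_⟩
    simp

lemma mlrandom_of_neg {x : ℝ} (h : MLRandom (-x)) : MLRandom x := by
  intro g hg hv
  let g' : ℕ → ℕ → ℚ × ℚ := fun i n => (-(g i n).2, -(g i n).1)
  have hg' : Computable₂ g' := (cneg' (Computable.snd.comp hg)).pair (cneg' (Computable.fst.comp hg))
  have hset : ∀ i, testSet g' i = Neg.neg ⁻¹' (testSet g i) := by
    intro i
    ext t
    simp only [testSet, Set.mem_iUnion, Set.mem_preimage, Set.mem_Ioo, g']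
    push_cast
    refine exists_congr fun n => ?_
    constructor <;> rintro ⟨h1, h2⟩ <;> constructor <;> linarith
  obtain ⟨i, hi⟩ := h g' hg' (fun i => by
    rw [hset, Measure.measure_preimage_neg]; exact hv i)
  refine ⟨i, fun hx => hi ?_⟩
  rw [hset]
  simpa using hx

/-- bounded search -/
def srch (t : ℕ → Bool) : ℕ → Bool
  | 0 => false
  | n + 1 => srch t n || t n

lemma srch_iff (t : ℕ → Bool) (n : ℕ) : srch t n = true ↔ ∃ k < n, t k = true := by
  induction n with
  | zero => simp [srch]
  | succ n ih =>
    simp only [srch, Bool.or_eq_true, ih]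
    constructor
    · rintro (⟨k, hk, h⟩ | h)
      · exact ⟨k, by omega, h⟩
      · exact ⟨n, by omega, h⟩
    · rintro ⟨k, hk, h⟩
      rcases Nat.lt_succ_iff_lt_or_eq.1 hk with h' | rfl
      · exact Or.inl ⟨k, h', h⟩
      · exact Or.inr h

lemma comp_srch {α : Type*} [Primcodable α] {t : α → ℕ → Bool} {n : α → ℕ}
    (ht : Computable₂ t) (hn : Computable n) : Computable (fun a => srch (t a) (n a)) := by
  have hor : Computable₂ or := Primrec.or.to_comp
  have hs : Computable₂ (fun (a : α) (p : ℕ × Bool) => or p.2 (t a p.1)) :=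
    hor.comp (Computable.snd.comp Computable.snd)
      (ht.comp Computable.fst (Computable.fst.comp Computable.snd))
  refine (Computable.nat_rec hn (Computable.const false) hs).of_eq fun a => ?_
  induction n a with
  | zero => rfl
  | succ k ih => simp only [srch]; rw [← ih]

/-- Solovay transfer for monotone approximations -/
lemma solovay {a x : ℝ} {as X : ℕ → ℚ} (hac : Computable as) (ham : Monotone as)
    (hat : Tendsto (fun n => (as n : ℝ)) atTop (nhds a)) (hlt : ∀ s, (as s : ℝ) < a)
    (hr : MLRandom a) (hXc : Computable X) (hXm : Monotone X)
    (hXt : Tendsto (fun n => (X n : ℝ)) atTop (nhds x)) {e : ℚ} (he : 0 < e)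
    (hS : ∀ s, e * (a - as s) ≤ x - X s) : MLRandom x := by
  intro g hg hv
  by_contra hcon
  push Not at hcon
  have he' : (0:ℝ) < e := by exact_mod_cast he
  have hXlt : ∀ s, (X s : ℝ) < x := fun s => by
    have := mul_pos he' (sub_pos.2 (hlt s))
    linarith [hS s]
  obtain ⟨c, hc⟩ := exists_pow_lt_of_lt_one (show (0:ℚ) < e / 2 by positivity)
    (show (1/2 : ℚ) < 1 by norm_num)
  let t : ℕ × ℕ → ℕ → Bool := fun p n =>
    (!decide (X p.2 ≤ (g (p.1 + c) n).1)) && (!decide ((g (p.1 + c) n).2 ≤ X (p.2 + 1)))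
  have hand : Computable₂ and := Primrec.and.to_comp
  have hnot : Computable not := Primrec.not.to_comp
  have htc : Computable₂ t := by
    have h1 : Computable (fun q : (ℕ × ℕ) × ℕ => g (q.1.1 + c) q.2) :=
      hg.comp (comp_nadd.comp (Computable.fst.comp Computable.fst) (Computable.const c)) Computable.snd
    have h2 : Computable (fun q : (ℕ × ℕ) × ℕ => X q.1.2) :=
      hXc.comp (Computable.snd.comp Computable.fst)
    have h3 : Computable (fun q : (ℕ × ℕ) × ℕ => X (q.1.2 + 1)) :=
      hXc.comp (Computable.succ.comp (Computable.snd.comp Computable.fst))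
    exact hand.comp (hnot.comp (cle h2 (Computable.fst.comp h1)))
      (hnot.comp (cle (Computable.snd.comp h1) h3))
  have htiff : ∀ i r n, t (i, r) n = true ↔ (g (i + c) n).1 < X r ∧ X (r + 1) < (g (i + c) n).2 := by
    intro i r n
    simp [t]
  let w : ℕ → ℕ → Bool := fun i r => srch (t (i, r)) (r + 1)
  have hw : Computable₂ w := comp_srch htc (Computable.succ.comp Computable.snd)
  have hwsum : ∀ i R, (∑ r ∈ Finset.range R, (bif w i r then X (r+1) - X r else 0) : ℚ) ≤ (1/2)^(i+c) := by
    intro i R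
    classical
    have hXr : Monotone (fun n => (X n : ℝ)) := fun _ _ h => Rat.cast_le.2 (hXm h)
    let F := (Finset.range R).filter (fun r => w i r = true)
    have hsub : (⋃ r ∈ F, Set.Ico (X r : ℝ) (X (r+1))) ⊆ testSet g (i+c) := by
      intro y hy
      simp only [Set.mem_iUnion] at hy
      obtain ⟨r, hrF, hy⟩ := hy
      have hwr := (Finset.mem_filter.1 hrF).2
      obtain ⟨n, _, hn⟩ := (srch_iff _ _).1 hwr
      rw [htiff] at hn
      refine Set.mem_iUnion.2 ⟨n, ?_, ?_⟩
      · exact (Rat.cast_lt.2 hn.1).trans_le hy.1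
      · exact hy.2.trans (Rat.cast_lt.2 hn.2)
    have hvol := (measure_mono hsub).trans (hv (i+c))
    have hdis : Set.PairwiseDisjoint (↑F : Set ℕ) (fun r => Set.Ico (X r : ℝ) (X (r+1))) :=
      fun r _ r' _ hne => hXr.pairwise_disjoint_on_Ico_succ hne
    rw [measure_biUnion_finset hdis (fun r _ => measurableSet_Ico)] at hvol
    simp only [Real.volume_Ico] at hvol
    rw [← ENNReal.ofReal_sum_of_nonneg (fun r _ => sub_nonneg.2 (hXr (Nat.le_succ r)))] at hvol
    have h5 : (2⁻¹ ^ (i+c) : ENNReal) = ENNReal.ofReal ((1/2)^(i+c)) := by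
      rw [ENNReal.ofReal_pow (by norm_num)]
      congr 1
      rw [one_div, ENNReal.ofReal_inv_of_pos (by norm_num)]
      simp
    rw [h5, ENNReal.ofReal_le_ofReal_iff (by positivity)] at hvol
    have h6 : (∑ r ∈ Finset.range R, (bif w i r then X (r+1) - X r else 0) : ℚ)
        = ∑ r ∈ F, (X (r+1) - X r) := by
      rw [Finset.sum_filter]
      refine Finset.sum_congr rfl fun r _ => ?_
      cases w i r <;> simp
    rw [h6, ← Rat.cast_le (K := ℝ)]
    push_cast
    exact hvol
  refine nonrandom_of_mass as hac ham hat
    (fun i r => (2 / e) * (bif w i r then X (r+1) - X r else 0)) ?_ ?_ ?_ ?_ hr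
  · refine cmul (Computable.const _) (Computable.cond hw (csub (hXc.comp ?_) (hXc.comp Computable.snd))
      (Computable.const 0))
    exact Computable.succ.comp Computable.snd
  · intro i r
    have := sub_nonneg.2 (hXm (Nat.le_succ r))
    refine mul_nonneg (by positivity) ?_
    cases w i r
    · simp
    · simpa using hXm (Nat.le_succ r)
  · intro i R
    rw [← Finset.mul_sum]
    calc _ ≤ (2 / e) * ((1/2)^(i+c)) := by gcongr; exact hwsum i R
      _ = ((2 / e) * (1/2)^c) * (1/2)^i := by rw [pow_add]; ring
      _ ≤ 1 * (1/2)^i := by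
        gcongr
        rw [div_mul_eq_mul_div, div_le_one he]
        linarith
      _ = _ := one_mul _
  · intro i
    obtain ⟨n, hn1, hn2⟩ := Set.mem_iUnion.1 (hcon (i + c))
    obtain ⟨N, hN⟩ := eventually_atTop.1 ((hXt.eventually (lt_mem_nhds hn1)).and (eventually_ge_atTop n))
    have hwt : ∀ r ≥ N, w i r = true := by
      intro r hr
      refine (srch_iff _ _).2 ⟨n, by have := (hN r hr).2; omega, ?_⟩
      rw [htiff]
      refine ⟨by exact_mod_cast (hN r hr).1, ?_⟩
      have := (le_lim hXm hXt (r+1)).trans_lt hn2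
      exact_mod_cast this
    have hev : ∀ᶠ R in atTop, a < as N + (2 / e : ℝ) * (X R - X N) := by
      have : Tendsto (fun R => (as N : ℝ) + (2 / e : ℝ) * (X R - X N)) atTop
          (nhds (as N + (2 / e : ℝ) * (x - X N))) :=
        ((hXt.sub_const _).const_mul _).const_add _
      refine this.eventually (lt_mem_nhds ?_)
      have h7 := hS N
      have h8 := hXlt N
      have h9 : a - as N < (2 / e : ℝ) * (x - X N) := by
        rw [div_mul_eq_mul_div, lt_div_iff₀ he']
        linarith
      linarith
    obtain ⟨R, hR, hNR⟩ := (hev.and (eventually_ge_atTop N)).exists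
    refine ⟨N, R, hNR, ?_⟩
    have h10 : ∑ r ∈ Finset.Ico N R, (bif w i r then X (r+1) - X r else 0) = X R - X N := by
      rw [← Finset.sum_Ico_sub X hNR]
      refine Finset.sum_congr rfl fun r hr => ?_
      rw [hwt r (Finset.mem_Ico.1 hr).1]; rfl
    rw [← Finset.mul_sum, h10]
    push_cast
    exact hR

lemma solovay' {a x : ℝ} {as xs : ℕ → ℚ} (hac : Computable as) (ham : Monotone as)
    (hat : Tendsto (fun n => (as n : ℝ)) atTop (nhds a)) (hlt : ∀ s, (as s : ℝ) < a)
    (hr : MLRandom a) (hXc : Computable xs)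
    (hXt : Tendsto (fun n => (xs n : ℝ)) atTop (nhds x)) {L : ℝ} (hL : 0 < L)
    (hS : Tendsto (fun s => (x - xs s) / (a - as s)) atTop (nhds L)) : LeftCE x ∧ MLRandom x := by
  obtain ⟨e, he, heL⟩ := exists_rat_btwn hL
  have he0 : 0 < e := by exact_mod_cast he
  obtain ⟨N, hN⟩ := eventually_atTop.1 (hS.eventually (lt_mem_nhds heL))
  have hN' : ∀ s ≥ N, e * (a - as s) ≤ x - xs s := by
    intro s hs
    have := hN s hs
    rw [lt_div_iff₀ (sub_pos.2 (hlt s))] at this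
    exact this.le
  let X : ℕ → ℚ := genH (fun s => xs (N + s)) (fun _ => 0)
  have hsh : Computable (fun s : ℕ => N + s) := comp_nadd.comp (Computable.const N) Computable.id
  have hXcomp : Computable X := by
    have hstep : Computable₂ (fun (_ : ℕ) (q : ℕ × ℚ) => max (q.2 + 0) (xs (N + (q.1 + 1)))) := by
      refine cmax (cadd (Computable.snd.comp Computable.snd) (Computable.const 0)) ?_
      exact hXc.comp (hsh.comp (Computable.succ.comp (Computable.fst.comp Computable.snd)))
    refine (Computable.nat_rec (f := fun p : ℕ => p) (g := fun _ => xs (N + 0)) Computable.id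
      (Computable.const _) hstep).of_eq fun r => ?_
    induction r with
    | zero => rfl
    | succ n ih =>
      simp only [X, genH] at ih ⊢
      rw [ih]
  have hXmono : Monotone X := genH_mono _ _ (fun _ => le_rfl)
  have hXS : ∀ s, e * (a - as (N + s)) ≤ x - X s := by
    intro s
    induction s with
    | zero => simpa [X, genH] using hN' N le_rfl
    | succ s ih =>
      have h1 := hN' (N + (s + 1)) (by omega)
      have h2 : (as (N + s) : ℝ) ≤ as (N + (s + 1)) := Rat.cast_le.2 (ham (by omega))
      have h3 : (e : ℝ) * as (N + s) ≤ e * as (N + (s + 1)) := by gcongr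
      simp only [X, genH, add_zero] at ih ⊢
      push_cast
      rcases max_choice ((genH (fun s => xs (N + s)) (fun _ => 0) s : ℚ) : ℝ) (xs (N + (s + 1)) : ℝ) with h | h <;>
        rw [h] <;> linarith
  have hsht : Tendsto (fun s => N + s) atTop atTop := tendsto_add_atTop_nat N |>.congr fun s => by omega
  have hXlim : Tendsto (fun n => (X n : ℝ)) atTop (nhds x) := by
    refine tendsto_of_tendsto_of_tendsto_of_le_of_le (hXt.comp hsht) tendsto_const_nhds ?_ ?_
    · intro s
      exact Rat.cast_le.2 (le_genH (fun s => xs (N + s)) (fun _ => 0) s)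
    · intro s
      have h4 := hXS s
      have h5 := mul_pos he (sub_pos.2 (hlt (N + s)))
      simp only
      linarith
  refine ⟨⟨X, hXcomp, hXmono, hXlim⟩, ?_⟩
  exact solovay (as := fun s => as (N + s)) (hac.comp hsh) (fun _ _ h => ham (by omega))
    (hat.comp hsht) (fun s => hlt _) hr hXcomp hXmono hXlim he0 hXS

end DCEaux

open DCEaux in
/-- If `δ` is a d.c.e. real which is not Martin-Löf random and `α` is a Martin-Löf
random left-c.e. real, then `α + δ` is a Martin-Löf random left-c.e. real. -/
theorem add_dce_random (d a : ℝ) (hd : DCE d) (hdn : ¬ MLRandom d)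
    (ha : LeftCE a) (har : MLRandom a) :
    LeftCE (a + d) ∧ MLRandom (a + d) := by
  obtain ⟨as, hac, ham, hat⟩ := ha
  obtain ⟨b, c, ⟨bs, hbc, hbm, hbt⟩, ⟨cs, hcc, hcm, hct⟩, rfl⟩ := hd
  have hlt : ∀ s, (as s : ℝ) < a := by
    intro s
    refine lt_of_le_of_ne (le_lim ham hat s) fun h => ?_
    rw [← h] at har
    exact rat_nonrandom _ har
  obtain ⟨Lb, hLb⟩ := ratio_lim hac ham hat hbc hbm hbt hlt har
  obtain ⟨Lc, hLc⟩ := ratio_lim hac ham hat hcc hcm hct hlt har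
  have hL := hLb.sub hLc
  have hL0 : Lb - Lc = 0 := by
    rcases lt_trichotomy (Lb - Lc) 0 with h | h | h
    · exfalso
      apply hdn
      apply mlrandom_of_neg
      refine (solovay' hac ham hat hlt har (xs := fun s => cs s - bs s) (csub hcc hbc) ?_
        (neg_pos.2 h) (hL.neg.congr fun s => ?_)).2
      · have := hct.sub hbt
        rw [neg_sub]
        simpa using this
      · push_cast
        ring
    · exact h
    · exfalso
      apply hdn
      refine (solovay' hac ham hat hlt har (xs := fun s => bs s - cs s) (csub hbc hcc) ?_
        h (hL.congr fun s => ?_)).2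
      · simpa using hbt.sub hct
      · push_cast
        ring
  rw [hL0] at hL
  refine solovay' hac ham hat hlt har (xs := fun s => as s + (bs s - cs s))
    (cadd hac (csub hbc hcc)) ?_ (L := 1 + 0) (by norm_num) ((hL.const_add 1).congr fun s => ?_)
  · simpa using hat.add (hbt.sub hct)
  · have : a - as s ≠ 0 := (sub_pos.2 (hlt s)).ne'
    push_cast
    field_simp
    ring
end

section
/- Let (α_s) and (β_s) be increasing sequences of rationals converging to reals α and β respectively, and let p > 0 be rational. If there exists s₀ with p(α − α_{s₀}) < β − β_{s₀}, then there exists s ≥ s₀ such that for all s' > s, p(α_{s'} − α_s) < β_{s'} − β_s. -/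
open Filter

/-- Let `(α_s)` and `(β_s)` be increasing sequences of rationals converging to `α` and
`β` respectively, and let `p > 0` be rational. If there exists `s₀` with
`p(α - α_{s₀}) < β - β_{s₀}`, then there exists `s ≥ s₀` such that for all `s' > s`,
`p(α_{s'} - α_s) < β_{s'} - β_s`. -/
theorem exists_stage_star_one (f g : ℕ → ℚ) (a b : ℝ)
    (hf : StrictMono f) (hg : StrictMono g)
    (hfl : Tendsto (fun s => (f s : ℝ)) atTop (nhds a))
    (hgl : Tendsto (fun s => (g s : ℝ)) atTop (nhds b))
    (p : ℚ) (hp : 0 < p) (s₀ : ℕ)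
    (h : (p : ℝ) * (a - (f s₀ : ℝ)) < b - (g s₀ : ℝ)) :
    ∃ s, s₀ ≤ s ∧ ∀ s' > s, p * (f s' - f s) < g s' - g s := by
  have hlim : Tendsto (fun s => (g s : ℝ) - (p : ℝ) * (f s : ℝ)) atTop (nhds (b - p * a)) :=
    hgl.sub (hfl.const_mul _)
  have hev := hlim.eventually_const_lt
    (show (g s₀ : ℝ) - (p : ℝ) * (f s₀ : ℝ) < b - p * a by linarith)
  obtain ⟨N, hN⟩ := eventually_atTop.1 hev
  have hN' : ∀ n, N ≤ n → g s₀ - p * f s₀ < g n - p * f n := fun n hn => by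
    exact_mod_cast hN n hn
  have hs₀ : s₀ < N := by
    by_contra hc
    exact lt_irrefl _ (hN' s₀ (not_lt.1 hc))
  let S := (Finset.range N).filter (fun n => g n - p * f n ≤ g s₀ - p * f s₀)
  have hmem : s₀ ∈ S := by simp [S, hs₀]
  obtain ⟨m, hm, hmax⟩ := S.exists_max_image id ⟨s₀, hmem⟩
  refine ⟨m, hmax s₀ hmem, fun s' hs' => ?_⟩
  have h1 : g m - p * f m ≤ g s₀ - p * f s₀ := (Finset.mem_filter.1 hm).2
  have h2 : g s₀ - p * f s₀ < g s' - p * f s' := by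
    by_contra hc
    have hlt : s' < N := by
      by_contra hc'
      exact hc (hN' s' (not_lt.1 hc'))
    have h3 : s' ≤ m :=
      hmax s' (Finset.mem_filter.2 ⟨Finset.mem_range.2 hlt, not_lt.1 hc⟩)
    omega
  linarith
end

section
/- Let (α_s) and (β_s) be increasing sequences of rationals converging to reals α and β respectively. If there exists s₀ with β − β_{s₀} < α − α_{s₀}, then there exists s ≥ s₀ such that for all s' > s, β_{s'} − β_s < α_{s'} − α_s. -/
open Filter

/-- Let `(α_s)` and `(β_s)` be increasing sequences of rationals converging to `α` and
`β` respectively. If there exists `s₀` with `β - β_{s₀} < α - α_{s₀}`, then there exists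
`s ≥ s₀` such that for all `s' > s`, `β_{s'} - β_s < α_{s'} - α_s`. -/
theorem exists_stage_star_two (f g : ℕ → ℚ) (a b : ℝ)
    (hf : StrictMono f) (hg : StrictMono g)
    (hfl : Tendsto (fun s => (f s : ℝ)) atTop (nhds a))
    (hgl : Tendsto (fun s => (g s : ℝ)) atTop (nhds b))
    (s₀ : ℕ) (h : b - (g s₀ : ℝ) < a - (f s₀ : ℝ)) :
    ∃ s, s₀ ≤ s ∧ ∀ s' > s, g s' - g s < f s' - f s := by
  by_contra hc
  push Not at hc
  have key : ∀ n : ℕ, ∃ s, s₀ + n ≤ s ∧ f s - g s ≤ f s₀ - g s₀ := by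
    intro n
    induction n with
    | zero => exact ⟨s₀, le_rfl, le_rfl⟩
    | succ k ih =>
      obtain ⟨s, hs, hd⟩ := ih
      obtain ⟨s', hs', hd'⟩ := hc s (by omega)
      exact ⟨s', by omega, by linarith⟩
  have hlim := hfl.sub hgl
  have hev := hlim.eventually (lt_mem_nhds (show (f s₀ : ℝ) - g s₀ < a - b by linarith))
  obtain ⟨N, hN⟩ := eventually_atTop.1 hev
  obtain ⟨s, hs, hd⟩ := key N
  have h1 := hN s (by omega)
  have h2 : (f s : ℝ) - g s ≤ f s₀ - g s₀ := by exact_mod_cast hd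
  linarith
end

section
/- Let (α_s) and (β_s) be computable increasing sequences of rationals converging to reals α and β respectively, and let p be a rational. If there exist only finitely many s with p(α − α_s) < β − β_s, then pα − β is a left-c.e. real. -/
open Filter MeasureTheory Set

namespace RatComp

/-- the raw code of a rational -/
def E (q : ℚ) : ℕ := (@Encodable.encode ℚ Rat.instEncodable q)

/-- code of an integer -/
def zc : ℤ → ℕ
  | Int.ofNat n => 2 * n
  | Int.negSucc n => 2 * n + 1

theorem E_eq (q : ℚ) : E q = Nat.pair (zc q.num) q.den := by
  obtain ⟨n, d, h1, h2⟩ := q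
  cases n <;> rfl

/-- validity of a code -/
def R (m : ℕ) : Prop := 0 < m.unpair.2 ∧ Nat.Coprime ((m.unpair.1 + 1) / 2) m.unpair.2

theorem zc_natAbs (z : ℤ) : (zc z + 1) / 2 = z.natAbs := by
  cases z <;> simp [zc] <;> omega

theorem zc_surj (k : ℕ) : ∃ z, zc z = k := by
  rcases Nat.even_or_odd' k with ⟨c, h | h⟩
  · exact ⟨Int.ofNat c, by simp [zc, h]⟩
  · exact ⟨Int.negSucc c, by simp [zc, h]⟩

theorem range_E : Set.range E = Set.ofPred R := by
  ext m
  constructor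
  · rintro ⟨q, rfl⟩
    show R _
    rw [E_eq]
    simp only [R, Nat.unpair_pair, zc_natAbs]
    exact ⟨q.den_pos, q.reduced⟩
  · rintro ⟨h1, h2⟩
    obtain ⟨z, hz⟩ := zc_surj m.unpair.1
    rw [← hz, zc_natAbs] at h2
    refine ⟨⟨z, m.unpair.2, h1.ne', h2⟩, ?_⟩
    rw [E_eq]
    simp [hz]

theorem E_inj : Function.Injective E := @Encodable.encode_injective ℚ Rat.instEncodable

theorem R_inf : (Set.ofPred R).Infinite := by
  rw [← range_E]
  exact Set.infinite_range_of_injective E_inj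

theorem E_ofNat (n : ℕ) : E (Denumerable.ofNat ℚ n) = Nat.nth R n := by
  let := @Encodable.decidableRangeEncode ℚ Rat.instEncodable
  let : Infinite (Set.range (@Encodable.encode ℚ Rat.instEncodable)) :=
    Infinite.of_injective _ (Equiv.ofInjective _ E_inj).injective
  have h1 : E (Denumerable.ofNat ℚ n) =
      (Nat.Subtype.ofNat (Set.range (@Encodable.encode ℚ Rat.instEncodable)) n : ℕ) := by
    have : Denumerable.ofNat ℚ n =
      (@Encodable.equivRangeEncode ℚ Rat.instEncodable).symm (Nat.Subtype.ofNat _ n) := rfl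
    rw [this]
    exact congrArg Subtype.val
      ((@Encodable.equivRangeEncode ℚ Rat.instEncodable).apply_symm_apply (Nat.Subtype.ofNat _ n))
  rw [h1]
  have hm : StrictMono (fun n => (Nat.Subtype.ofNat
      (Set.range (@Encodable.encode ℚ Rat.instEncodable)) n : ℕ)) :=
    strictMono_nat_of_lt_succ fun n => Nat.Subtype.lt_succ_self _
  have hr : Set.range (fun n => (Nat.Subtype.ofNat
      (Set.range (@Encodable.encode ℚ Rat.instEncodable)) n : ℕ)) = Set.range (Nat.nth R) := by
    rw [Nat.range_nth_of_infinite R_inf, ← range_E]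
    exact Nat.Subtype.coe_comp_ofNat_range
  exact congrFun ((hm.range_inj (Nat.nth_strictMono R_inf)).1 hr) n

theorem comp_of_graph {α : Type*} [Primcodable α] (F : α → ℕ) (g : α → ℕ → Bool)
    (hg : Computable₂ g) (h : ∀ a n, g a n = true ↔ n = F a) : Computable F := by
  refine (Partrec.rfind hg.partrec₂).of_eq fun a => ?_
  rw [PFun.coe_val, Part.eq_some_iff, Nat.mem_rfind]
  constructor
  · simpa using ((h a _).2 rfl).symm
  · intro m hm
    have : g a m = false := by
      rw [Bool.eq_false_iff]
      intro h'
      exact hm.ne ((h a m).1 h')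
    simpa using this.symm

theorem coprime_iff (a b : ℕ) (hb : 0 < b) :
    Nat.Coprime a b ↔ ∀ k < b + 1, a % k = 0 → b % k = 0 → k = 1 := by
  constructor
  · intro h k _ h1 h2
    exact Nat.eq_one_of_dvd_coprimes h (Nat.dvd_of_mod_eq_zero h1) (Nat.dvd_of_mod_eq_zero h2)
  · intro h
    exact h _ (Nat.lt_succ_of_le (Nat.gcd_le_right _ hb))
      (Nat.mod_eq_zero_of_dvd (Nat.gcd_dvd_left _ _)) (Nat.mod_eq_zero_of_dvd (Nat.gcd_dvd_right _ _))

theorem R_prim : PrimrecPred R := by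
  have hu2 : Primrec fun m : ℕ => m.unpair.2 := Primrec.snd.comp Primrec.unpair
  have hu1 : Primrec fun m : ℕ => (m.unpair.1 + 1) / 2 :=
    Primrec.nat_div.comp (Primrec.succ.comp (Primrec.fst.comp Primrec.unpair)) (Primrec.const 2)
  have h0 : PrimrecRel fun (k : ℕ) (m : ℕ) =>
      (¬ ((m.unpair.1 + 1) / 2) % k = 0) ∨ (¬ m.unpair.2 % k = 0) ∨ k = 1 := by
    refine PrimrecPred.or ?_ (PrimrecPred.or ?_ ?_)
    · exact (Primrec.eq.comp (Primrec.nat_mod.comp (hu1.comp Primrec.snd) Primrec.fst)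
        (Primrec.const 0)).not
    · exact (Primrec.eq.comp (Primrec.nat_mod.comp (hu2.comp Primrec.snd) Primrec.fst)
        (Primrec.const 0)).not
    · exact Primrec.eq.comp Primrec.fst (Primrec.const 1)
  have h1 := h0.forall_lt.comp (Primrec.succ.comp hu2) Primrec.id
  have h2 := (Primrec.nat_lt.comp (Primrec.const 0) hu2).and h1
  refine h2.of_eq fun m => ?_
  unfold R
  refine and_congr_right fun hb => ?_
  rw [coprime_iff _ _ hb]
  refine forall_congr' fun k => forall_congr' fun _ => ?_
  show (_ ∨ _ ∨ _) ↔ _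
  tauto

open Classical in
theorem nth_comp : Computable (Nat.nth R) := by
  obtain ⟨_, hR⟩ := R_prim
  have hR : Primrec fun a => decide (R a) := hR.of_eq fun a => by simp
  have hc : Primrec (Nat.count R) := by
    refine (Primrec.nat_rec₁ (f := fun n IH => IH + cond (decide (R n)) 1 0) 0 ?_).of_eq ?_
    · exact Primrec.nat_add.comp Primrec.snd
        (Primrec.cond (hR.comp Primrec.fst) (Primrec.const 1) (Primrec.const 0))
    · intro n
      induction n with
      | zero => simp
      | succ n ih =>
        rw [Nat.count_succ, ← ih]
        by_cases h : R n <;> simp [h]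
  refine comp_of_graph _ (fun n m => decide (R m) && decide (Nat.count R m = n)) ?_ ?_
  · refine Primrec₂.to_comp ?_
    exact Primrec.and.comp (hR.comp Primrec.snd)
      (Primrec.eq.decide.comp (hc.comp Primrec.snd) Primrec.fst)
  · intro n m
    simp only [Bool.and_eq_true, decide_eq_true_eq]
    constructor
    · rintro ⟨h1, rfl⟩
      exact (Nat.nth_count h1).symm
    · rintro rfl
      exact ⟨Nat.nth_mem_of_infinite R_inf n, Nat.count_nth_of_infinite R_inf n⟩

theorem E_comp : Computable E := by
  refine (nth_comp.comp Computable.encode).of_eq fun q => ?_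
  rw [← E_ofNat, Denumerable.ofNat_encode]

/-- positive part of numerator -/
def A (q : ℚ) : ℕ := cond (decide ((E q).unpair.1 % 2 = 0)) ((E q).unpair.1 / 2) 0
/-- negative part of numerator -/
def B (q : ℚ) : ℕ := cond (decide ((E q).unpair.1 % 2 = 0)) 0 (((E q).unpair.1 + 1) / 2)
/-- denominator -/
def D (q : ℚ) : ℕ := (E q).unpair.2

theorem D_comp : Computable D := Computable.snd.comp (Computable.unpair.comp E_comp)

theorem A_comp : Computable A := by
  have h : Primrec fun k : ℕ => cond (decide (k % 2 = 0)) (k / 2) 0 :=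
    Primrec.cond (Primrec.eq.decide.comp (Primrec.nat_mod.comp Primrec.id (Primrec.const 2))
      (Primrec.const 0)) (Primrec.nat_div.comp Primrec.id (Primrec.const 2)) (Primrec.const 0)
  exact h.to_comp.comp (Computable.fst.comp (Computable.unpair.comp E_comp))

theorem B_comp : Computable B := by
  have h : Primrec fun k : ℕ => cond (decide (k % 2 = 0)) 0 ((k + 1) / 2) :=
    Primrec.cond (Primrec.eq.decide.comp (Primrec.nat_mod.comp Primrec.id (Primrec.const 2))
      (Primrec.const 0)) (Primrec.const 0)
        (Primrec.nat_div.comp Primrec.succ (Primrec.const 2))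
  exact h.to_comp.comp (Computable.fst.comp (Computable.unpair.comp E_comp))

theorem D_pos (q : ℚ) : (0 : ℚ) < D q := by
  have : D q = q.den := by simp [D, E_eq]
  rw [this]
  exact_mod_cast q.den_pos

theorem eq_ABD (q : ℚ) : q = ((A q : ℚ) - B q) / D q := by
  have hd : D q = q.den := by simp [D, E_eq]
  have hn : ((A q : ℤ) - B q) = q.num := by
    simp only [A, B, E_eq, Nat.unpair_pair]
    cases q.num with
    | ofNat n => simp [zc]
    | negSucc n =>
      have h1 : (2 * n + 1) % 2 = 1 := by omega
      have h2 : (2 * n + 1 + 1) / 2 = n + 1 := by omega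
      simp [zc, h1, h2, Int.negSucc_eq]
  have hn' : ((A q : ℚ) - B q) = q.num := by exact_mod_cast hn
  rw [hn', hd, Rat.num_div_den]

theorem nmul {α : Type*} [Primcodable α] {f g : α → ℕ} (hf : Computable f) (hg : Computable g) :
    Computable fun a => f a * g a := Primrec.nat_mul.to_comp.comp hf hg

theorem nadd {α : Type*} [Primcodable α] {f g : α → ℕ} (hf : Computable f) (hg : Computable g) :
    Computable fun a => f a + g a := Primrec.nat_add.to_comp.comp hf hg

theorem lin_comp (p : ℚ) : Computable fun z : ℚ × ℚ => p * z.1 - z.2 := by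
  refine Computable.encode_iff.1 (comp_of_graph _ (fun z n =>
    decide (A (Denumerable.ofNat ℚ n) * (D z.2 * (D p * D z.1))
        + A z.2 * (D (Denumerable.ofNat ℚ n) * (D p * D z.1))
        + (A p * B z.1 + B p * A z.1) * (D (Denumerable.ofNat ℚ n) * D z.2) =
      B (Denumerable.ofNat ℚ n) * (D z.2 * (D p * D z.1))
        + B z.2 * (D (Denumerable.ofNat ℚ n) * (D p * D z.1))
        + (A p * A z.1 + B p * B z.1) * (D (Denumerable.ofNat ℚ n) * D z.2))) ?_ ?_)
  · have hr : Computable fun w : (ℚ × ℚ) × ℕ => Denumerable.ofNat ℚ w.2 :=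
      (Computable.ofNat ℚ).comp Computable.snd
    have hx : Computable fun w : (ℚ × ℚ) × ℕ => w.1.1 := Computable.fst.comp Computable.fst
    have hy : Computable fun w : (ℚ × ℚ) × ℕ => w.1.2 := Computable.snd.comp Computable.fst
    have ar := A_comp.comp hr
    have br := B_comp.comp hr
    have dr := D_comp.comp hr
    have ax := A_comp.comp hx
    have bx := B_comp.comp hx
    have dx := D_comp.comp hx
    have ay := A_comp.comp hy
    have byy := B_comp.comp hy
    have dy := D_comp.comp hy
    have c (n : ℕ) : Computable fun w : (ℚ × ℚ) × ℕ => n := Computable.const n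
    refine (Primrec.eq (α := ℕ)).decide.to_comp.comp ?_ ?_
    · exact nadd (nadd (nmul ar (nmul dy (nmul (c _) dx))) (nmul ay (nmul dr (nmul (c _) dx))))
        (nmul (nadd (nmul (c _) bx) (nmul (c _) ax)) (nmul dr dy))
    · exact nadd (nadd (nmul br (nmul dy (nmul (c _) dx))) (nmul byy (nmul dr (nmul (c _) dx))))
        (nmul (nadd (nmul (c _) ax) (nmul (c _) bx)) (nmul dr dy))
  · rintro ⟨x, y⟩ n
    rw [decide_eq_true_eq, ← Denumerable.encode_ofNat (α := ℚ) n]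
    refine Iff.trans ?_ ((Denumerable.eqv ℚ).injective.eq_iff
      (a := Denumerable.ofNat ℚ n) (b := p * x - y)).symm
    rw [Denumerable.ofNat_encode]
    generalize Denumerable.ofNat ℚ n = r
    dsimp only
    have e1 := eq_ABD r
    have e2 := eq_ABD x
    have e3 := eq_ABD y
    have e4 := eq_ABD p
    have d1 := (D_pos r)
    have d2 := (D_pos x)
    have d3 := (D_pos y)
    have d4 := (D_pos p)
    rw [← Nat.cast_inj (R := ℚ)]
    push_cast
    generalize (A r : ℚ) = ar at *
    generalize (B r : ℚ) = br at *
    generalize (D r : ℚ) = dr at *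
    generalize (A x : ℚ) = ax at *
    generalize (B x : ℚ) = bx at *
    generalize (D x : ℚ) = dx at *
    generalize (A y : ℚ) = ay at *
    generalize (B y : ℚ) = yb at *
    generalize (D y : ℚ) = dy at *
    generalize (A p : ℚ) = ap at *
    generalize (B p : ℚ) = bp at *
    generalize (D p : ℚ) = dp at *
    have n1 := d1.ne'
    have n2 := d2.ne'
    have n3 := d3.ne'
    have n4 := d4.ne'
    rw [eq_div_iff n1] at e1
    rw [eq_div_iff n2] at e2
    rw [eq_div_iff n3] at e3
    rw [eq_div_iff n4] at e4
    have key : (ar * (dy * (dp * dx)) + ay * (dr * (dp * dx)) + (ap * bx + bp * ax) * (dr * dy))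
      - (br * (dy * (dp * dx)) + yb * (dr * (dp * dx)) + (ap * ax + bp * bx) * (dr * dy))
      = (r - (p * x - y)) * (dr * dx * dy * dp) := by
      have : ar = r * dr + br := by linarith
      subst this
      have : ax = x * dx + bx := by linarith
      subst this
      have : ay = y * dy + yb := by linarith
      subst this
      have : ap = p * dp + bp := by linarith
      subst this
      ring
    rw [← sub_eq_zero, key, ← sub_eq_zero (a := r)]
    simp [n1, n2, n3, n4]

theorem max_comp : Computable₂ fun x y : ℚ => max x y := by
  have hx : Computable fun w : ℚ × ℚ => w.1 := Computable.fst
  have hy : Computable fun w : ℚ × ℚ => w.2 := Computable.snd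
  have h := Computable.cond (Primrec.nat_le.decide.to_comp.comp
    (nadd (nmul (A_comp.comp hx) (D_comp.comp hy)) (nmul (B_comp.comp hy) (D_comp.comp hx)))
    (nadd (nmul (A_comp.comp hy) (D_comp.comp hx)) (nmul (B_comp.comp hx) (D_comp.comp hy))))
    hy hx
  refine h.of_eq ?_
  rintro ⟨x, y⟩
  dsimp only
  have key : A x * D y + B y * D x ≤ A y * D x + B x * D y ↔ x ≤ y := by
    conv_rhs => rw [eq_ABD x, eq_ABD y, div_le_div_iff₀ (D_pos x) (D_pos y)]
    rw [← Nat.cast_le (α := ℚ)]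
    push_cast
    constructor <;> intro h <;> linarith
  by_cases hxy : x ≤ y
  · simp [key, hxy]
  · simp [key, hxy, (not_le.1 hxy).le]

theorem runmax (c : ℕ → ℚ) (hc : Computable c) : ∃ m : ℕ → ℚ, Computable m ∧ m 0 = c 0 ∧
    ∀ n, m (n + 1) = max (m n) (c (n + 1)) := by
  have hh : Computable₂ (fun (_ : ℕ) (z : ℕ × ℚ) => max z.2 (c (z.1 + 1))) :=
    max_comp.comp (g := fun w : ℕ × (ℕ × ℚ) => w.2.2) (h := fun w => c (w.2.1 + 1))
      (Computable.snd.comp Computable.snd)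
      (hc.comp (Computable.succ.comp (Computable.fst.comp Computable.snd)))
  exact ⟨_, Computable.nat_rec Computable.id (Computable.const (c 0)) hh, rfl, fun n => rfl⟩

theorem lin_shift (f g : ℕ → ℚ) (p : ℚ) (k : ℕ) (hf : Computable f) (hg : Computable g) :
    Computable fun n => p * f (n + k) - g (n + k) := by
  have hs : Computable fun n : ℕ => n + k := nadd Computable.id (Computable.const k)
  have h1 : Computable fun n : ℕ => f (n + k) := hf.comp hs
  have h2 : Computable fun n : ℕ => g (n + k) := hg.comp hs
  have h3 : Computable fun n : ℕ => (f (n + k), g (n + k)) := Computable.pair h1 h2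
  have h4 := (lin_comp p).comp h3
  exact h4

end RatComp

/-- Let `(α_s)` and `(β_s)` be computable increasing sequences of rationals converging
to `α` and `β` respectively, and let `p` be rational. If there exist only finitely many
`s` with `p(α - α_s) < β - β_s`, then `pα - β` is a left-c.e. real. -/
theorem leftCE_of_finite (f g : ℕ → ℚ) (a b : ℝ)
    (hfc : Computable f) (hfm : Monotone f)
    (hfl : Tendsto (fun s => (f s : ℝ)) atTop (nhds a))
    (hgc : Computable g) (hgm : Monotone g)
    (hgl : Tendsto (fun s => (g s : ℝ)) atTop (nhds b))
    (p : ℚ)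
    (h : {s : ℕ | (p : ℝ) * (a - (f s : ℝ)) < b - (g s : ℝ)}.Finite) :
    LeftCE ((p : ℝ) * a - b) := by
  obtain ⟨M, hM⟩ := h.bddAbove
  have hle : ∀ s, M + 1 ≤ s → (p : ℝ) * f s - g s ≤ p * a - b := by
    intro s hs
    by_contra hc
    have : s ≤ M := hM (show (p : ℝ) * (a - (f s : ℝ)) < b - (g s : ℝ) by linarith)
    omega
  let c : ℕ → ℚ := fun n => p * f (n + (M + 1)) - g (n + (M + 1))
  have hcc : Computable c := RatComp.lin_shift f g p (M + 1) hfc hgc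
  obtain ⟨m, hmc, hm0, hms⟩ := RatComp.runmax c hcc
  have hcle : ∀ n, (c n : ℝ) ≤ p * a - b := by
    intro n
    have := hle (n + (M + 1)) (by omega)
    simpa [c] using this
  have hmle : ∀ n, (m n : ℝ) ≤ p * a - b := by
    intro n
    induction n with
    | zero => rw [hm0]; exact hcle 0
    | succ n ih =>
      rw [hms, Rat.cast_max]
      exact max_le ih (hcle _)
  have hcm : ∀ n, c n ≤ m n := by
    intro n
    cases n with
    | zero => exact hm0.ge
    | succ n => rw [hms]; exact le_max_right _ _
  have hcl : Tendsto (fun n => (c n : ℝ)) atTop (nhds (p * a - b)) := by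
    have h1 := ((hfl.const_mul (p : ℝ)).sub hgl).comp (tendsto_add_atTop_nat (M + 1))
    refine h1.congr fun n => ?_
    simp [c]
  refine ⟨m, hmc, monotone_nat_of_le_succ fun n => ?_, ?_⟩
  · rw [hms]; exact le_max_left _ _
  · exact tendsto_of_tendsto_of_tendsto_of_le_of_le hcl tendsto_const_nhds
      (fun n => Rat.cast_le.2 (hcm n)) hmle
end

section
/- Let (α_s) and (β_s) be computable increasing sequences of rationals converging to reals α and β respectively. If there exist only finitely many s with β − β_s < α − α_s, then α − β is a right-c.e. real. -/
open Filter MeasureTheory Set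

def qcode (q : ℚ) : ℕ := Nat.pair (Equiv.intEquivNat q.num) q.den

theorem qcode_eq (q : ℚ) : qcode q = @Encodable.encode ℚ Rat.instEncodable q := rfl

instance qinf : Infinite (Set.range (@Encodable.encode ℚ Rat.instEncodable)) :=
    Infinite.of_injective _ (Equiv.ofInjective _ (@Encodable.encode_injective ℚ Rat.instEncodable)).injective

theorem qcode_ofNat (n : ℕ) : qcode (Denumerable.ofNat ℚ n) =
    (@Nat.Subtype.ofNat (Set.range (@Encodable.encode ℚ Rat.instEncodable)) 
     (@Encodable.decidableRangeEncode ℚ Rat.instEncodable) qinf n : ℕ) := by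
  have h : Denumerable.ofNat ℚ n = (@Encodable.equivRangeEncode ℚ Rat.instEncodable).symm 
    (@Nat.Subtype.ofNat (Set.range (@Encodable.encode ℚ Rat.instEncodable)) 
     (@Encodable.decidableRangeEncode ℚ Rat.instEncodable) qinf n) := by
    apply Denumerable.ofNat_of_decode
    rfl
  rw [h, qcode_eq]
  exact congrArg Subtype.val ((@Encodable.equivRangeEncode ℚ Rat.instEncodable).apply_symm_apply _)

theorem subtype_succ_val {s : Set ℕ} [Infinite s] [DecidablePred (· ∈ s)] (x : s) (y : ℕ)
    (hy : (x : ℕ) = y) (h : ∃ m, y + m + 1 ∈ s) [DecidablePred (fun m => y + m + 1 ∈ s)] :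
    (Nat.Subtype.succ x : ℕ) = y + Nat.find h + 1 := by
  subst hy
  unfold Nat.Subtype.succ
  simp only
  congr!

theorem qcode_succ (n : ℕ) : ∃ h : ∃ m, (qcode (Denumerable.ofNat ℚ n) + m + 1) ∈ Set.range qcode,
   ∀ inst : DecidablePred (fun m => (qcode (Denumerable.ofNat ℚ n) + m + 1) ∈ Set.range qcode), 
   qcode (Denumerable.ofNat ℚ (n+1)) = qcode (Denumerable.ofNat ℚ n) + Nat.find h + 1 := by
  have key := qcode_ofNat (n+1)
  have k0 := qcode_ofNat n
  have h := @Nat.Subtype.exists_succ _ qinf (@Nat.Subtype.ofNat (Set.range (@Encodable.encode ℚ Rat.instEncodable)) 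
     (@Encodable.decidableRangeEncode ℚ Rat.instEncodable) qinf n)
  rw [← k0] at h
  refine ⟨h, fun inst => ?_⟩
  rw [key, Nat.Subtype.ofNat]
  exact @subtype_succ_val _ qinf (@Encodable.decidableRangeEncode ℚ Rat.instEncodable) _ _ k0.symm h inst

theorem mem_range_qcode (m : ℕ) : m ∈ Set.range qcode ↔
    0 < m.unpair.2 ∧ ∀ k < m.unpair.2 + 1, ((m.unpair.1 + 1)/2 % k = 0 ∧ m.unpair.2 % k = 0) → k = 1 := by
  have hab : ∀ z : ℤ, (Equiv.intEquivNat z + 1) / 2 = z.natAbs := by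
    intro z
    cases z with
    | ofNat n => show (2 * n + 1) / 2 = n; omega
    | negSucc n => show (2 * n + 1 + 1) / 2 = n + 1; omega
  constructor
  · rintro ⟨q, rfl⟩
    simp only [qcode, Nat.unpair_pair, hab]
    refine ⟨q.den_pos, fun k _ hk => ?_⟩
    have := q.reduced
    exact Nat.eq_one_of_dvd_coprimes this (Nat.dvd_of_mod_eq_zero hk.1) (Nat.dvd_of_mod_eq_zero hk.2)
  · rintro ⟨h1, h2⟩
    have hc : Nat.Coprime (Equiv.intEquivNat.symm m.unpair.1).natAbs m.unpair.2 := by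
      rw [← hab, Equiv.apply_symm_apply]
      apply h2
      · exact Nat.lt_succ_of_le (Nat.gcd_le_right _ h1)
      · exact ⟨Nat.mod_eq_zero_of_dvd (Nat.gcd_dvd_left _ _), Nat.mod_eq_zero_of_dvd (Nat.gcd_dvd_right _ _)⟩
    refine ⟨⟨_, _, h1.ne', hc⟩, ?_⟩
    simp [qcode]

theorem primrec_range_qcode : PrimrecPred (fun m => m ∈ Set.range qcode) := by
  have h1 : PrimrecRel (fun (k : ℕ) (m : ℕ) => ((m.unpair.1 + 1)/2 % k = 0 ∧ m.unpair.2 % k = 0) → k = 1) := by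
    have u1 : Primrec (fun p : ℕ × ℕ => (p.2.unpair.1 + 1)/2) :=
      Primrec.nat_div.comp (Primrec.succ.comp (Primrec.fst.comp (Primrec.unpair.comp Primrec.snd))) (Primrec.const 2)
    have u2 : Primrec (fun p : ℕ × ℕ => p.2.unpair.2) :=
      (Primrec.snd.comp (Primrec.unpair.comp Primrec.snd))
    have e1 : PrimrecPred (fun p : ℕ × ℕ => (p.2.unpair.1 + 1)/2 % p.1 = 0) :=
      Primrec.eq.comp (Primrec.nat_mod.comp u1 Primrec.fst) (Primrec.const 0)
    have e2 : PrimrecPred (fun p : ℕ × ℕ => p.2.unpair.2 % p.1 = 0) :=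
      Primrec.eq.comp (Primrec.nat_mod.comp u2 Primrec.fst) (Primrec.const 0)
    have e3 : PrimrecPred (fun p : ℕ × ℕ => p.1 = 1) :=
      Primrec.eq.comp Primrec.fst (Primrec.const 1)
    exact ((e1.and e2).not.or e3).of_eq (fun p => by tauto)
  have u : Primrec (fun m : ℕ => m.unpair.2) := Primrec.snd.comp Primrec.unpair
  have h2 := h1.forall_lt.comp (Primrec.succ.comp u) Primrec.id
  exact ((Primrec.nat_lt.comp (Primrec.const 0) u).and h2).of_eq (fun m => (mem_range_qcode m).symm)

theorem find_computable {α : Type*} [Primcodable α] (t : α → ℕ → Bool) (ht : Computable₂ t)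
    (f : α → ℕ) (hf : ∀ a, t a (f a) = true) (hm : ∀ a, ∀ k < f a, t a k = false) : Computable f := by
  have := Partrec.rfind (α := α) (p := fun a n => (Part.some (t a n))) ht
  refine Partrec.of_eq this (fun a => ?_)
  refine Part.eq_some_iff.2 ?_
  refine Nat.mem_rfind.2 ⟨?_, fun {k} hk => ?_⟩
  · simpa using (hf a).symm
  · simpa using (hm a k hk).symm

theorem qcode_ofNat_computable : Computable (fun n => qcode (Denumerable.ofNat ℚ n)) := by
  classical
  have hS := primrec_range_qcode
  have hn : ∀ x : ℕ, (∃ m, x + m + 1 ∈ Set.range qcode) := by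
    intro x
    refine ⟨qcode (((x:ℤ)+1 : ℤ) : ℚ) - (x+1), ⟨(((x:ℤ)+1 : ℤ) : ℚ), ?_⟩⟩
    · have h1 : x + 1 ≤ qcode (((x:ℤ)+1 : ℤ) : ℚ) := by
        unfold qcode
        refine le_trans ?_ (Nat.left_le_pair _ _)
        rw [Rat.num_intCast]
        show x + 1 ≤ 2 * (x+1)
        omega
      omega
  have hfind : Computable (fun x => Nat.find (hn x)) := by
    apply find_computable (fun x m => decide (x + m + 1 ∈ Set.range qcode))
    · have : PrimrecPred (fun p : ℕ × ℕ => p.1 + p.2 + 1 ∈ Set.range qcode) :=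
        hS.comp (Primrec.succ.comp (Primrec.nat_add.comp Primrec.fst Primrec.snd))
      exact this.decide.to_comp
    · intro a; exact decide_eq_true (Nat.find_spec (hn a))
    · intro a k hk; exact decide_eq_false (Nat.find_min (hn a) hk)
  have hrec := Computable.nat_rec (α := ℕ) (σ := ℕ) (f := id) (g := fun _ => qcode (Denumerable.ofNat ℚ 0))
    (h := fun _ p => p.2 + Nat.find (hn p.2) + 1) Computable.id (Computable.const _)
    (by
      have s : Computable (fun p : ℕ × ℕ × ℕ => p.2.2) := Computable.snd.comp Computable.snd
      exact Computable.succ.comp (Primrec.nat_add.to_comp.comp s (hfind.comp s)))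
  refine hrec.of_eq (fun n => ?_)
  induction n with
  | zero => rfl
  | succ n ih =>
    obtain ⟨h, h'⟩ := qcode_succ n
    rw [h' (fun _ => Classical.dec _)]
    simp only [id] at ih ⊢
    rw [ih]

theorem qcode_computable : Computable qcode :=
  (qcode_ofNat_computable.comp Computable.encode).of_eq (fun q => by simp only [Denumerable.ofNat_encode])

theorem pos_computable : Computable (fun q : ℚ => q.num.toNat) := by
  have h : Primrec (fun c : ℕ => bif (c.unpair.1).bodd then 0 else c.unpair.1.div2) := by
    have u : Primrec (fun m : ℕ => m.unpair.1) := Primrec.fst.comp Primrec.unpair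
    exact Primrec.cond (Primrec.nat_bodd.comp u) (Primrec.const 0) (Primrec.nat_div2.comp u)
  refine (h.to_comp.comp qcode_computable).of_eq (fun q => ?_)
  simp only [qcode, Nat.unpair_pair]
  cases q.num with
  | ofNat n =>
    rw [show Equiv.intEquivNat (Int.ofNat n) = 2 * n from rfl]
    simp [Nat.div2_val]
  | negSucc n =>
    rw [show Equiv.intEquivNat (Int.negSucc n) = 2 * n + 1 from rfl]
    simp

theorem neg_computable : Computable (fun q : ℚ => (-q.num).toNat) := by
  have h : Primrec (fun c : ℕ => bif (c.unpair.1).bodd then c.unpair.1.div2 + 1 else 0) := by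
    have u : Primrec (fun m : ℕ => m.unpair.1) := Primrec.fst.comp Primrec.unpair
    exact Primrec.cond (Primrec.nat_bodd.comp u) (Primrec.succ.comp (Primrec.nat_div2.comp u)) (Primrec.const 0)
  refine (h.to_comp.comp qcode_computable).of_eq (fun q => ?_)
  simp only [qcode, Nat.unpair_pair]
  cases q.num with
  | ofNat n =>
    rw [show Equiv.intEquivNat (Int.ofNat n) = 2 * n from rfl]
    simp
  | negSucc n =>
    rw [show Equiv.intEquivNat (Int.negSucc n) = 2 * n + 1 from rfl]
    simp [Nat.div2_val]

theorem den_computable : Computable (fun q : ℚ => q.den) :=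
  ((Primrec.snd.comp Primrec.unpair).to_comp.comp qcode_computable).of_eq (fun q => by simp [qcode])

theorem rat_rep (q : ℚ) : q = ((q.num.toNat : ℚ) - ((-q.num).toNat : ℚ)) / q.den := by
  have : ((q.num.toNat : ℚ) - ((-q.num).toNat : ℚ)) = q.num := by
    have := Int.toNat_sub_toNat_neg q.num
    exact_mod_cast congrArg (Int.cast (R := ℚ)) this
  rw [this, Rat.num_div_den]

/-- Numerator comparison data. -/
theorem le_computable : Computable₂ (fun q r : ℚ => decide (q ≤ r)) := by
  have add := Primrec.nat_add.to_comp
  have mul := Primrec.nat_mul.to_comp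
  have p1 : Computable (fun x : ℚ × ℚ => x.1.num.toNat) := pos_computable.comp Computable.fst
  have n1 : Computable (fun x : ℚ × ℚ => (-x.1.num).toNat) := neg_computable.comp Computable.fst
  have d1 : Computable (fun x : ℚ × ℚ => x.1.den) := den_computable.comp Computable.fst
  have p2 : Computable (fun x : ℚ × ℚ => x.2.num.toNat) := pos_computable.comp Computable.snd
  have n2 : Computable (fun x : ℚ × ℚ => (-x.2.num).toNat) := neg_computable.comp Computable.snd
  have d2 : Computable (fun x : ℚ × ℚ => x.2.den) := den_computable.comp Computable.snd
  have A := add.comp (mul.comp p1 d2) (mul.comp n2 d1)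
  have B := add.comp (mul.comp p2 d1) (mul.comp n1 d2)
  have le : Computable₂ (fun a b : ℕ => decide (a ≤ b)) := Primrec.nat_le.decide.to_comp
  refine Computable.of_eq (le.comp A B) (fun x => ?_)
  obtain ⟨q, r⟩ := x
  simp only [decide_eq_decide]
  conv_rhs => rw [rat_rep q, rat_rep r]
  have hq : (0:ℚ) < q.den := by exact_mod_cast q.den_pos
  have hr : (0:ℚ) < r.den := by exact_mod_cast r.den_pos
  rw [div_le_div_iff₀ hq hr, ← Nat.cast_le (α := ℚ)]
  push_cast
  constructor <;> intro h <;> linarith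

theorem sub_computable : Computable₂ (fun q r : ℚ => q - r) := by
  have add := Primrec.nat_add.to_comp
  have mul := Primrec.nat_mul.to_comp
  have c1 : Computable (fun x : (ℚ × ℚ) × ℕ => x.1.1) := Computable.fst.comp Computable.fst
  have c2 : Computable (fun x : (ℚ × ℚ) × ℕ => x.1.2) := Computable.snd.comp Computable.fst
  have c3 : Computable (fun x : (ℚ × ℚ) × ℕ => Denumerable.ofNat ℚ x.2) :=
    (Primrec.ofNat ℚ).to_comp.comp Computable.snd
  have p1 := pos_computable.comp c1
  have n1 := neg_computable.comp c1
  have d1 := den_computable.comp c1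
  have p2 := pos_computable.comp c2
  have n2 := neg_computable.comp c2
  have d2 := den_computable.comp c2
  have p3 := pos_computable.comp c3
  have n3 := neg_computable.comp c3
  have d3 := den_computable.comp c3
  have A := add.comp (mul.comp p3 (mul.comp d1 d2)) (mul.comp (add.comp (mul.comp n1 d2) (mul.comp p2 d1)) d3)
  have B := add.comp (mul.comp n3 (mul.comp d1 d2)) (mul.comp (add.comp (mul.comp p1 d2) (mul.comp n2 d1)) d3)
  have eq : Computable₂ (fun a b : ℕ => decide (a = b)) := (Primrec.eq (α := ℕ)).decide.to_comp
  have C := eq.comp A B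
  have D : Computable₂ (fun (x : ℚ × ℚ) (k : ℕ) => decide (Denumerable.ofNat ℚ k = x.1 - x.2)) := by
    refine Computable.of_eq C (fun x => ?_)
    obtain ⟨⟨q, r⟩, k⟩ := x
    simp only [decide_eq_decide]
    generalize Denumerable.ofNat ℚ k = s
    conv_rhs => rw [rat_rep q, rat_rep r, rat_rep s]
    have hq : (q.den : ℚ) ≠ 0 := by exact_mod_cast q.den_nz
    have hr : (r.den : ℚ) ≠ 0 := by exact_mod_cast r.den_nz
    have hs : (s.den : ℚ) ≠ 0 := by exact_mod_cast s.den_nz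
    rw [div_sub_div _ _ hq hr, div_eq_div_iff hs (mul_ne_zero hq hr), ← Nat.cast_inj (R := ℚ)]
    push_cast
    constructor <;> intro h <;> linarith
  have E : Computable (fun x : ℚ × ℚ => @Encodable.encode ℚ Rat.instDenumerable.toEncodable (x.1 - x.2)) := by
    apply find_computable _ D
    · intro a; simp only [Denumerable.ofNat_encode, decide_true]
    · intro a k hk
      simp only [decide_eq_false_iff_not]
      intro h
      rw [← h] at hk
      rw [Denumerable.encode_ofNat] at hk
      exact lt_irrefl _ hk
  exact ((Primrec.ofNat ℚ).to_comp.comp E).of_eq (fun x => by simp only [Denumerable.ofNat_encode])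

theorem rightCE_aux (f g : ℕ → ℚ) (a b : ℝ)
    (hfc : Computable f) 
    (hfl : Tendsto (fun s => (f s : ℝ)) atTop (nhds a))
    (hgc : Computable g) 
    (hgl : Tendsto (fun s => (g s : ℝ)) atTop (nhds b))
    (h : {s : ℕ | b - (g s : ℝ) < a - (f s : ℝ)}.Finite) :
    ∃ m : ℕ → ℚ, Computable m ∧ Antitone m ∧
    Tendsto (fun n => (m n : ℝ)) atTop (nhds (a - b)) := by
  obtain ⟨N, hN⟩ := h.bddAbove
  have hN' : ∀ s, N < s → a - b ≤ ((f s - g s : ℚ) : ℝ) := by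
    intro s hs
    by_contra hc
    push_cast at hc
    have : s ≤ N := hN (by show b - (g s : ℝ) < a - (f s : ℝ); linarith)
    omega
  let u : ℕ → ℚ := fun n => f (n + (N + 1)) - g (n + (N + 1))
  have hu : Computable u := by
    have sh : Computable (fun n => n + (N + 1)) :=
      Primrec.nat_add.to_comp.comp Computable.id (Computable.const (N+1))
    exact sub_computable.comp (hfc.comp sh) (hgc.comp sh)
  have hul : Tendsto (fun n => (u n : ℝ)) atTop (nhds (a - b)) := by
    have := (hfl.sub hgl).comp (tendsto_add_atTop_nat (N+1))
    refine this.congr (fun n => ?_)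
    simp [u]
  have hub : ∀ n, a - b ≤ (u n : ℝ) := fun n => hN' _ (by omega)
  let m : ℕ → ℚ := fun n => Nat.rec (u 0) (fun k r => if r ≤ u (k+1) then r else u (k+1)) n
  have hs : ∀ n, m (n+1) = min (m n) (u (n+1)) := fun n => (min_def _ _).symm
  refine ⟨m, ?_, ?_, ?_⟩
  · have c2 : Computable (fun p : ℕ × ℕ × ℚ => u (p.2.1 + 1)) :=
      hu.comp (Computable.succ.comp (Computable.fst.comp Computable.snd))
    have c1 : Computable (fun p : ℕ × ℕ × ℚ => p.2.2) := Computable.snd.comp Computable.snd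
    refine (Computable.nat_rec (α := ℕ) (σ := ℚ) (f := id) (g := fun _ => u 0)
      (h := fun _ p => bif decide (p.2 ≤ u (p.1+1)) then p.2 else u (p.1+1)) Computable.id
      (Computable.const _) (Computable.cond (le_computable.comp c1 c2) c1 c2)).of_eq (fun n => ?_)
    simp only [m, id, Bool.cond_decide]
  · exact antitone_nat_of_succ_le (fun n => by rw [hs]; exact min_le_left _ _)
  · refine tendsto_of_tendsto_of_tendsto_of_le_of_le tendsto_const_nhds hul ?_ ?_
    · intro n
      induction n with
      | zero => exact hub 0
      | succ n ih =>
        simp only [hs, Rat.cast_min]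
        exact le_min ih (hub _)
    · intro n
      cases n with
      | zero => exact le_rfl
      | succ n =>
        simp only [hs, Rat.cast_min]
        exact min_le_right _ _

/-- Let `(α_s)` and `(β_s)` be computable increasing sequences of rationals converging
to `α` and `β` respectively. If there exist only finitely many `s` with
`β - β_s < α - α_s`, then `α - β` is a right-c.e. real. -/
theorem rightCE_of_finite (f g : ℕ → ℚ) (a b : ℝ)
    (hfc : Computable f) (hfm : Monotone f)
    (hfl : Tendsto (fun s => (f s : ℝ)) atTop (nhds a))
    (hgc : Computable g) (hgm : Monotone g)
    (hgl : Tendsto (fun s => (g s : ℝ)) atTop (nhds b))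
    (h : {s : ℕ | b - (g s : ℝ) < a - (f s : ℝ)}.Finite) :
    RightCE (a - b) := by
  exact rightCE_aux f g a b hfc hfl hgc hgl h
end
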